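/- arXiv:0909.4481 — 2 statements merged into one kernel-verified Lean document; each statement's English description precedes it below -/
import Mathlib

section
/- Let p ∈ (1,∞) and A ≥ 0. Let T be a linear operator defined on the linear span of the Haar functions, with values in L¹_loc(ℝⁿ), such that all pairings ⟨h^θ_J, T h^ζ_I⟩ (I, J ∈ 𝒟, θ, ζ ∈ {0,1}ⁿ) are defined and: (i) for every I ∈ 𝒟 and η ∈ {0,1}ⁿ∖{0}, Σ_{m∈ℤⁿ} ⟨h⁰_{I∔m}, T h^η_I⟩ = 0 (i.e. T*1 = 0) and Σ_{m∈ℤⁿ} ⟨h^η_I, T h⁰_{I∔m}⟩ = 0 (i.e. T1 = 0), both series converging absolutely; (ii) for every (θ,ζ) ∈ {0,1}^{2n}∖{(0,0)}: Σ_{m∈ℤⁿ} sup_{I∈𝒟} |⟨h^θ_{I∔m}, T h^ζ_I⟩| · log(2+|m|) ≤ A. Then for all f, g with finite Haar expansion, |⟨g, Tf⟩| ≤ C A ‖f‖_{L^p} ‖g‖_{L^{p′}}, with C depending only on n and p; in particular T extends to a bounded operator on L^p(ℝⁿ) of norm at most C A. -/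
open MeasureTheory

noncomputable section

open Classical in
/-- Classical indicator of a proposition. -/
def indR (P : Prop) : ℝ := if P then 1 else 0

/-- The real sign associated to a boolean. -/
def sgnB (b : Bool) : ℝ := if b then 1 else -1

/-- The `ℓ∞` norm of an integer vector, as a real number. -/
def inorm {n : ℕ} (m : Fin n → ℤ) : ℝ := ‖(fun i => (m i : ℝ) : Fin n → ℝ)‖

/-- The dyadic cube `2^{-k}([0,1)^n + m)` of generation `k` in `ℝ^n` (with the `ℓ∞` metric). -/
def dyadicCube (n : ℕ) (k : ℤ) (m : Fin n → ℤ) : Set (Fin n → ℝ) :=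
  {x | ∀ i, (2:ℝ) ^ (-k) * m i ≤ x i ∧ x i < (2:ℝ) ^ (-k) * (m i + 1)}

/-- The side length `2^{-k}` of a dyadic cube of generation `k`. -/
def sideLen (k : ℤ) : ℝ := (2:ℝ) ^ (-k)

/-- One-dimensional Haar function on the dyadic interval `2^{-k}[m, m+1)`:
the non-cancellative `h⁰` for `η = false`, the cancellative `h¹` for `η = true`. -/
def haar1D (k : ℤ) (m : ℤ) (η : Bool) (t : ℝ) : ℝ :=
  (Real.sqrt ((2:ℝ) ^ (-k)))⁻¹ *
    (if η then
        (Set.Ico ((2:ℝ) ^ (-k) * m) ((2:ℝ) ^ (-k) * (m + 1/2))).indicator 1 t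
          - (Set.Ico ((2:ℝ) ^ (-k) * (m + 1/2)) ((2:ℝ) ^ (-k) * (m + 1))).indicator 1 t
      else (Set.Ico ((2:ℝ) ^ (-k) * m) ((2:ℝ) ^ (-k) * (m + 1))).indicator 1 t)

/-- The Haar function `h^η_I` for the dyadic cube `I` indexed by `(k, m)`. -/
def haarFn (n : ℕ) (k : ℤ) (m : Fin n → ℤ) (η : Fin n → Bool) (x : Fin n → ℝ) : ℝ :=
  ∏ i, haar1D k (m i) (η i) (x i)

/-- The non-cancellative Haar function `h⁰_I = |I|^{-1/2} 1_I`. -/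
def haarZero (n : ℕ) (k : ℤ) (m : Fin n → ℤ) : (Fin n → ℝ) → ℝ :=
  haarFn n k m (fun _ => false)

/-- The pairing `⟨g, f⟩ = ∫ g f dx`. -/
def pairing {n : ℕ} (g f : (Fin n → ℝ) → ℝ) : ℝ := ∫ x, g x * f x

/-- A normalised standard kernel with Hölder exponent `γ` (with respect to the `ℓ∞` metric). -/
structure IsNormalisedKernel (n : ℕ) (γ : ℝ) (K : (Fin n → ℝ) → (Fin n → ℝ) → ℝ) : Prop where
  size : ∀ x y, x ≠ y → |K x y| ≤ dist x y ^ (-(n:ℝ))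
  smooth : ∀ x y h, 2 * ‖h‖ < dist x y →
    |K (x + h) y - K x y| + |K x (y + h) - K x y| ≤ ‖h‖ ^ γ * dist x y ^ (-(n:ℝ) - γ)

/-- The singular integral `Tf(x) = ∫ K(x,y) f(y) dy`. -/
def czIntegral {n : ℕ} (K : (Fin n → ℝ) → (Fin n → ℝ) → ℝ) (f : (Fin n → ℝ) → ℝ)
    (x : Fin n → ℝ) : ℝ := ∫ y, K x y * f y

/-- The truncated singular integral `T_ε f(x) = ∫_{|y-x|>ε} K(x,y) f(y) dy`. -/
def czTrunc {n : ℕ} (K : (Fin n → ℝ) → (Fin n → ℝ) → ℝ) (ε : ℝ) (f : (Fin n → ℝ) → ℝ)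
    (x : Fin n → ℝ) : ℝ := ∫ y in {y | ε < dist x y}, K x y * f y

/-- The dyadic conditional expectation `E_k f`. -/
def dyadicE (n : ℕ) (k : ℤ) (f : (Fin n → ℝ) → ℝ) (x : Fin n → ℝ) : ℝ :=
  (2:ℝ) ^ (k * (n:ℤ)) * ∫ y in dyadicCube n k (fun i => ⌊(2:ℝ) ^ k * x i⌋), f y

/-- The dyadic martingale difference `D_k f = E_{k+1} f - E_k f`. -/
def dyadicD (n : ℕ) (k : ℤ) (f : (Fin n → ℝ) → ℝ) (x : Fin n → ℝ) : ℝ :=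
  dyadicE n (k+1) f x - dyadicE n k f x

/-- The centre of the dyadic cube indexed by `(k, m)`. -/
def cubeCenter (n : ℕ) (k : ℤ) (m : Fin n → ℤ) : Fin n → ℝ :=
  fun i => (2:ℝ) ^ (-k) * (m i + 1/2)

/-- The concentric `c`-fold expansion of the dyadic cube indexed by `(k, m)`. -/
def expandCube (n : ℕ) (k : ℤ) (m : Fin n → ℤ) (c : ℝ) : Set (Fin n → ℝ) :=
  {x | ∀ i, |x i - cubeCenter n k m i| ≤ c * (2:ℝ) ^ (-k) / 2}

/-- The set `Σ_{f,s} = ⋃_k 9Ω_k`, where `Ω_k` is the union of the cubes `I ∈ 𝒟_k` on which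
`D_{k+s} f` is not a.e. zero. -/
def SigmaSet (n : ℕ) (f : (Fin n → ℝ) → ℝ) (s : ℕ) : Set (Fin n → ℝ) :=
  ⋃ (k : ℤ) (m : Fin n → ℤ)
    (_ : ¬ (∀ᵐ x ∂(volume.restrict (dyadicCube n k m)), dyadicD n (k + (s:ℤ)) f x = 0)),
      expandCube n k m 9

/-- The (measure-theoretic) support of a measurable function: the complement of the union of
all balls on which the function vanishes a.e. -/
def suppAE {n : ℕ} (f : (Fin n → ℝ) → ℝ) : Set (Fin n → ℝ) :=
  {x | ∀ r > 0, ¬ (∀ᵐ y ∂(volume.restrict (Metric.ball x r)), f y = 0)}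

/-- The axis-parallel closed cube with centre `c` and side length `ρ`. -/
def cube (n : ℕ) (c : Fin n → ℝ) (ρ : ℝ) : Set (Fin n → ℝ) :=
  {x | ∀ i, |x i - c i| ≤ ρ / 2}

/-- The index of the `s`-th dyadic ancestor `I^{(s)}` of the cube indexed by `(k, m)`
(the ancestor is the cube indexed by `(k - s, ancestorIdx s m)`). -/
def ancestorIdx {n : ℕ} (s : ℕ) (m : Fin n → ℤ) : Fin n → ℤ :=
  fun i => Int.fdiv (m i) (2 ^ s)

/-- The distance between two sets (in the ambient metric). -/
def setDist {α : Type*} [PseudoMetricSpace α] (A B : Set α) : ℝ :=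
  sInf (Set.image2 dist A B)

/-- The index of the cell of level `j` (side `2 ^ j`) of `ℤ^n` containing `x`. -/
def cellIdx {n : ℕ} (j : ℕ) (x : Fin n → ℤ) : Fin n → ℤ := fun i => x i / 2 ^ j

/-- The dyadic cell of level `j` and index `q` in `ℤ^n`. -/
def cell {n : ℕ} (j : ℕ) (q : Fin n → ℤ) : Finset (Fin n → ℤ) :=
  Fintype.piFinset fun i => Finset.Ico (2 ^ j * q i) (2 ^ j * (q i + 1))

/-- The threefold concentric enlargement of a dyadic cell. -/
def bigCell {n : ℕ} (j : ℕ) (q : Fin n → ℤ) : Finset (Fin n → ℤ) :=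
  Fintype.piFinset fun i => Finset.Ico (2 ^ j * (q i - 1)) (2 ^ j * (q i + 2))

lemma mem_cell {n : ℕ} {j : ℕ} {q x : Fin n → ℤ} : x ∈ cell j q ↔ cellIdx j x = q := by
  have h2 : (0 : ℤ) < 2 ^ j := by positivity
  simp only [cell, Fintype.mem_piFinset, Finset.mem_Ico, cellIdx, funext_iff]
  refine forall_congr' fun i => ?_
  constructor
  · rintro ⟨h, h'⟩
    apply le_antisymm
    · exact Int.lt_add_one_iff.mp (Int.ediv_lt_of_lt_mul h2 (by linarith))
    · exact (Int.le_ediv_iff_mul_le h2).mpr (by linarith)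
  · rintro h
    have h3 := Int.mul_ediv_add_emod (x i) (2 ^ j)
    have h4 := Int.emod_nonneg (x i) h2.ne'
    have h5 := Int.emod_lt_of_pos (x i) h2
    rw [h] at h3
    constructor <;> nlinarith

lemma mem_cell_self {n : ℕ} (j : ℕ) (x : Fin n → ℤ) : x ∈ cell j (cellIdx j x) :=
  mem_cell.mpr rfl

lemma card_cell {n : ℕ} (j : ℕ) (q : Fin n → ℤ) : (cell j q).card = (2 ^ j) ^ n := by
  have : ∀ i : Fin n, (2 ^ j * (q i + 1) - 2 ^ j * q i).toNat = 2 ^ j := by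
    intro i
    have : (2 ^ j * (q i + 1) - 2 ^ j * q i) = ((2 ^ j : ℕ) : ℤ) := by push_cast; ring
    rw [this, Int.toNat_natCast]
  simp [cell, Fintype.card_piFinset, this]

lemma card_bigCell {n : ℕ} (j : ℕ) (q : Fin n → ℤ) :
    (bigCell j q).card = 3 ^ n * (2 ^ j) ^ n := by
  have : ∀ i : Fin n, (2 ^ j * (q i + 2) - 2 ^ j * (q i - 1)).toNat = 3 * 2 ^ j := by
    intro i
    have : (2 ^ j * (q i + 2) - 2 ^ j * (q i - 1)) = ((3 * 2 ^ j : ℕ) : ℤ) := by push_cast; ring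
    rw [this, Int.toNat_natCast]
  simp [bigCell, Fintype.card_piFinset, this, mul_pow]

lemma cellIdx_add {n : ℕ} (i j : ℕ) (x : Fin n → ℤ) :
    cellIdx (i + j) x = cellIdx j (cellIdx i x) := by
  funext a
  simp only [cellIdx]
  rw [Int.ediv_ediv_of_nonneg (by positivity), pow_add]

lemma cellIdx_zero {n : ℕ} (x : Fin n → ℤ) : cellIdx 0 x = x := by
  funext a; simp [cellIdx]

lemma cellIdx_eq_of_le {n : ℕ} {i j : ℕ} (h : i ≤ j) {x y : Fin n → ℤ}
    (hxy : cellIdx i x = cellIdx i y) : cellIdx j x = cellIdx j y := by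
  obtain ⟨k, rfl⟩ := Nat.exists_eq_add_of_le h
  rw [cellIdx_add, cellIdx_add, hxy]

lemma cell_zero {n : ℕ} (q : Fin n → ℤ) : cell 0 q = {q} := by
  ext x; simp [mem_cell, cellIdx_zero]

lemma cell_subset_cell {n : ℕ} {i j : ℕ} (h : i ≤ j) (x : Fin n → ℤ) :
    cell i (cellIdx i x) ⊆ cell j (cellIdx j x) := by
  intro y hy
  rw [mem_cell] at hy ⊢
  exact cellIdx_eq_of_le h hy

/-- The selection of the maximal dyadic cells on which the mean of `|f|` exceeds `l`. -/
lemma exists_stopping_cells {n : ℕ} (hn : 0 < n) (f : (Fin n → ℤ) → ℝ) (Z : Finset (Fin n → ℤ))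
    (hf : ∀ x, x ∉ Z → f x = 0) {l : ℝ} (hl : 0 < l) :
    ∃ S : Finset (ℕ × (Fin n → ℤ)),
      (∀ a ∈ S, ∀ b ∈ S, ∀ x, x ∈ cell a.1 a.2 → x ∈ cell b.1 b.2 → a = b) ∧
      (∀ a ∈ S, l * ((2:ℝ) ^ a.1) ^ n < ∑ x ∈ cell a.1 a.2, |f x|) ∧
      (∀ a ∈ S, ∑ x ∈ cell a.1 a.2, |f x| ≤ 2 ^ n * l * ((2:ℝ) ^ a.1) ^ n) ∧
      (∀ x, (∀ a ∈ S, x ∉ cell a.1 a.2) → |f x| ≤ l) := by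
  classical
  let heavy : ℕ → (Fin n → ℤ) → Prop := fun j q => l * ((2:ℝ) ^ j) ^ n < ∑ x ∈ cell j q, |f x|
  have hZ : ∀ W : Finset (Fin n → ℤ), ∑ x ∈ W, |f x| ≤ ∑ x ∈ Z, |f x| := by
    intro W
    calc ∑ x ∈ W, |f x| ≤ ∑ x ∈ W ∪ Z, |f x| :=
          Finset.sum_le_sum_of_subset_of_nonneg Finset.subset_union_left
            (fun _ _ _ => abs_nonneg _)
      _ = ∑ x ∈ Z, |f x| := by
          symm
          apply Finset.sum_subset Finset.subset_union_right
          intro x _ hx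
          simp [hf x hx]
  obtain ⟨R, hR⟩ := exists_nat_gt ((∑ x ∈ Z, |f x|) / l)
  have hbd : ∀ j q, heavy j q → j < R := by
    intro j q h
    have h1 : l * ((2:ℝ) ^ j) ^ n < ∑ x ∈ Z, |f x| := lt_of_lt_of_le h (hZ _)
    have h2 : ((2:ℝ) ^ j) ^ n < R := by
      refine lt_trans ?_ hR
      rw [lt_div_iff₀ hl]; linarith
    have h3 : (j : ℝ) < 2 ^ j := by exact_mod_cast Nat.lt_two_pow_self
    have h4 : (2:ℝ) ^ j ≤ ((2:ℝ) ^ j) ^ n :=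
      le_self_pow₀ (one_le_pow₀ (by norm_num)) hn.ne'
    exact_mod_cast lt_trans (lt_of_lt_of_le h3 h4) h2
  have hmeet : ∀ j q, heavy j q → q ∈ Z.image (cellIdx j) := by
    intro j q h
    have h1 : 0 < ∑ x ∈ cell j q, |f x| := lt_trans (by positivity) h
    obtain ⟨x, hx, hx0⟩ := Finset.exists_ne_zero_of_sum_ne_zero h1.ne'
    refine Finset.mem_image.mpr ⟨x, ?_, mem_cell.mp hx⟩
    by_contra hxZ
    exact hx0 (by simp [hf x hxZ])
  let U : Finset (ℕ × (Fin n → ℤ)) :=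
    (Finset.range R).biUnion fun j => (Z.image (cellIdx j)).image fun q => (j, q)
  let S := U.filter fun a => heavy a.1 a.2 ∧ ∀ k, 0 < k → ¬ heavy (a.1 + k) (cellIdx k a.2)
  have hS : ∀ a, a ∈ S ↔
      heavy a.1 a.2 ∧ ∀ k, 0 < k → ¬ heavy (a.1 + k) (cellIdx k a.2) := by
    intro a
    simp only [S, Finset.mem_filter, and_iff_right_iff_imp]
    rintro ⟨h, -⟩
    simp only [U, Finset.mem_biUnion]
    exact ⟨a.1, Finset.mem_range.mpr (hbd _ _ h),
      Finset.mem_image.mpr ⟨a.2, hmeet _ _ h, rfl⟩⟩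
  have hlt : ∀ a ∈ S, ∀ b ∈ S, ∀ x, x ∈ cell a.1 a.2 → x ∈ cell b.1 b.2 → ¬ a.1 < b.1 := by
    intro a ha b hb x hxa hxb hab
    obtain ⟨k, hk⟩ := Nat.exists_eq_add_of_lt hab
    refine ((hS a).mp ha).2 (k + 1) (by omega) ?_
    rw [mem_cell] at hxa hxb
    have : cellIdx (k + 1) a.2 = b.2 := by
      rw [← hxa, ← cellIdx_add, ← hxb, hk]; rfl
    rw [this, ← add_assoc, ← hk]
    exact ((hS b).mp hb).1
  refine ⟨S, ?_, fun a ha => ((hS a).mp ha).1, ?_, ?_⟩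
  · intro a ha b hb x hxa hxb
    have h1 := hlt a ha b hb x hxa hxb
    have h2 := hlt b hb a ha x hxb hxa
    have h3 : a.1 = b.1 := by omega
    rw [mem_cell] at hxa hxb
    exact Prod.ext h3 (by rw [← hxa, ← hxb, h3])
  · intro a ha
    have h1 := ((hS a).mp ha).2 1 one_pos
    have hne : (cell a.1 a.2).Nonempty := by
      rw [← Finset.card_pos, card_cell]; positivity
    obtain ⟨x, hx⟩ := hne
    rw [mem_cell] at hx
    have h2 : cell a.1 a.2 ⊆ cell (a.1 + 1) (cellIdx 1 a.2) := by
      rw [← hx, ← cellIdx_add]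
      exact cell_subset_cell (by omega) x
    calc ∑ x ∈ cell a.1 a.2, |f x| ≤ ∑ x ∈ cell (a.1 + 1) (cellIdx 1 a.2), |f x| :=
          Finset.sum_le_sum_of_subset_of_nonneg h2 (fun _ _ _ => abs_nonneg _)
      _ ≤ l * ((2:ℝ) ^ (a.1 + 1)) ^ n := not_lt.mp h1
      _ = _ := by rw [pow_succ, mul_pow]; ring
  · intro x hx
    by_contra! hfx
    have h0 : heavy 0 (cellIdx 0 x) := by
      simp only [heavy, cellIdx_zero, cell_zero, Finset.sum_singleton]
      simpa using hfx
    let j := Nat.findGreatest (fun j => heavy j (cellIdx j x)) R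
    have hj : heavy j (cellIdx j x) :=
      Nat.findGreatest_spec (P := fun j => heavy j (cellIdx j x)) (Nat.zero_le R) h0
    refine hx (j, cellIdx j x) ((hS _).mpr ⟨hj, ?_⟩) (mem_cell_self _ _)
    intro k hk hh
    simp only [← cellIdx_add] at hh
    exact Nat.findGreatest_is_greatest (P := fun j => heavy j (cellIdx j x)) (k := j + k)
      (by omega) (hbd _ _ hh).le hh

/-- The discrete Calderón–Zygmund estimate: a linear operator bounded on `ℓ²` which maps mean-zero
functions on a cell to functions integrable off its enlargement has a weak-type bound. -/
lemma card_lt_le_of_cell_bound {n : ℕ} (hn : 0 < n) {N : ℝ} (hN : 0 < N)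
    (T : ((Fin n → ℤ) → ℝ) →ₗ[ℝ] ((Fin n → ℤ) → ℝ))
    (hL2 : ∀ (f : (Fin n → ℤ) → ℝ) (Z Y : Finset (Fin n → ℤ)), (∀ x, x ∉ Z → f x = 0) →
      ∑ x ∈ Y, (T f x) ^ 2 ≤ N ^ 2 * ∑ x ∈ Z, f x ^ 2)
    (hbad : ∀ (j : ℕ) (q : Fin n → ℤ) (b : (Fin n → ℤ) → ℝ), (∀ x, x ∉ cell j q → b x = 0) →
      ∑ x ∈ cell j q, b x = 0 → ∀ Y : Finset (Fin n → ℤ), (∀ x ∈ Y, x ∉ bigCell j q) →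
      ∑ x ∈ Y, |T b x| ≤ N * ∑ x ∈ cell j q, |b x|)
    (f : (Fin n → ℤ) → ℝ) (Z Y : Finset (Fin n → ℤ)) (hf : ∀ x, x ∉ Z → f x = 0)
    {l : ℝ} (hl : 0 < l) :
    ((Y.filter fun x => 2 * N * l < |T f x|).card : ℝ) ≤
      l⁻¹ ^ 2 * (∑ x ∈ Z with |f x| ≤ l, f x ^ 2)
        + 8 * 4 ^ n * (l⁻¹ * ∑ x ∈ Z with l / 2 < |f x|, |f x|) := by
  classical
  obtain ⟨S, hdisj, hlow, hup, hoff⟩ := exists_stopping_cells hn f Z hf hl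
  let cl : ℕ × (Fin n → ℤ) → Finset (Fin n → ℤ) := fun a => cell a.1 a.2
  let V : ℕ × (Fin n → ℤ) → ℝ := fun a => ((2:ℝ) ^ a.1) ^ n
  have hVpos : ∀ a, 0 < V a := fun a => by positivity
  have hVcard : ∀ a, ((cl a).card : ℝ) = V a := fun a => by simp [cl, V, card_cell]
  let av : ℕ × (Fin n → ℤ) → ℝ := fun a => (∑ x ∈ cl a, f x) / V a
  let b : ℕ × (Fin n → ℤ) → (Fin n → ℤ) → ℝ := fun a x => if x ∈ cl a then f x - av a else 0
  let B : (Fin n → ℤ) → ℝ := ∑ a ∈ S, b a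
  let G : (Fin n → ℤ) → ℝ := f - B
  let U := S.biUnion cl
  have hpw : (S : Set (ℕ × (Fin n → ℤ))).PairwiseDisjoint cl := by
    intro a ha c hc hac
    rw [Function.onFun, Finset.disjoint_left]
    intro x hxa hxc
    exact hac (hdisj a ha c hc x hxa hxc)
  set m : ℝ := ∑ a ∈ S, V a with hm
  have hav : ∀ a ∈ S, |av a| ≤ 2 ^ n * l := by
    intro a ha
    rw [abs_div, abs_of_pos (hVpos a), div_le_iff₀ (hVpos a)]
    exact (Finset.abs_sum_le_sum_abs _ _).trans (hup a ha)
  have hBin : ∀ a ∈ S, ∀ x ∈ cl a, B x = f x - av a := by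
    intro a ha x hx
    simp only [B, Finset.sum_apply]
    rw [Finset.sum_eq_single a]
    · simp [b, hx]
    · intro c hc hca
      have : x ∉ cl c := fun hxc => hca (hdisj c hc a ha x hxc hx)
      simp [b, this]
    · exact fun h => absurd ha h
  have hBout : ∀ x, x ∉ U → B x = 0 := by
    intro x hx
    simp only [B, Finset.sum_apply]
    refine Finset.sum_eq_zero fun a ha => ?_
    have : x ∉ cl a := fun h => hx (Finset.mem_biUnion.mpr ⟨a, ha, h⟩)
    simp [b, this]
  have hGin : ∀ a ∈ S, ∀ x ∈ cl a, G x = av a := by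
    intro a ha x hx
    simp [G, hBin a ha x hx]
  have hGout : ∀ x, x ∉ U → G x = f x := by
    intro x hx
    simp [G, hBout x hx]
  have hm_le : m ≤ 2 * (l⁻¹ * ∑ x ∈ Z with l / 2 < |f x|, |f x|) := by
    have h1 : ∀ a ∈ S, l / 2 * V a ≤ ∑ x ∈ cl a with l / 2 < |f x|, |f x| := by
      intro a ha
      have h2 := hlow a ha
      have h3 := Finset.sum_filter_add_sum_filter_not (cl a) (fun x => l / 2 < |f x|)
        (fun x => |f x|)
      have h4 : ∑ x ∈ cl a with ¬ (l / 2 < |f x|), |f x| ≤ V a * (l / 2) := by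
        calc ∑ x ∈ cl a with ¬ (l / 2 < |f x|), |f x|
            ≤ ∑ x ∈ cl a with ¬ (l / 2 < |f x|), l / 2 :=
              Finset.sum_le_sum fun x hx => not_lt.mp (Finset.mem_filter.mp hx).2
          _ ≤ ∑ x ∈ cl a, l / 2 :=
              Finset.sum_le_sum_of_subset_of_nonneg (Finset.filter_subset _ _)
                (fun _ _ _ => by positivity)
          _ = V a * (l / 2) := by rw [Finset.sum_const, nsmul_eq_mul, hVcard]
      change l * V a < ∑ x ∈ cl a, |f x| at h2
      linarith
    have h5 : l / 2 * m ≤ ∑ x ∈ Z with l / 2 < |f x|, |f x| := by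
      rw [hm, Finset.mul_sum]
      refine (Finset.sum_le_sum h1).trans ?_
      rw [← Finset.sum_biUnion]
      · refine Finset.sum_le_sum_of_subset_of_nonneg ?_ (fun _ _ _ => abs_nonneg _)
        intro x hx
        obtain ⟨a, ha, hxa⟩ := Finset.mem_biUnion.mp hx
        rw [Finset.mem_filter] at hxa ⊢
        refine ⟨?_, hxa.2⟩
        by_contra hxZ
        have := hxa.2
        rw [hf x hxZ, abs_zero] at this
        linarith
      · intro a ha c hc hac
        exact Finset.disjoint_of_subset_left (Finset.filter_subset _ _)
          (Finset.disjoint_of_subset_right (Finset.filter_subset _ _) (hpw ha hc hac))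
    have h6 : m = 2 * (l⁻¹ * (l / 2 * m)) := by field_simp
    rw [h6]
    gcongr
  have hG2 : ∑ x ∈ Z ∪ U, G x ^ 2 ≤ (∑ x ∈ Z with |f x| ≤ l, f x ^ 2) + 4 ^ n * l ^ 2 * m := by
    rw [← Finset.sdiff_union_self_eq_union, Finset.sum_union Finset.sdiff_disjoint]
    gcongr ?_ + ?_
    · calc ∑ x ∈ Z \ U, G x ^ 2 = ∑ x ∈ Z \ U, f x ^ 2 :=
            Finset.sum_congr rfl fun x hx => by rw [hGout x (Finset.mem_sdiff.mp hx).2]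
        _ ≤ _ := by
            refine Finset.sum_le_sum_of_subset_of_nonneg ?_ (fun _ _ _ => sq_nonneg _)
            intro x hx
            rw [Finset.mem_sdiff] at hx
            refine Finset.mem_filter.mpr ⟨hx.1, hoff x fun a ha hxa => hx.2 ?_⟩
            exact Finset.mem_biUnion.mpr ⟨a, ha, hxa⟩
    · rw [Finset.sum_biUnion hpw, hm, Finset.mul_sum]
      refine Finset.sum_le_sum fun a ha => ?_
      calc ∑ x ∈ cl a, G x ^ 2 = ∑ x ∈ cl a, av a ^ 2 :=
            Finset.sum_congr rfl fun x hx => by rw [hGin a ha x hx]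
        _ = V a * av a ^ 2 := by rw [Finset.sum_const, nsmul_eq_mul, hVcard]
        _ ≤ V a * (2 ^ n * l) ^ 2 := by
            gcongr V a * ?_
            rw [← sq_abs]; gcongr; exact hav a ha
        _ = 4 ^ n * l ^ 2 * V a := by
            rw [mul_pow, ← pow_mul, mul_comm n 2, pow_mul]; norm_num; ring
  have hb0 : ∀ a, ∑ x ∈ cl a, b a x = 0 := by
    intro a
    have : ∑ x ∈ cl a, b a x = ∑ x ∈ cl a, (f x - av a) :=
      Finset.sum_congr rfl fun x hx => by simp [b, hx]
    rw [this, Finset.sum_sub_distrib, Finset.sum_const, nsmul_eq_mul, hVcard]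
    simp only [av]
    field_simp [(hVpos a).ne']
    ring
  have hb1 : ∀ a ∈ S, ∑ x ∈ cl a, |b a x| ≤ 2 * 2 ^ n * l * V a := by
    intro a ha
    have : ∑ x ∈ cl a, |b a x| ≤ ∑ x ∈ cl a, (|f x| + 2 ^ n * l) := by
      refine Finset.sum_le_sum fun x hx => ?_
      simp only [b, hx, if_true]
      exact (abs_sub _ _).trans (by gcongr; exact hav a ha)
    refine this.trans ?_
    rw [Finset.sum_add_distrib, Finset.sum_const, nsmul_eq_mul, hVcard]
    have := hup a ha
    change ∑ x ∈ cl a, |f x| ≤ 2 ^ n * l * V a at this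
    linarith
  let E := S.biUnion fun a => bigCell a.1 a.2
  have hE : (E.card : ℝ) ≤ 3 ^ n * m := by
    calc (E.card : ℝ) ≤ ((∑ a ∈ S, (bigCell a.1 a.2).card : ℕ) : ℝ) := by
          exact_mod_cast Finset.card_biUnion_le
      _ = 3 ^ n * m := by
          rw [hm, Finset.mul_sum]; push_cast
          exact Finset.sum_congr rfl fun a _ => by simp [card_bigCell, V]
  have hTB : ∑ x ∈ Y \ E, |T B x| ≤ N * (2 * 2 ^ n * l * m) := by
    have h1 : ∀ x, |T B x| ≤ ∑ a ∈ S, |T (b a) x| := by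
      intro x
      simp only [B, map_sum, Finset.sum_apply]
      exact Finset.abs_sum_le_sum_abs _ _
    calc ∑ x ∈ Y \ E, |T B x| ≤ ∑ x ∈ Y \ E, ∑ a ∈ S, |T (b a) x| :=
          Finset.sum_le_sum fun x _ => h1 x
      _ = ∑ a ∈ S, ∑ x ∈ Y \ E, |T (b a) x| := Finset.sum_comm
      _ ≤ ∑ a ∈ S, N * (2 * 2 ^ n * l * V a) := by
          refine Finset.sum_le_sum fun a ha => ?_
          refine (hbad a.1 a.2 (b a) ?_ (hb0 a) (Y \ E) ?_).trans ?_
          · intro x hx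
            have : x ∉ cl a := hx
            simp [b, this]
          · intro x hx hxa
            exact (Finset.mem_sdiff.mp hx).2 (Finset.mem_biUnion.mpr ⟨a, ha, hxa⟩)
          · gcongr; exact hb1 a ha
      _ = _ := by rw [hm, Finset.mul_sum, Finset.mul_sum]
  have hcheb1 : ((Y.filter fun x => N * l < |T G x|).card : ℝ) * (N * l) ^ 2 ≤
      N ^ 2 * ∑ x ∈ Z ∪ U, G x ^ 2 := by
    refine le_trans ?_ (hL2 G (Z ∪ U) Y ?_)
    · rw [← nsmul_eq_mul, ← Finset.sum_const]
      refine (Finset.sum_le_sum ?_).trans (Finset.sum_le_sum_of_subset_of_nonneg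
        (Finset.filter_subset _ _) (fun _ _ _ => sq_nonneg _))
      intro x hx
      rw [← sq_abs (T G x)]
      have := (Finset.mem_filter.mp hx).2
      gcongr
    · intro x hx
      rw [Finset.mem_union, not_or] at hx
      rw [hGout x hx.2, hf x hx.1]
  have hcheb2 : (((Y \ E).filter fun x => N * l < |T B x|).card : ℝ) * (N * l) ≤
      N * (2 * 2 ^ n * l * m) := by
    refine le_trans ?_ hTB
    rw [← nsmul_eq_mul, ← Finset.sum_const]
    refine (Finset.sum_le_sum ?_).trans (Finset.sum_le_sum_of_subset_of_nonneg
        (Finset.filter_subset _ _) (fun _ _ _ => abs_nonneg _))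
    intro x hx
    exact (Finset.mem_filter.mp hx).2.le
  have hsub : (Y.filter fun x => 2 * N * l < |T f x|) ⊆
      (Y.filter fun x => N * l < |T G x|) ∪ (E ∪ (Y \ E).filter fun x => N * l < |T B x|) := by
    intro x hx
    rw [Finset.mem_filter] at hx
    have hfx : T f x = T G x + T B x := by
      have : f = G + B := by simp [G]
      conv_lhs => rw [this, map_add]
      rfl
    have habs := abs_add_le (T G x) (T B x)
    rw [← hfx] at habs
    by_cases h1 : N * l < |T G x|
    · exact Finset.mem_union_left _ (Finset.mem_filter.mpr ⟨hx.1, h1⟩)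
    · refine Finset.mem_union_right _ ?_
      by_cases h2 : x ∈ E
      · exact Finset.mem_union_left _ h2
      · refine Finset.mem_union_right _ (Finset.mem_filter.mpr
          ⟨Finset.mem_sdiff.mpr ⟨hx.1, h2⟩, ?_⟩)
        have := hx.2
        push Not at h1
        linarith
  have hcard : ((Y.filter fun x => 2 * N * l < |T f x|).card : ℝ) ≤
      ((Y.filter fun x => N * l < |T G x|).card : ℝ) + ((E.card : ℝ) +
        (((Y \ E).filter fun x => N * l < |T B x|).card : ℝ)) := by
    have := (Finset.card_le_card hsub).trans ((Finset.card_union_le _ _).trans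
      (Nat.add_le_add_left (Finset.card_union_le _ _) _))
    exact_mod_cast this
  have hm0 : 0 ≤ m := Finset.sum_nonneg fun a _ => (hVpos a).le
  have e1 : ((Y.filter fun x => N * l < |T G x|).card : ℝ) ≤
      l⁻¹ ^ 2 * (∑ x ∈ Z with |f x| ≤ l, f x ^ 2) + 4 ^ n * m := by
    have h1 := hcheb1.trans (mul_le_mul_of_nonneg_left hG2 (sq_nonneg N))
    rw [← le_div_iff₀ (by positivity)] at h1
    refine h1.trans (le_of_eq ?_)
    field_simp
  have e2 : (((Y \ E).filter fun x => N * l < |T B x|).card : ℝ) ≤ 2 * 2 ^ n * m := by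
    rw [← le_div_iff₀ (by positivity)] at hcheb2
    refine hcheb2.trans (le_of_eq ?_)
    field_simp
  have c1 : (2:ℝ) ^ n ≤ 4 ^ n := by gcongr; norm_num
  have c2 : (3:ℝ) ^ n ≤ 4 ^ n := by gcongr; norm_num
  have e3 : (4 ^ n + 2 * 2 ^ n + 3 ^ n) * m ≤ 4 * 4 ^ n * m := by
    gcongr; linarith
  have e4 : 4 * 4 ^ n * m ≤
      4 * 4 ^ n * (2 * (l⁻¹ * ∑ x ∈ Z with l / 2 < |f x|, |f x|)) := by gcongr
  linarith

lemma integrable_indicator_Ioo_rpow {r : ℝ} (hr : -1 < r) {a : ℝ} (ha : 0 ≤ a) :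
    Integrable ((Set.Ioo 0 a).indicator fun l : ℝ => l ^ r) := by
  rw [integrable_indicator_iff measurableSet_Ioo, ← intervalIntegrable_iff_integrableOn_Ioo_of_le ha]
  exact intervalIntegral.intervalIntegrable_rpow' hr

lemma integral_indicator_Ioo_rpow {r : ℝ} (hr : -1 < r) {a : ℝ} (ha : 0 ≤ a) :
    ∫ l, (Set.Ioo 0 a).indicator (fun l : ℝ => l ^ r) l = a ^ (r + 1) / (r + 1) := by
  rw [integral_indicator measurableSet_Ioo, ← integral_Ioc_eq_integral_Ioo,
    ← intervalIntegral.integral_of_le ha, integral_rpow (Or.inl hr),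
    Real.zero_rpow (by linarith), sub_zero]

lemma integrable_indicator_Ici_rpow {r : ℝ} (hr : r < -1) {a : ℝ} (ha : 0 < a) :
    Integrable ((Set.Ici a).indicator fun l : ℝ => l ^ r) := by
  rw [integrable_indicator_iff measurableSet_Ici, integrableOn_Ici_iff_integrableOn_Ioi]
  exact integrableOn_Ioi_rpow_of_lt hr ha

lemma integral_indicator_Ici_rpow {r : ℝ} (hr : r < -1) {a : ℝ} (ha : 0 < a) :
    ∫ l, (Set.Ici a).indicator (fun l : ℝ => l ^ r) l = -a ^ (r + 1) / (r + 1) := by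
  rw [integral_indicator measurableSet_Ici, integral_Ici_eq_integral_Ioi,
    integral_Ioi_rpow_of_lt hr ha]

/-- Marcinkiewicz interpolation from a two-sided distributional estimate, for finite sums. -/
lemma sum_rpow_le_of_card_lt_le {α β : Type*} (Y : Finset α) (Z : Finset β) (F : α → ℝ) (f : β → ℝ)
    (hF : ∀ x, 0 ≤ F x) (hf : ∀ x, 0 ≤ f x) {p N D : ℝ} (hp1 : 1 < p) (hp2 : p < 2) (hN : 0 < N)
    (hD : 0 ≤ D)
    (h : ∀ l, 0 < l → ((Y.filter fun x => 2 * N * l < F x).card : ℝ) ≤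
      l⁻¹ ^ 2 * (∑ x ∈ Z with f x ≤ l, f x ^ 2) + D * (l⁻¹ * ∑ x ∈ Z with l / 2 < f x, f x)) :
    ∑ x ∈ Y, F x ^ p ≤ (2 * N) ^ p * (p * (1 / (2 - p) + 2 * D / (p - 1))) *
      ∑ x ∈ Z, f x ^ p := by
  classical
  let a : α → ℝ := fun x => F x / (2 * N)
  have ha : ∀ x, 0 ≤ a x := fun x => div_nonneg (hF x) (by positivity)
  have key : ∫ l, ∑ x ∈ Y, (Set.Ioo 0 (a x)).indicator (fun l : ℝ => l ^ (p - 1)) l ≤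
      ∫ l, ((∑ x ∈ Z with 0 < f x, f x ^ 2 * (Set.Ici (f x)).indicator (fun l : ℝ => l ^ (p - 3)) l)
        + ∑ x ∈ Z, D * f x * (Set.Ioo 0 (2 * f x)).indicator (fun l : ℝ => l ^ (p - 2)) l) := by
    apply integral_mono
    · exact integrable_finsetSum _ fun x _ => integrable_indicator_Ioo_rpow (by linarith) (ha x)
    · refine (integrable_finsetSum _ fun x hx => ?_).add (integrable_finsetSum _ fun x hx => ?_)
      · exact (integrable_indicator_Ici_rpow (by linarith)
          (Finset.mem_filter.mp hx).2).const_mul _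
      · exact (integrable_indicator_Ioo_rpow (by linarith) (by have := hf x; positivity)).const_mul _
    · intro l
      dsimp only
      by_cases hl : 0 < l
      · have e1 : ∑ x ∈ Y, (Set.Ioo 0 (a x)).indicator (fun l : ℝ => l ^ (p - 1)) l =
            l ^ (p - 1) * ((Y.filter fun x => 2 * N * l < F x).card : ℝ) := by
          rw [Finset.card_filter]
          push_cast
          rw [Finset.mul_sum]
          refine Finset.sum_congr rfl fun x _ => ?_
          have : l ∈ Set.Ioo 0 (a x) ↔ 2 * N * l < F x := by
            simp only [Set.mem_Ioo, hl, true_and, a]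
            rw [lt_div_iff₀ (by positivity), mul_comm]
          simp only [Set.indicator_apply, this]
          split_ifs <;> simp
        have e2 : ∑ x ∈ Z with 0 < f x,
            f x ^ 2 * (Set.Ici (f x)).indicator (fun l : ℝ => l ^ (p - 3)) l =
            l ^ (p - 3) * ∑ x ∈ Z with f x ≤ l, f x ^ 2 := by
          rw [Finset.sum_filter, Finset.sum_filter, Finset.mul_sum]
          refine Finset.sum_congr rfl fun x _ => ?_
          simp only [Set.indicator_apply, Set.mem_Ici]
          rcases (hf x).eq_or_lt with h0 | h0
          · simp [← h0]
          · simp only [h0, if_true]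
            split_ifs <;> ring
        have e3 : ∑ x ∈ Z, D * f x * (Set.Ioo 0 (2 * f x)).indicator (fun l : ℝ => l ^ (p - 2)) l =
            l ^ (p - 2) * (D * ∑ x ∈ Z with l / 2 < f x, f x) := by
          rw [Finset.sum_filter, Finset.mul_sum, Finset.mul_sum]
          refine Finset.sum_congr rfl fun x _ => ?_
          have : l ∈ Set.Ioo 0 (2 * f x) ↔ l / 2 < f x := by
            simp only [Set.mem_Ioo, hl, true_and]
            rw [div_lt_iff₀ (by norm_num), mul_comm]
          simp only [Set.indicator_apply, this]
          split_ifs <;> ring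
        rw [e1, e2, e3]
        have e4 : l ^ (p - 3) = l ^ (p - 1) * l⁻¹ ^ 2 := by
          rw [show p - 3 = (p - 1) - (2 : ℕ) by push_cast; ring, Real.rpow_sub_natCast hl.ne']
          field_simp
        have e5 : l ^ (p - 2) = l ^ (p - 1) * l⁻¹ := by
          rw [show p - 2 = (p - 1) - 1 by ring, Real.rpow_sub_one hl.ne']
          field_simp
        rw [e4, e5]
        have := mul_le_mul_of_nonneg_left (h l hl) (Real.rpow_nonneg hl.le (p - 1))
        linarith
      · have z1 : ∀ x, (Set.Ioo 0 (a x)).indicator (fun l : ℝ => l ^ (p - 1)) l = 0 := fun x =>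
          Set.indicator_of_notMem (fun h => hl h.1) _
        have z2 : ∀ x, (Set.Ioo 0 (2 * f x)).indicator (fun l : ℝ => l ^ (p - 2)) l = 0 := fun x =>
          Set.indicator_of_notMem (fun h => hl h.1) _
        simp only [z1, z2, Finset.sum_const_zero, mul_zero, add_zero]
        refine Finset.sum_nonneg fun x hx => ?_
        rw [Set.indicator_of_notMem, mul_zero]
        exact fun h => hl (lt_of_lt_of_le (Finset.mem_filter.mp hx).2 h)
  rw [integral_finsetSum _ fun x _ => integrable_indicator_Ioo_rpow (by linarith) (ha x),
    integral_add, integral_finsetSum, integral_finsetSum] at key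
  rotate_left
  · exact fun x hx => (integrable_indicator_Ioo_rpow (by linarith)
      (by have := hf x; positivity)).const_mul _
  · exact fun x hx => (integrable_indicator_Ici_rpow (by linarith)
      (Finset.mem_filter.mp hx).2).const_mul _
  · exact integrable_finsetSum _ fun x hx => (integrable_indicator_Ici_rpow (by linarith)
      (Finset.mem_filter.mp hx).2).const_mul _
  · exact integrable_finsetSum _ fun x hx => (integrable_indicator_Ioo_rpow (by linarith)
      (by have := hf x; positivity)).const_mul _
  have l1 : ∑ x ∈ Y, ∫ l, (Set.Ioo 0 (a x)).indicator (fun l : ℝ => l ^ (p - 1)) l =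
      ((2 * N) ^ p * p)⁻¹ * ∑ x ∈ Y, F x ^ p := by
    rw [Finset.mul_sum]
    refine Finset.sum_congr rfl fun x _ => ?_
    rw [integral_indicator_Ioo_rpow (by linarith) (ha x)]
    simp only [a, sub_add_cancel]
    rw [Real.div_rpow (hF x) (by positivity)]
    field_simp
  have l2 : ∑ x ∈ Z with 0 < f x, ∫ l, f x ^ 2 *
      (Set.Ici (f x)).indicator (fun l : ℝ => l ^ (p - 3)) l ≤ 1 / (2 - p) * ∑ x ∈ Z, f x ^ p := by
    rw [Finset.mul_sum]
    refine (Finset.sum_le_sum (g := fun x => 1 / (2 - p) * f x ^ p) fun x hx => ?_).trans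
      (Finset.sum_le_sum_of_subset_of_nonneg (Finset.filter_subset _ _) fun x _ _ => ?_)
    · have hx0 := (Finset.mem_filter.mp hx).2
      rw [integral_const_mul, integral_indicator_Ici_rpow (by linarith) hx0]
      rw [show p - 3 + 1 = p - (2 : ℕ) by push_cast; ring, Real.rpow_sub_natCast hx0.ne']
      have h3 : 2 - p ≠ 0 := by linarith
      push_cast
      rw [show p - 2 = -(2 - p) by ring]
      apply le_of_eq
      field_simp
    · have := Real.rpow_nonneg (hf x) p
      have h3 : 0 < 2 - p := by linarith
      positivity
  have l3 : ∑ x ∈ Z, ∫ l, D * f x * (Set.Ioo 0 (2 * f x)).indicator (fun l : ℝ => l ^ (p - 2)) l ≤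
      2 * D / (p - 1) * ∑ x ∈ Z, f x ^ p := by
    rw [Finset.mul_sum]
    refine Finset.sum_le_sum fun x hx => ?_
    have h1 : 0 < p - 1 := by linarith
    rw [integral_const_mul, integral_indicator_Ioo_rpow (by linarith) (by have := hf x; positivity)]
    rw [show p - 2 + 1 = p - 1 by ring, Real.mul_rpow (by norm_num) (hf x)]
    have h2 : (2:ℝ) ^ (p - 1) ≤ 2 := by
      conv_rhs => rw [← Real.rpow_one 2]
      exact Real.rpow_le_rpow_of_exponent_le (by norm_num) (by linarith)
    rcases (hf x).eq_or_lt with h0 | h0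
    · simp [← h0, Real.zero_rpow (show p ≠ 0 by linarith)]
    · have h3 : f x ^ p = f x * f x ^ (p - 1) := by
        rw [Real.rpow_sub_one h0.ne']; field_simp
      rw [h3]
      have h4 := Real.rpow_pos_of_pos h0 (p - 1)
      calc D * f x * (2 ^ (p - 1) * f x ^ (p - 1) / (p - 1))
          ≤ D * f x * (2 * f x ^ (p - 1) / (p - 1)) := by gcongr
        _ = _ := by ring
  have hc : 0 < (2 * N) ^ p * p := mul_pos (Real.rpow_pos_of_pos (by positivity) _) (by linarith)
  have := (l1 ▸ key).trans (add_le_add l2 l3)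
  rw [inv_mul_le_iff₀ hc] at this
  refine this.trans (le_of_eq ?_)
  ring

/-- The `ℓ^p` norm over a finite set. -/
def lpNormOn {α : Type*} (Z : Finset α) (p : ℝ) (f : α → ℝ) : ℝ :=
  (∑ x ∈ Z, |f x| ^ p) ^ (1 / p)

/-- `f` vanishes off the finite set `Z`. -/
def VanishesOff {α : Type*} (Z : Finset α) (f : α → ℝ) : Prop := ∀ x, x ∉ Z → f x = 0

/-- Mean-zero functions on a cell are mapped, with norm at most `N`, to functions summable off
the enlarged cell. -/
def CellBound {n : ℕ} (N : ℝ) (T : ((Fin n → ℤ) → ℝ) →ₗ[ℝ] ((Fin n → ℤ) → ℝ)) : Prop :=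
  ∀ (j : ℕ) (q : Fin n → ℤ) (b : (Fin n → ℤ) → ℝ), (∀ x, x ∉ cell j q → b x = 0) →
      ∑ x ∈ cell j q, b x = 0 → ∀ Y : Finset (Fin n → ℤ), (∀ x ∈ Y, x ∉ bigCell j q) →
      ∑ x ∈ Y, |T b x| ≤ N * ∑ x ∈ cell j q, |b x|

lemma lpNormOn_nonneg {α : Type*} (Z : Finset α) (p : ℝ) (f : α → ℝ) : 0 ≤ lpNormOn Z p f :=
  Real.rpow_nonneg (Finset.sum_nonneg fun _ _ => Real.rpow_nonneg (abs_nonneg _) _) _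

lemma lpNormOn_two {α : Type*} (Z : Finset α) (f : α → ℝ) :
    lpNormOn Z 2 f = √(∑ x ∈ Z, f x ^ 2) := by
  simp [lpNormOn, Real.sqrt_eq_rpow]

lemma lpNormOn_le_of_sum_le {α β : Type*} {Z : Finset α} {Y : Finset β} {p K N : ℝ} (hp : 0 < p)
    (hK : 0 ≤ K) (hN : 0 ≤ N) {f : α → ℝ} {F : β → ℝ}
    (h : ∑ x ∈ Y, |F x| ^ p ≤ K * N ^ p * ∑ x ∈ Z, |f x| ^ p) :
    lpNormOn Y p F ≤ K ^ (1 / p) * N * lpNormOn Z p f := by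
  have h0 : 0 ≤ ∑ x ∈ Z, |f x| ^ p :=
    Finset.sum_nonneg fun _ _ => Real.rpow_nonneg (abs_nonneg _) _
  have h1 : 0 ≤ ∑ x ∈ Y, |F x| ^ p :=
    Finset.sum_nonneg fun _ _ => Real.rpow_nonneg (abs_nonneg _) _
  unfold lpNormOn
  refine (Real.rpow_le_rpow h1 h (by positivity)).trans (le_of_eq ?_)
  rw [Real.mul_rpow (by positivity) h0, Real.mul_rpow hK (by positivity), ← Real.rpow_mul hN,
    mul_one_div_cancel hp.ne', Real.rpow_one]

lemma abs_sum_mul_le_lpNormOn {α : Type*} (Z : Finset α) {p q : ℝ} (hpq : p.HolderConjugate q)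
    (f g : α → ℝ) : |∑ x ∈ Z, f x * g x| ≤ lpNormOn Z p f * lpNormOn Z q g := by
  refine (Finset.abs_sum_le_sum_abs _ _).trans ?_
  have := Real.inner_le_Lp_mul_Lq Z (fun x => |f x|) (fun x => |g x|) hpq
  simpa [lpNormOn, abs_mul] using this

lemma exists_lpNormOn_le {n : ℕ} (hn : 0 < n) {p : ℝ} (hp1 : 1 < p) (hp2 : p ≤ 2) :
    ∃ C : ℝ, 0 < C ∧ ∀ (N : ℝ), 0 < N → ∀ T : ((Fin n → ℤ) → ℝ) →ₗ[ℝ] ((Fin n → ℤ) → ℝ),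
      (∀ (f : (Fin n → ℤ) → ℝ) (Z Y : Finset (Fin n → ℤ)), VanishesOff Z f →
        ∑ x ∈ Y, (T f x) ^ 2 ≤ N ^ 2 * ∑ x ∈ Z, f x ^ 2) →
      CellBound N T →
      ∀ (f : (Fin n → ℤ) → ℝ) (Z Y : Finset (Fin n → ℤ)), VanishesOff Z f →
        lpNormOn Y p (T f) ≤ C * N * lpNormOn Z p f := by
  rcases hp2.eq_or_lt with rfl | hp2
  · refine ⟨1, one_pos, fun N hN T hL2 _ f Z Y hf => ?_⟩
    rw [lpNormOn_two, lpNormOn_two, one_mul]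
    rw [← Real.sqrt_sq hN.le, ← Real.sqrt_mul (sq_nonneg N)]
    exact Real.sqrt_le_sqrt (hL2 f Z Y hf)
  · set D : ℝ := 8 * 4 ^ n
    set K : ℝ := 2 ^ p * (p * (1 / (2 - p) + 2 * D / (p - 1))) with hK
    have hK0 : 0 < K := by
      have h1 : 0 < 2 - p := by linarith
      have h2 : 0 < p - 1 := by linarith
      positivity
    refine ⟨K ^ (1 / p), Real.rpow_pos_of_pos hK0 _, fun N hN T hL2 hbad f Z Y hf => ?_⟩
    refine lpNormOn_le_of_sum_le (by linarith) hK0.le hN.le ?_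
    have := sum_rpow_le_of_card_lt_le Y Z (fun x => |T f x|) (fun x => |f x|)
      (fun _ => abs_nonneg _) (fun _ => abs_nonneg _) hp1 hp2 hN (D := D) (by positivity) ?_
    · refine this.trans (le_of_eq ?_)
      rw [Real.mul_rpow (by norm_num) hN.le, hK]
      ring
    · intro l hl
      have := card_lt_le_of_cell_bound hn hN T hL2 hbad f Z Y hf hl
      simpa using this

lemma sum_sq_le_of_form_bound {n : ℕ} {N : ℝ} (hN : 0 < N)
    {T : ((Fin n → ℤ) → ℝ) →ₗ[ℝ] ((Fin n → ℤ) → ℝ)}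
    {B : ((Fin n → ℤ) → ℝ) → ((Fin n → ℤ) → ℝ) → ℝ}
    (hT : ∀ f g Z, VanishesOff Z g → B f g = ∑ x ∈ Z, g x * T f x)
    (hB : ∀ f g Z Y, VanishesOff Z f → VanishesOff Y g →
      |B f g| ≤ N * √(∑ x ∈ Z, f x ^ 2) * √(∑ x ∈ Y, g x ^ 2))
    (f : (Fin n → ℤ) → ℝ) (Z Y : Finset (Fin n → ℤ)) (hf : VanishesOff Z f) :
    ∑ x ∈ Y, (T f x) ^ 2 ≤ N ^ 2 * ∑ x ∈ Z, f x ^ 2 := by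
  classical
  let g : (Fin n → ℤ) → ℝ := fun x => if x ∈ Y then T f x else 0
  have hg : VanishesOff Y g := fun x hx => by simp [g, hx]
  have h1 : B f g = ∑ x ∈ Y, (T f x) ^ 2 := by
    rw [hT f g Y hg]
    exact Finset.sum_congr rfl fun x hx => by simp [g, hx, sq]
  have h2 : ∑ x ∈ Y, g x ^ 2 = ∑ x ∈ Y, (T f x) ^ 2 :=
    Finset.sum_congr rfl fun x hx => by simp [g, hx]
  have h3 := (le_abs_self _).trans (hB f g Z Y hf hg)
  rw [h1, h2] at h3
  set S := ∑ x ∈ Y, (T f x) ^ 2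
  set A := ∑ x ∈ Z, f x ^ 2
  have hS : 0 ≤ S := Finset.sum_nonneg fun _ _ => sq_nonneg _
  have hA : 0 ≤ A := Finset.sum_nonneg fun _ _ => sq_nonneg _
  rcases hS.eq_or_lt with h0 | h0
  · rw [← h0]; positivity
  · have h4 : 0 < √S := Real.sqrt_pos.mpr h0
    have h5 : √S ≤ N * √A := by
      have : √S * √S ≤ N * √A * √S := by rwa [Real.mul_self_sqrt hS]
      exact le_of_mul_le_mul_right this h4
    calc S = √S ^ 2 := (Real.sq_sqrt hS).symm
      _ ≤ (N * √A) ^ 2 := by gcongr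
      _ = N ^ 2 * A := by rw [mul_pow, Real.sq_sqrt hA]

/-- Extrapolation of an `ℓ²` bound for a bilinear form to `ℓ^p × ℓ^{p'}`, when both the associated
operator and its transpose satisfy the cell bound. -/
lemma exists_abs_form_le {n : ℕ} (hn : 0 < n) {p q : ℝ} (hpq : p.HolderConjugate q) :
    ∃ C : ℝ, 0 < C ∧ ∀ (N : ℝ), 0 < N → ∀ T T' : ((Fin n → ℤ) → ℝ) →ₗ[ℝ] ((Fin n → ℤ) → ℝ),
      ∀ B : ((Fin n → ℤ) → ℝ) → ((Fin n → ℤ) → ℝ) → ℝ,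
      (∀ f g Z, VanishesOff Z g → B f g = ∑ x ∈ Z, g x * T f x) →
      (∀ f g Z, VanishesOff Z f → B f g = ∑ x ∈ Z, f x * T' g x) →
      (∀ f g Z Y, VanishesOff Z f → VanishesOff Y g →
        |B f g| ≤ N * √(∑ x ∈ Z, f x ^ 2) * √(∑ x ∈ Y, g x ^ 2)) →
      CellBound N T → CellBound N T' →
      ∀ f g Z, VanishesOff Z f → VanishesOff Z g →
        |B f g| ≤ C * N * lpNormOn Z p f * lpNormOn Z q g := by
  rcases le_total p 2 with hp | hp
  · obtain ⟨C, hC, h⟩ := exists_lpNormOn_le hn hpq.lt hp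
    refine ⟨C, hC, fun N hN T T' B hT hT' hB hb hb' f g Z hf hg => ?_⟩
    rw [hT f g Z hg]
    refine (abs_sum_mul_le_lpNormOn Z hpq.symm g (T f)).trans ?_
    rw [mul_comm]
    exact mul_le_mul_of_nonneg_right
      (h N hN T (sum_sq_le_of_form_bound hN hT hB) hb f Z Z hf) (lpNormOn_nonneg _ _ _)
  · have hq : q ≤ 2 := by
      by_contra! hq
      have h1 := hpq.inv_add_inv_eq_one
      have h2 : p⁻¹ ≤ 2⁻¹ := inv_anti₀ (by norm_num) hp
      have h3 : q⁻¹ < 2⁻¹ := inv_strictAnti₀ (by norm_num) hq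
      linarith
    obtain ⟨C, hC, h⟩ := exists_lpNormOn_le hn hpq.symm.lt hq
    refine ⟨C, hC, fun N hN T T' B hT hT' hB hb hb' f g Z hf hg => ?_⟩
    rw [hT' f g Z hf]
    refine (abs_sum_mul_le_lpNormOn Z hpq f (T' g)).trans ?_
    have h2 := sum_sq_le_of_form_bound hN (T := T') (B := fun g f => B f g)
      (fun f g Z hg => hT' g f Z hg)
      (fun f g Z Y hf hg => (hB g f Y Z hg hf).trans (le_of_eq (by ring)))
    calc lpNormOn Z p f * lpNormOn Z q (T' g)
        ≤ lpNormOn Z p f * (C * N * lpNormOn Z q g) :=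
          mul_le_mul_of_nonneg_left (h N hN T' h2 hb' g Z Z hg) (lpNormOn_nonneg _ _ _)
      _ = _ := by ring

/-- The sign of the one-dimensional Haar function of level `j` at the integer `t`. -/
def haarSign (j : ℕ) (t : ℤ) : ℝ := if (2 * t / 2 ^ j) % 2 = 0 then 1 else -1

/-- The sign of the `n`-dimensional Haar functions of level `j` and type `η`. -/
def haarSigns {n : ℕ} (j : ℕ) (η : Fin n → Bool) (x : Fin n → ℤ) : ℝ :=
  ∏ i, if η i then haarSign j (x i) else 1

/-- The unnormalised Haar coefficient of a function on `ℤ^n`. -/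
def haarCoef {n : ℕ} (j : ℕ) (q : Fin n → ℤ) (η : Fin n → Bool) (f : (Fin n → ℤ) → ℝ) : ℝ :=
  ∑ x ∈ cell j q, f x * haarSigns j η x

lemma abs_haarSign (j : ℕ) (t : ℤ) : |haarSign j t| = 1 := by
  unfold haarSign; split_ifs <;> simp

lemma abs_haarSigns {n : ℕ} (j : ℕ) (η : Fin n → Bool) (x : Fin n → ℤ) :
    |haarSigns j η x| = 1 := by
  unfold haarSigns
  rw [Finset.abs_prod]
  refine Finset.prod_eq_one fun i _ => ?_
  split_ifs <;> simp [abs_haarSign]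

lemma haarSign_eq_of_ediv_eq {j : ℕ} {s t : ℤ} (h : s / 2 ^ j = t / 2 ^ j) :
    haarSign (j + 1) s = haarSign (j + 1) t := by
  have : ∀ u : ℤ, 2 * u / 2 ^ (j + 1) = u / 2 ^ j := by
    intro u
    rw [pow_succ, mul_comm _ (2 : ℤ), Int.mul_ediv_mul_of_pos _ _ (by norm_num)]
  simp only [haarSign, this, h]

lemma haarSigns_eq_of_cellIdx_eq {n : ℕ} {i j : ℕ} (hij : i < j) (η : Fin n → Bool)
    {x y : Fin n → ℤ} (h : cellIdx i x = cellIdx i y) : haarSigns j η x = haarSigns j η y := by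
  obtain ⟨k, rfl⟩ := Nat.exists_eq_add_of_lt hij
  have h' := cellIdx_eq_of_le (Nat.le_add_right i k) h
  unfold haarSigns
  refine Finset.prod_congr rfl fun a _ => ?_
  rw [haarSign_eq_of_ediv_eq (congrFun h' a)]

lemma haarCoef_eq_sum {n : ℕ} (j : ℕ) (q : Fin n → ℤ) (η : Fin n → Bool)
    {f : (Fin n → ℤ) → ℝ} {Z : Finset (Fin n → ℤ)} (hf : VanishesOff Z f) :
    haarCoef j q η f = ∑ x ∈ Z, f x * (if cellIdx j x = q then haarSigns j η x else 0) := by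
  classical
  unfold haarCoef
  have h1 : ∀ x ∈ cell j q, f x * haarSigns j η x =
      f x * (if cellIdx j x = q then haarSigns j η x else 0) := by
    intro x hx
    rw [if_pos (mem_cell.mp hx)]
  rw [Finset.sum_congr rfl h1]
  refine (Finset.sum_subset (Finset.subset_union_left (s₂ := Z)) ?_).trans
    (Finset.sum_subset (Finset.subset_union_right (s₁ := cell j q)) ?_).symm
  · intro x _ hx
    rw [mem_cell] at hx
    rw [if_neg hx, mul_zero]
  · intro x _ hx
    rw [hf x hx, zero_mul]

lemma abs_haarCoef_le {n : ℕ} (j : ℕ) (q : Fin n → ℤ) (η : Fin n → Bool)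
    (f : (Fin n → ℤ) → ℝ) : |haarCoef j q η f| ≤ ∑ x ∈ cell j q, |f x| := by
  refine (Finset.abs_sum_le_sum_abs _ _).trans (le_of_eq ?_)
  exact Finset.sum_congr rfl fun x _ => by rw [abs_mul, abs_haarSigns, mul_one]

/-- The bilinear form pairing Haar coefficients of shifted cells. -/
def shiftForm {n : ℕ} (S : Finset (ℕ × (Fin n → ℤ))) (β : ℕ × (Fin n → ℤ) → ℝ)
    (r s : Fin n → ℤ) (ζ θ : Fin n → Bool) (f g : (Fin n → ℤ) → ℝ) : ℝ :=
  ∑ J ∈ S, β J / ((2:ℝ) ^ J.1) ^ n * haarCoef J.1 (J.2 + r) ζ f * haarCoef J.1 (J.2 + s) θ g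

/-- The operator associated to `shiftForm`. -/
def shiftOp {n : ℕ} (S : Finset (ℕ × (Fin n → ℤ))) (β : ℕ × (Fin n → ℤ) → ℝ)
    (r s : Fin n → ℤ) (ζ θ : Fin n → Bool) :
    ((Fin n → ℤ) → ℝ) →ₗ[ℝ] ((Fin n → ℤ) → ℝ) where
  toFun f x := ∑ J ∈ S, β J / ((2:ℝ) ^ J.1) ^ n * haarCoef J.1 (J.2 + r) ζ f *
    (if cellIdx J.1 x = J.2 + s then haarSigns J.1 θ x else 0)
  map_add' f g := by
    funext x
    simp only [haarCoef, Pi.add_apply]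
    rw [← Finset.sum_add_distrib]
    refine Finset.sum_congr rfl fun J _ => ?_
    simp only [add_mul, Finset.sum_add_distrib, mul_add]
  map_smul' c f := by
    funext x
    simp only [haarCoef, Pi.smul_apply, smul_eq_mul, RingHom.id_apply]
    rw [Finset.mul_sum]
    refine Finset.sum_congr rfl fun J _ => ?_
    simp only [mul_assoc, ← Finset.mul_sum]
    ring

lemma shiftForm_eq_sum_shiftOp {n : ℕ} (S : Finset (ℕ × (Fin n → ℤ)))
    (β : ℕ × (Fin n → ℤ) → ℝ) (r s : Fin n → ℤ) (ζ θ : Fin n → Bool)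
    (f g : (Fin n → ℤ) → ℝ) (Z : Finset (Fin n → ℤ)) (hg : VanishesOff Z g) :
    shiftForm S β r s ζ θ f g = ∑ x ∈ Z, g x * shiftOp S β r s ζ θ f x := by
  simp only [shiftForm, shiftOp, LinearMap.coe_mk, AddHom.coe_mk, Finset.mul_sum]
  rw [Finset.sum_comm]
  refine Finset.sum_congr rfl fun J _ => ?_
  rw [haarCoef_eq_sum J.1 (J.2 + s) θ hg, Finset.mul_sum]
  exact Finset.sum_congr rfl fun x _ => by ring

lemma shiftForm_swap {n : ℕ} (S : Finset (ℕ × (Fin n → ℤ)))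
    (β : ℕ × (Fin n → ℤ) → ℝ) (r s : Fin n → ℤ) (ζ θ : Fin n → Bool)
    (f g : (Fin n → ℤ) → ℝ) :
    shiftForm S β r s ζ θ f g = shiftForm S β s r θ ζ g f := by
  unfold shiftForm
  exact Finset.sum_congr rfl fun J _ => by ring

lemma haarCoef_eq_zero_of_cell {n : ℕ} {j j₀ : ℕ} (hj : j₀ < j) (q q₀ : Fin n → ℤ)
    (ζ : Fin n → Bool) {b : (Fin n → ℤ) → ℝ} (hb : VanishesOff (cell j₀ q₀) b)
    (hb0 : ∑ x ∈ cell j₀ q₀, b x = 0) : haarCoef j q ζ b = 0 := by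
  rw [haarCoef_eq_sum j q ζ hb]
  rcases (cell j₀ q₀).eq_empty_or_nonempty with h | ⟨y, hy⟩
  · simp [h]
  · have : ∀ x ∈ cell j₀ q₀, b x * (if cellIdx j x = q then haarSigns j ζ x else 0) =
        b x * (if cellIdx j y = q then haarSigns j ζ y else 0) := by
      intro x hx
      have hxy : cellIdx j₀ x = cellIdx j₀ y := (mem_cell.mp hx).trans (mem_cell.mp hy).symm
      rw [cellIdx_eq_of_le hj.le hxy, haarSigns_eq_of_cellIdx_eq hj ζ hxy]
    rw [Finset.sum_congr rfl this, ← Finset.sum_mul, hb0, zero_mul]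

lemma mem_bigCell_of_shift {n : ℕ} {j j₀ k : ℕ} (hj : j + k ≤ j₀) {q q₀ r s : Fin n → ℤ}
    (hrs : ∀ i, |s i - r i| ≤ 2 ^ k) {x y : Fin n → ℤ} (hy : cellIdx j₀ y = q₀)
    (hyq : cellIdx j y = q + r) (hxq : cellIdx j x = q + s) : x ∈ bigCell j₀ q₀ := by
  obtain ⟨d, rfl⟩ := Nat.exists_eq_add_of_le (show j ≤ j₀ by omega)
  have hkd : k ≤ d := by omega
  rw [cellIdx_add] at hy
  have hz := mem_cell.mpr hy
  have hx := mem_cell.mpr hxq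
  simp only [cell, bigCell, Fintype.mem_piFinset, Finset.mem_Ico] at hz hx ⊢
  intro i
  have h1 := hz i
  have h2 := hx i
  have h3 := abs_le.mp (hrs i)
  have h4 : (2:ℤ) ^ k ≤ 2 ^ d := pow_le_pow_right₀ (by norm_num) hkd
  have h5 : cellIdx j y i = q i + r i := congrFun hyq i
  rw [h5] at h1
  have hp : (0:ℤ) < 2 ^ j := by positivity
  simp only [Pi.add_apply] at h2
  rw [pow_add, mul_assoc, mul_assoc]
  constructor
  · exact (mul_le_mul_of_nonneg_left (by linarith) hp.le).trans h2.1
  · refine lt_of_lt_of_le h2.2 (mul_le_mul_of_nonneg_left ?_ hp.le)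
    have : q i + r i + 1 ≤ 2 ^ d * (q₀ i + 1) := h1.2
    linarith

lemma cellBound_shiftOp {n : ℕ} (S : Finset (ℕ × (Fin n → ℤ)))
    (β : ℕ × (Fin n → ℤ) → ℝ) (hβ : ∀ J, |β J| ≤ 1) (r s : Fin n → ℤ) (ζ θ : Fin n → Bool)
    {k : ℕ} (hrs : ∀ i, |s i - r i| ≤ 2 ^ k) :
    CellBound ((k : ℝ) + 1) (shiftOp S β r s ζ θ) := by
  classical
  intro j₀ q₀ b hb hb0 Y hY
  let t : ℕ × (Fin n → ℤ) → (Fin n → ℤ) → ℝ := fun J x =>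
    β J / ((2:ℝ) ^ J.1) ^ n * haarCoef J.1 (J.2 + r) ζ b *
    (if cellIdx J.1 x = J.2 + s then haarSigns J.1 θ x else 0)
  have ht0 : ∀ J, ∀ x ∈ Y, ¬ (J.1 ∈ Finset.Icc (j₀ - k) j₀) → t J x = 0 := by
    intro J x hx hJ
    rw [Finset.mem_Icc, not_and_or] at hJ
    rcases hJ with hJ | hJ
    · by_cases hxs : cellIdx J.1 x = J.2 + s
      · have : haarCoef J.1 (J.2 + r) ζ b = 0 := by
          by_contra hne
          obtain ⟨y, hy, hy0⟩ := Finset.exists_ne_zero_of_sum_ne_zero hne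
          have hyQ : y ∈ cell j₀ q₀ := by
            by_contra hyQ
            exact hy0 (by rw [hb y hyQ, zero_mul])
          exact hY x hx (mem_bigCell_of_shift (by omega) hrs (mem_cell.mp hyQ)
            (mem_cell.mp hy) hxs)
        simp [t, this]
      · simp [t, hxs]
    · have := haarCoef_eq_zero_of_cell (show j₀ < J.1 by omega) (J.2 + r) q₀ ζ hb hb0
      simp [t, this]
  have ht1 : ∀ J, ∑ x ∈ Y, |t J x| ≤ ∑ y ∈ cell J.1 (J.2 + r), |b y| := by
    intro J
    have hV : 0 < ((2:ℝ) ^ J.1) ^ n := by positivity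
    calc ∑ x ∈ Y, |t J x| ≤ ∑ x ∈ Y, if x ∈ cell J.1 (J.2 + s) then
          (((2:ℝ) ^ J.1) ^ n)⁻¹ * ∑ y ∈ cell J.1 (J.2 + r), |b y| else 0 := by
          refine Finset.sum_le_sum fun x _ => ?_
          simp only [t, mem_cell]
          split_ifs
          · rw [abs_mul, abs_mul, abs_haarSigns, mul_one, abs_div, abs_of_pos hV]
            gcongr
            · rw [div_le_iff₀ hV, inv_mul_cancel₀ hV.ne']; exact hβ J
            · exact abs_haarCoef_le _ _ _ _
          · simp
      _ = ∑ x ∈ Y with x ∈ cell J.1 (J.2 + s),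
            (((2:ℝ) ^ J.1) ^ n)⁻¹ * ∑ y ∈ cell J.1 (J.2 + r), |b y| := by
          rw [Finset.sum_filter]
      _ ≤ ∑ x ∈ cell J.1 (J.2 + s),
            (((2:ℝ) ^ J.1) ^ n)⁻¹ * ∑ y ∈ cell J.1 (J.2 + r), |b y| := by
          refine Finset.sum_le_sum_of_subset_of_nonneg ?_ (fun _ _ _ => ?_)
          · intro x hx; exact (Finset.mem_filter.mp hx).2
          · exact mul_nonneg (by positivity) (Finset.sum_nonneg fun _ _ => abs_nonneg _)
      _ = _ := by
          rw [Finset.sum_const, card_cell, nsmul_eq_mul]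
          push_cast
          field_simp
  calc ∑ x ∈ Y, |shiftOp S β r s ζ θ b x| ≤ ∑ x ∈ Y, ∑ J ∈ S, |t J x| :=
        Finset.sum_le_sum fun x _ => Finset.abs_sum_le_sum_abs _ _
    _ = ∑ J ∈ S, ∑ x ∈ Y, |t J x| := Finset.sum_comm
    _ = ∑ J ∈ S with J.1 ∈ Finset.Icc (j₀ - k) j₀, ∑ x ∈ Y, |t J x| := by
        rw [Finset.sum_filter]
        refine Finset.sum_congr rfl fun J _ => ?_
        split_ifs with h
        · rfl
        · exact Finset.sum_eq_zero fun x hx => by rw [ht0 J x hx h, abs_zero]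
    _ ≤ ∑ J ∈ S with J.1 ∈ Finset.Icc (j₀ - k) j₀, ∑ y ∈ cell J.1 (J.2 + r), |b y| :=
        Finset.sum_le_sum fun J _ => ht1 J
    _ = ∑ j ∈ Finset.Icc (j₀ - k) j₀,
          ∑ J ∈ (S.filter fun J => J.1 ∈ Finset.Icc (j₀ - k) j₀) with J.1 = j,
            ∑ y ∈ cell J.1 (J.2 + r), |b y| := by
        rw [Finset.sum_fiberwise_of_maps_to]
        exact fun J hJ => (Finset.mem_filter.mp hJ).2
    _ ≤ ∑ j ∈ Finset.Icc (j₀ - k) j₀, ∑ y ∈ cell j₀ q₀, |b y| := by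
        refine Finset.sum_le_sum fun j _ => ?_
        rw [← Finset.sum_biUnion]
        · set W := ((S.filter fun J => J.1 ∈ Finset.Icc (j₀ - k) j₀).filter
            fun J => J.1 = j).biUnion fun J => cell J.1 (J.2 + r)
          calc ∑ y ∈ W, |b y| ≤ ∑ y ∈ W ∪ cell j₀ q₀, |b y| :=
                Finset.sum_le_sum_of_subset_of_nonneg Finset.subset_union_left
                  (fun _ _ _ => abs_nonneg _)
            _ = _ := by
                symm
                refine Finset.sum_subset Finset.subset_union_right fun y _ hy => ?_
                rw [hb y hy, abs_zero]
        · intro J hJ J' hJ' hne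
          rw [Function.onFun, Finset.disjoint_left]
          intro y hy hy'
          rw [mem_cell] at hy hy'
          have e1 : J.1 = j := (Finset.mem_filter.mp hJ).2
          have e2 : J'.1 = j := (Finset.mem_filter.mp hJ').2
          rw [e1] at hy
          rw [e2] at hy'
          exact hne (Prod.ext (e1.trans e2.symm) (add_right_cancel (hy.symm.trans hy')))
    _ ≤ ((k : ℝ) + 1) * ∑ x ∈ cell j₀ q₀, |b x| := by
        rw [Finset.sum_const, nsmul_eq_mul]
        gcongr
        have : (Finset.Icc (j₀ - k) j₀).card ≤ k + 1 := by
          rw [Nat.card_Icc]; omega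
        exact_mod_cast this

lemma CellBound.sub {n : ℕ} {N N' : ℝ} {T T' : ((Fin n → ℤ) → ℝ) →ₗ[ℝ] ((Fin n → ℤ) → ℝ)}
    (h : CellBound N T) (h' : CellBound N' T') : CellBound (N + N') (T - T') := by
  intro j q b hb hb0 Y hY
  calc ∑ x ∈ Y, |(T - T') b x| ≤ ∑ x ∈ Y, (|T b x| + |T' b x|) :=
        Finset.sum_le_sum fun x _ => abs_sub _ _
    _ ≤ _ := by
        rw [Finset.sum_add_distrib, add_mul]
        exact add_le_add (h j q b hb hb0 Y hY) (h' j q b hb hb0 Y hY)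

lemma CellBound.mono {n : ℕ} {N N' : ℝ} {T : ((Fin n → ℤ) → ℝ) →ₗ[ℝ] ((Fin n → ℤ) → ℝ)}
    (h : CellBound N T) (hN : N ≤ N') : CellBound N' T := fun j q b hb hb0 Y hY =>
  (h j q b hb hb0 Y hY).trans (mul_le_mul_of_nonneg_right hN
    (Finset.sum_nonneg fun _ _ => abs_nonneg _))

/-- A finite set which is a union of cells of level `j`. -/
def CellClosed {n : ℕ} (j : ℕ) (W : Finset (Fin n → ℤ)) : Prop :=
  ∀ x ∈ W, cell j (cellIdx j x) ⊆ W

/-- A function which is constant on the cells of level `j`. -/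
def CellConst {n : ℕ} (j : ℕ) (h : (Fin n → ℤ) → ℝ) : Prop :=
  ∀ x y, cellIdx j x = cellIdx j y → h x = h y

/-- The average of `f` over the cell of level `j` containing `x`. -/
def cellAvg {n : ℕ} (j : ℕ) (f : (Fin n → ℤ) → ℝ) (x : Fin n → ℤ) : ℝ :=
  (((2:ℝ) ^ j) ^ n)⁻¹ * ∑ y ∈ cell j (cellIdx j x), f y

lemma cellClosed_cell {n : ℕ} {i j : ℕ} (hij : i ≤ j) (q : Fin n → ℤ) :
    CellClosed i (cell j q) := by
  intro x hx
  rw [mem_cell] at hx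
  rw [← hx]
  exact cell_subset_cell hij x

lemma exists_cellClosed {n : ℕ} (L : ℕ) (Z : Finset (Fin n → ℤ)) :
    ∃ W, Z ⊆ W ∧ ∀ j ≤ L, CellClosed j W := by
  classical
  refine ⟨Z.biUnion fun x => cell L (cellIdx L x), fun x hx =>
    Finset.mem_biUnion.mpr ⟨x, hx, mem_cell_self L x⟩, fun j hj x hx => ?_⟩
  obtain ⟨z, hz, hxz⟩ := Finset.mem_biUnion.mp hx
  rw [mem_cell] at hxz
  intro y hy
  exact Finset.mem_biUnion.mpr ⟨z, hz, hxz ▸ cell_subset_cell hj x hy⟩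

lemma CellClosed.sum_eq {n : ℕ} {j : ℕ} {W : Finset (Fin n → ℤ)} (hW : CellClosed j W)
    (u : (Fin n → ℤ) → ℝ) :
    ∑ x ∈ W, u x = ∑ q ∈ W.image (cellIdx j), ∑ x ∈ cell j q, u x := by
  rw [← Finset.sum_fiberwise_of_maps_to (g := cellIdx j) (t := W.image (cellIdx j))
    (fun x hx => Finset.mem_image_of_mem _ hx)]
  refine Finset.sum_congr rfl fun q hq => Finset.sum_congr ?_ fun _ _ => rfl
  obtain ⟨z, hz, rfl⟩ := Finset.mem_image.mp hq
  ext x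
  rw [Finset.mem_filter, mem_cell]
  exact ⟨fun h => h.2, fun h => ⟨hW z hz (mem_cell.mpr h), h⟩⟩

lemma cellAvg_zero {n : ℕ} (f : (Fin n → ℤ) → ℝ) : cellAvg 0 f = f := by
  funext x
  simp [cellAvg, cell_zero, cellIdx_zero]

lemma cellAvg_const {n : ℕ} {i j : ℕ} (h : i ≤ j) (f : (Fin n → ℤ) → ℝ) :
    CellConst i (cellAvg j f) := by
  intro x y hxy
  simp only [cellAvg, cellIdx_eq_of_le h hxy]

lemma sum_cell_cellAvg {n : ℕ} (j : ℕ) (q : Fin n → ℤ) (f : (Fin n → ℤ) → ℝ) :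
    ∑ x ∈ cell j q, cellAvg j f x = ∑ x ∈ cell j q, f x := by
  have : ∀ x ∈ cell j q, cellAvg j f x = (((2:ℝ) ^ j) ^ n)⁻¹ * ∑ y ∈ cell j q, f y := by
    intro x hx
    rw [cellAvg, mem_cell.mp hx]
  rw [Finset.sum_congr rfl this, Finset.sum_const, card_cell, nsmul_eq_mul]
  push_cast
  field_simp

lemma sum_cellAvg_mul {n : ℕ} {j : ℕ} {W : Finset (Fin n → ℤ)} (hW : CellClosed j W)
    (f : (Fin n → ℤ) → ℝ) {h : (Fin n → ℤ) → ℝ} (hh : CellConst j h) :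
    ∑ x ∈ W, cellAvg j f x * h x = ∑ x ∈ W, f x * h x := by
  rw [hW.sum_eq, hW.sum_eq]
  refine Finset.sum_congr rfl fun q hq => ?_
  obtain ⟨z, _, rfl⟩ := Finset.mem_image.mp hq
  have : ∀ u : (Fin n → ℤ) → ℝ, ∑ x ∈ cell j (cellIdx j z), u x * h x =
      (∑ x ∈ cell j (cellIdx j z), u x) * h z := by
    intro u
    rw [Finset.sum_mul]
    exact Finset.sum_congr rfl fun x hx => by rw [hh x z (mem_cell.mp hx)]
  rw [this, this, sum_cell_cellAvg]

lemma cellAvg_cellAvg {n : ℕ} {i j : ℕ} (h : i ≤ j) (f : (Fin n → ℤ) → ℝ) :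
    cellAvg j (cellAvg i f) = cellAvg j f := by
  funext x
  have := sum_cellAvg_mul (cellClosed_cell h (cellIdx j x)) f (h := fun _ => 1) (fun _ _ _ => rfl)
  simp only [mul_one] at this
  rw [cellAvg, cellAvg, this]

lemma VanishesOff.cellAvg {n : ℕ} {j : ℕ} {W : Finset (Fin n → ℤ)} (hW : CellClosed j W)
    {f : (Fin n → ℤ) → ℝ} (hf : VanishesOff W f) : VanishesOff W (cellAvg j f) := by
  intro x hx
  have : ∀ y ∈ cell j (cellIdx j x), f y = 0 := by
    intro y hy
    refine hf y fun hyW => hx ?_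
    refine hW y hyW (mem_cell.mpr (mem_cell.mp hy).symm)
  rw [_root_.cellAvg, Finset.sum_eq_zero this, mul_zero]

/-- The martingale differences of `f` up to level `L`, with the average of level `L` as the
last term. -/
def cellDiff {n : ℕ} (L i : ℕ) (f : (Fin n → ℤ) → ℝ) (x : Fin n → ℤ) : ℝ :=
  if i < L then cellAvg i f x - cellAvg (i + 1) f x else cellAvg L f x

lemma cellDiff_const {n : ℕ} {L i : ℕ} (hi : i ≤ L) (f : (Fin n → ℤ) → ℝ) :
    CellConst i (cellDiff L i f) := by
  intro x y hxy
  unfold cellDiff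
  split_ifs
  · rw [cellAvg_const le_rfl f x y hxy, cellAvg_const (Nat.le_succ i) f x y hxy]
  · exact cellAvg_const hi f x y hxy

lemma VanishesOff.cellDiff {n : ℕ} {L i : ℕ} {W : Finset (Fin n → ℤ)}
    (hW : ∀ j ≤ L, CellClosed j W)
    {f : (Fin n → ℤ) → ℝ} (hf : VanishesOff W f) : VanishesOff W (cellDiff L i f) := by
  intro x hx
  unfold _root_.cellDiff
  split_ifs with h
  · rw [hf.cellAvg (hW i h.le) x hx, hf.cellAvg (hW (i + 1) h) x hx, sub_zero]
  · exact hf.cellAvg (hW L le_rfl) x hx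

lemma cellAvg_eq_sum_cellDiff {n : ℕ} {L j : ℕ} (hj : j ≤ L) (f : (Fin n → ℤ) → ℝ)
    (x : Fin n → ℤ) :
    cellAvg j f x = ∑ u ∈ Finset.range (L + 1 - j), cellDiff L (j + u) f x := by
  obtain ⟨M, rfl⟩ := Nat.exists_eq_add_of_le hj
  rw [show j + M + 1 - j = M + 1 by omega, Finset.sum_range_succ]
  have h1 : ∀ u ∈ Finset.range M, cellDiff (j + M) (j + u) f x =
      cellAvg (j + u) f x - cellAvg (j + (u + 1)) f x := by
    intro u hu
    rw [Finset.mem_range] at hu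
    rw [cellDiff, if_pos (by omega), add_assoc]
  rw [Finset.sum_congr rfl h1, Finset.sum_range_sub' (fun u => cellAvg (j + u) f x)]
  simp [cellDiff]

lemma sum_cellDiff_sq {n : ℕ} {L : ℕ} {W : Finset (Fin n → ℤ)} (hW : ∀ j ≤ L, CellClosed j W)
    (f : (Fin n → ℤ) → ℝ) :
    ∑ i ∈ Finset.range (L + 1), ∑ x ∈ W, cellDiff L i f x ^ 2 = ∑ x ∈ W, f x ^ 2 := by
  rw [Finset.sum_range_succ]
  have h1 : ∀ i ∈ Finset.range L, ∑ x ∈ W, cellDiff L i f x ^ 2 =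
      ∑ x ∈ W, cellAvg i f x ^ 2 - ∑ x ∈ W, cellAvg (i + 1) f x ^ 2 := by
    intro i hi
    rw [Finset.mem_range] at hi
    have h := sum_cellAvg_mul (hW (i + 1) hi) (cellAvg i f)
      (cellAvg_const (le_refl (i + 1)) f)
    rw [cellAvg_cellAvg (Nat.le_succ i)] at h
    have e : ∀ x, cellDiff L i f x ^ 2 = cellAvg i f x ^ 2 - cellAvg (i + 1) f x ^ 2
        + 2 * (cellAvg (i + 1) f x * cellAvg (i + 1) f x)
        - 2 * (cellAvg i f x * cellAvg (i + 1) f x) := by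
      intro x
      rw [cellDiff, if_pos hi]
      ring
    simp only [e, Finset.sum_sub_distrib, Finset.sum_add_distrib, ← Finset.mul_sum]
    linarith
  rw [Finset.sum_congr rfl h1, Finset.sum_range_sub' (fun i => ∑ x ∈ W, cellAvg i f x ^ 2)]
  simp [cellDiff, cellAvg_zero]

lemma haarSign_add {j : ℕ} (t : ℤ) : haarSign (j + 1) (t + 2 ^ j) = - haarSign (j + 1) t := by
  have h : 2 * (t + 2 ^ j) / 2 ^ (j + 1) = 2 * t / 2 ^ (j + 1) + 1 := by
    rw [mul_add, ← pow_succ', Int.add_ediv_of_dvd_right (dvd_refl _),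
      Int.ediv_self (by positivity)]
  unfold haarSign
  rw [h]
  split_ifs with h1 h2 h2
  · omega
  · ring
  · ring
  · omega

lemma sum_haarSign {j : ℕ} (hj : 0 < j) (a : ℤ) :
    ∑ t ∈ Finset.Ico (2 ^ j * a) (2 ^ j * (a + 1)), haarSign j t = 0 := by
  obtain ⟨i, rfl⟩ := Nat.exists_eq_add_of_lt hj
  rw [zero_add]
  have hp : (0:ℤ) < 2 ^ i := by positivity
  have h2 : (2:ℤ) ^ (i + 1) * (a + 1) = 2 ^ (i + 1) * a + (2 ^ i + 2 ^ i) := by ring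
  refine Finset.sum_involution
    (fun t _ => if t < 2 ^ (i + 1) * a + 2 ^ i then t + 2 ^ i else t - 2 ^ i) ?_ ?_ ?_ ?_
  · intro t _
    split_ifs
    · rw [haarSign_add]; ring
    · have := haarSign_add (j := i) (t - 2 ^ i)
      rw [sub_add_cancel] at this
      rw [this]; ring
  · intro t _ _
    split_ifs <;> omega
  · intro t ht
    rw [Finset.mem_Ico] at ht ⊢
    split_ifs <;> constructor <;> omega
  · intro t ht
    rw [Finset.mem_Ico] at ht
    split_ifs <;> omega

lemma sum_haarSigns {n : ℕ} {j : ℕ} (hj : 0 < j) (q : Fin n → ℤ)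
    {η : Fin n → Bool} (hη : η ≠ fun _ => false) : ∑ x ∈ cell j q, haarSigns j η x = 0 := by
  obtain ⟨i, hi⟩ := Function.ne_iff.mp hη
  have hi : η i = true := by simpa using hi
  unfold cell haarSigns
  rw [← Finset.prod_univ_sum (fun i => Finset.Ico (2 ^ j * q i) (2 ^ j * (q i + 1)))
    (fun i t => if η i then haarSign j t else 1)]
  refine Finset.prod_eq_zero (Finset.mem_univ i) ?_
  simp only [hi, if_true]
  exact sum_haarSign hj (q i)

lemma haarCoef_eq_zero_of_cellConst {n : ℕ} {j : ℕ} (hj : 0 < j) (q : Fin n → ℤ)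
    {η : Fin n → Bool} (hη : η ≠ fun _ => false) {f : (Fin n → ℤ) → ℝ} (hf : CellConst j f) :
    haarCoef j q η f = 0 := by
  unfold haarCoef
  rcases (cell j q).eq_empty_or_nonempty with h | ⟨y, hy⟩
  · simp [h]
  · rw [Finset.sum_congr rfl fun x hx => by
        rw [hf x y ((mem_cell.mp hx).trans (mem_cell.mp hy).symm)],
      ← Finset.mul_sum, sum_haarSigns hj q hη, mul_zero]

lemma haarCoef_cellAvg {n : ℕ} {i j : ℕ} (hij : i < j) (q : Fin n → ℤ)
    (η : Fin n → Bool) (f : (Fin n → ℤ) → ℝ) :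
    haarCoef j q η (cellAvg i f) = haarCoef j q η f :=
  sum_cellAvg_mul (cellClosed_cell hij.le q) f
    (fun _ _ h => haarSigns_eq_of_cellIdx_eq hij η h)

lemma haarCoef_cellDiff {n : ℕ} {L j : ℕ} (hj : j < L) (q : Fin n → ℤ)
    {η : Fin n → Bool} (hη : η ≠ fun _ => false) (f : (Fin n → ℤ) → ℝ) :
    haarCoef (j + 1) q η (cellDiff L j f) = haarCoef (j + 1) q η f := by
  have h0 := haarCoef_eq_zero_of_cellConst (Nat.succ_pos j) q hη
    (cellAvg_const (le_refl (j + 1)) f)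
  rw [← haarCoef_cellAvg (Nat.lt_succ_self j) q η f,
    ← sub_zero (haarCoef (j + 1) q η (cellAvg j f)), ← h0]
  simp only [haarCoef, cellDiff, if_pos hj, ← Finset.sum_sub_distrib, sub_mul]

/-- A sum over cells of level `j` of a set of nonnegative sums. -/
lemma sum_cells_le {n : ℕ} {j : ℕ} (S : Finset (ℕ × (Fin n → ℤ))) (r : Fin n → ℤ)
    (hS : ∀ J ∈ S, J.1 = j) {W : Finset (Fin n → ℤ)} {u : (Fin n → ℤ) → ℝ}
    (hu : VanishesOff W u) (hu0 : ∀ x, 0 ≤ u x) :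
    ∑ J ∈ S, ∑ x ∈ cell J.1 (J.2 + r), u x ≤ ∑ x ∈ W, u x := by
  classical
  rw [← Finset.sum_biUnion]
  · set Y := S.biUnion fun J => cell J.1 (J.2 + r)
    calc ∑ y ∈ Y, u y ≤ ∑ y ∈ Y ∪ W, u y :=
          Finset.sum_le_sum_of_subset_of_nonneg Finset.subset_union_left (fun _ _ _ => hu0 _)
      _ = _ := (Finset.sum_subset Finset.subset_union_right fun y _ hy => hu y hy).symm
  · intro J hJ J' hJ' hne
    rw [Function.onFun, Finset.disjoint_left]
    intro y hy hy'
    rw [mem_cell] at hy hy'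
    rw [hS J hJ] at hy
    rw [hS J' hJ'] at hy'
    exact hne (Prod.ext ((hS J hJ).trans (hS J' hJ').symm) (add_right_cancel (hy.symm.trans hy')))

lemma sum_haarCoef_sq_le {n : ℕ} (S : Finset (ℕ × (Fin n → ℤ))) (hS : ∀ J ∈ S, 0 < J.1)
    (r : Fin n → ℤ) {η : Fin n → Bool} (hη : η ≠ fun _ => false) {f : (Fin n → ℤ) → ℝ}
    {Z : Finset (Fin n → ℤ)} (hf : VanishesOff Z f) :
    ∑ J ∈ S, (((2:ℝ) ^ J.1) ^ n)⁻¹ * haarCoef J.1 (J.2 + r) η f ^ 2 ≤ ∑ x ∈ Z, f x ^ 2 := by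
  classical
  set L := S.sup Prod.fst with hL
  have hLS : ∀ J ∈ S, J.1 ≤ L := fun J hJ => Finset.le_sup (f := Prod.fst) hJ
  obtain ⟨W, hZW, hW⟩ := exists_cellClosed L Z
  have hfW : VanishesOff W f := fun x hx => hf x fun h => hx (hZW h)
  have hZ : ∑ x ∈ Z, f x ^ 2 = ∑ x ∈ W, f x ^ 2 :=
    Finset.sum_subset hZW fun x _ hx => by rw [hf x hx]; simp
  rw [hZ, ← sum_cellDiff_sq hW f]
  have h1 : ∀ J ∈ S, (((2:ℝ) ^ J.1) ^ n)⁻¹ * haarCoef J.1 (J.2 + r) η f ^ 2 ≤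
      ∑ x ∈ cell J.1 (J.2 + r), cellDiff L (J.1 - 1) f x ^ 2 := by
    rintro ⟨j, q⟩ hJ
    have hj0 : 0 < j := hS _ hJ
    have hjL : j ≤ L := hLS _ hJ
    obtain ⟨i, rfl⟩ := Nat.exists_eq_add_of_lt hj0
    rw [zero_add] at hjL ⊢
    simp only [Nat.add_sub_cancel]
    rw [← haarCoef_cellDiff hjL (q + r) hη f, inv_mul_le_iff₀ (by positivity)]
    have := Finset.sum_mul_sq_le_sq_mul_sq (cell (i + 1) (q + r)) (cellDiff L i f)
      (haarSigns (i + 1) η)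
    refine this.trans (le_of_eq ?_)
    have e : ∀ x, haarSigns (i + 1) η x ^ 2 = 1 := fun x => by
      rw [← sq_abs, abs_haarSigns, one_pow]
    simp only [e, Finset.sum_const, card_cell, nsmul_eq_mul]
    push_cast
    ring
  refine (Finset.sum_le_sum h1).trans ?_
  rw [← Finset.sum_fiberwise_of_maps_to (g := fun J => J.1 - 1) (t := Finset.range (L + 1))
    (fun J hJ => Finset.mem_range.mpr (by have := hLS J hJ; omega))]
  refine Finset.sum_le_sum fun i _ => ?_
  have h2 : ∀ J ∈ S.filter (fun J => J.1 - 1 = i), J.1 = i + 1 := fun J hJ => by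
    obtain ⟨a, b⟩ := Finset.mem_filter.mp hJ
    have := hS J a
    omega
  refine le_trans (le_of_eq ?_) (sum_cells_le (S.filter fun J => J.1 - 1 = i) r h2
    (u := fun x => cellDiff L i f x ^ 2) (fun x hx => ?_) fun x => sq_nonneg _)
  · exact Finset.sum_congr rfl fun J hJ => by rw [(Finset.mem_filter.mp hJ).2]
  · simp [hfW.cellDiff hW x hx]

lemma abs_shiftForm_le {n : ℕ} (S : Finset (ℕ × (Fin n → ℤ)))
    (hS : ∀ J ∈ S, 0 < J.1) (β : ℕ × (Fin n → ℤ) → ℝ) (hβ : ∀ J, |β J| ≤ 1)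
    (r s : Fin n → ℤ) {ζ θ : Fin n → Bool} (hζ : ζ ≠ fun _ => false) (hθ : θ ≠ fun _ => false)
    {f g : (Fin n → ℤ) → ℝ} {Z Y : Finset (Fin n → ℤ)} (hf : VanishesOff Z f)
    (hg : VanishesOff Y g) :
    |shiftForm S β r s ζ θ f g| ≤ √(∑ x ∈ Z, f x ^ 2) * √(∑ x ∈ Y, g x ^ 2) := by
  have key : ∀ J ∈ S, |β J / ((2:ℝ) ^ J.1) ^ n * haarCoef J.1 (J.2 + r) ζ f *
      haarCoef J.1 (J.2 + s) θ g| ≤ √((((2:ℝ) ^ J.1) ^ n)⁻¹ * haarCoef J.1 (J.2 + r) ζ f ^ 2) *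
      √((((2:ℝ) ^ J.1) ^ n)⁻¹ * haarCoef J.1 (J.2 + s) θ g ^ 2) := by
    intro J _
    have hV : 0 < ((2:ℝ) ^ J.1) ^ n := by positivity
    rw [Real.sqrt_mul (by positivity), Real.sqrt_mul (by positivity), Real.sqrt_sq_eq_abs,
      Real.sqrt_sq_eq_abs, abs_mul, abs_mul, abs_div, abs_of_pos hV]
    have e := Real.mul_self_sqrt (inv_nonneg.mpr hV.le)
    calc _ = |β J| * ((((2:ℝ) ^ J.1) ^ n)⁻¹ * (|haarCoef J.1 (J.2 + r) ζ f| *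
          |haarCoef J.1 (J.2 + s) θ g|)) := by ring
      _ ≤ 1 * ((((2:ℝ) ^ J.1) ^ n)⁻¹ * (|haarCoef J.1 (J.2 + r) ζ f| *
          |haarCoef J.1 (J.2 + s) θ g|)) := by
          gcongr
          exact hβ J
      _ = (√(((2:ℝ) ^ J.1) ^ n)⁻¹ * √(((2:ℝ) ^ J.1) ^ n)⁻¹) * (|haarCoef J.1 (J.2 + r) ζ f| *
          |haarCoef J.1 (J.2 + s) θ g|) := by rw [e, one_mul]
      _ = _ := by ring
  refine (Finset.abs_sum_le_sum_abs _ _).trans ((Finset.sum_le_sum key).trans ?_)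
  refine (Real.sum_sqrt_mul_sqrt_le _ (fun _ => by positivity) (fun _ => by positivity)).trans ?_
  gcongr
  · exact sum_haarCoef_sq_le S hS r hζ hf
  · exact sum_haarCoef_sq_le S hS s hθ hg

lemma card_shift_ne_le {i : ℕ} (a w : ℤ) :
    ((Finset.Ico (2 ^ i * a) (2 ^ i * (a + 1))).filter fun t => (t + w) / 2 ^ i ≠ a).card
      ≤ w.natAbs := by
  have hp : (0:ℤ) < 2 ^ i := by positivity
  have key : ∀ t : ℤ, (t + w) / 2 ^ i ≠ a → t + w < 2 ^ i * a ∨ 2 ^ i * (a + 1) ≤ t + w := by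
    intro t ht
    by_contra! h
    refine ht (le_antisymm (Int.lt_add_one_iff.mp (Int.ediv_lt_of_lt_mul hp ?_))
      ((Int.le_ediv_iff_mul_le hp).mpr ?_)) <;> linarith
  rcases le_total 0 w with hw | hw
  · refine (Finset.card_le_card (t := Finset.Ico (2 ^ i * (a + 1) - w) (2 ^ i * (a + 1))) ?_).trans
      (by rw [Int.card_Ico]; omega)
    intro t ht
    rw [Finset.mem_filter, Finset.mem_Ico] at ht
    rw [Finset.mem_Ico]
    rcases key t ht.2 with h | h <;> constructor <;> linarith [ht.1.1, ht.1.2]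
  · refine (Finset.card_le_card (t := Finset.Ico (2 ^ i * a) (2 ^ i * a - w)) ?_).trans
      (by rw [Int.card_Ico]; omega)
    intro t ht
    rw [Finset.mem_filter, Finset.mem_Ico] at ht
    rw [Finset.mem_Ico]
    rcases key t ht.2 with h | h <;> constructor <;> linarith [ht.1.1, ht.1.2]

lemma card_cell_shift_ne_le {n : ℕ} {i : ℕ} (q v : Fin n → ℤ) :
    ((cell i q).filter fun x => cellIdx i (x + v) ≠ q).card * 2 ^ i
      ≤ (2 ^ i) ^ n * ∑ a, (v a).natAbs := by
  classical
  let I : Fin n → Finset ℤ := fun a => Finset.Ico (2 ^ i * q a) (2 ^ i * (q a + 1))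
  have hI : ∀ a, (I a).card = 2 ^ i := by
    intro a
    have : (2 ^ i * (q a + 1) - 2 ^ i * q a) = ((2 ^ i : ℕ) : ℤ) := by push_cast; ring
    simp only [I, Int.card_Ico, this, Int.toNat_natCast]
  let P : Fin n → Finset (Fin n → ℤ) := fun a =>
    Fintype.piFinset (Function.update I a ((I a).filter fun t => (t + v a) / 2 ^ i ≠ q a))
  have hP : ∀ a, (P a).card * 2 ^ i ≤ (2 ^ i) ^ n * (v a).natAbs := by
    intro a
    have h1 : ((2:ℕ) ^ i) ^ n = 2 ^ i * ∏ _b ∈ Finset.univ.erase a, 2 ^ i := by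
      rw [Finset.mul_prod_erase _ (fun _ => 2 ^ i) (Finset.mem_univ a)]
      simp
    simp only [P, Fintype.card_piFinset]
    rw [← Finset.mul_prod_erase _ _ (Finset.mem_univ a), Function.update_self, h1,
      Finset.prod_congr rfl fun b hb => by
        rw [Function.update_of_ne (Finset.ne_of_mem_erase hb), hI b]]
    have := card_shift_ne_le (i := i) (q a) (v a)
    calc _ ≤ (v a).natAbs * (∏ _b ∈ Finset.univ.erase a, 2 ^ i) * 2 ^ i := by
          gcongr
      _ = _ := by ring
  have hsub : ((cell i q).filter fun x => cellIdx i (x + v) ≠ q) ⊆ Finset.univ.biUnion P := by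
    intro x hx
    rw [Finset.mem_filter] at hx
    obtain ⟨a, ha⟩ := Function.ne_iff.mp hx.2
    rw [Finset.mem_biUnion]
    refine ⟨a, Finset.mem_univ a, Fintype.mem_piFinset.mpr fun b => ?_⟩
    have hx1 := Fintype.mem_piFinset.mp hx.1
    by_cases hb : b = a
    · subst hb
      rw [Function.update_self, Finset.mem_filter]
      exact ⟨hx1 b, ha⟩
    · rw [Function.update_of_ne hb]
      exact hx1 b
  calc _ ≤ (Finset.univ.biUnion P).card * 2 ^ i :=
        Nat.mul_le_mul_right _ (Finset.card_le_card hsub)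
    _ ≤ (∑ a, (P a).card) * 2 ^ i := Nat.mul_le_mul_right _ Finset.card_biUnion_le
    _ = ∑ a, (P a).card * 2 ^ i := Finset.sum_mul _ _ _
    _ ≤ ∑ a, (2 ^ i) ^ n * (v a).natAbs := Finset.sum_le_sum fun a _ => hP a
    _ = _ := (Finset.mul_sum _ _ _).symm

lemma sum_le_of_vanishesOff {α : Type*} {W : Finset α} (Y : Finset α)
    {u : α → ℝ} (hu : VanishesOff W u) (hu0 : ∀ x, 0 ≤ u x) :
    ∑ x ∈ Y, u x ≤ ∑ x ∈ W, u x := by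
  classical
  calc ∑ y ∈ Y, u y ≤ ∑ y ∈ Y ∪ W, u y :=
        Finset.sum_le_sum_of_subset_of_nonneg Finset.subset_union_left (fun _ _ _ => hu0 _)
    _ = _ := (Finset.sum_subset Finset.subset_union_right fun y _ hy => hu y hy).symm

lemma sum_shift_ne_le {n : ℕ} {i : ℕ} {W : Finset (Fin n → ℤ)} (hW : CellClosed i W)
    {h : (Fin n → ℤ) → ℝ} (hh : CellConst i h) (hv : VanishesOff W h) (v : Fin n → ℤ)
    (Y : Finset (Fin n → ℤ)) :
    ∑ x ∈ Y, (if cellIdx i (x + v) ≠ cellIdx i x then h x ^ 2 else 0) ≤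
      ((∑ a, (v a).natAbs : ℕ) : ℝ) / 2 ^ i * ∑ x ∈ W, h x ^ 2 := by
  refine (sum_le_of_vanishesOff (W := W) Y (fun x hx => by simp [hv x hx])
    (fun x => by positivity)).trans ?_
  rw [hW.sum_eq, hW.sum_eq, Finset.mul_sum]
  refine Finset.sum_le_sum fun q hq => ?_
  obtain ⟨z, _, rfl⟩ := Finset.mem_image.mp hq
  set q := cellIdx i z
  have e1 : ∀ x ∈ cell i q, (if cellIdx i (x + v) ≠ cellIdx i x then h x ^ 2 else 0) =
      if cellIdx i (x + v) ≠ q then h z ^ 2 else 0 := by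
    intro x hx
    rw [mem_cell] at hx
    rw [hx, hh x z hx]
  have e2 : ∀ x ∈ cell i q, h x ^ 2 = h z ^ 2 := fun x hx => by rw [hh x z (mem_cell.mp hx)]
  rw [Finset.sum_congr rfl e1, Finset.sum_congr rfl e2, ← Finset.sum_filter, Finset.sum_const,
    Finset.sum_const, card_cell, nsmul_eq_mul, nsmul_eq_mul, ← mul_assoc]
  refine mul_le_mul_of_nonneg_right ?_ (sq_nonneg _)
  have := card_cell_shift_ne_le (i := i) q v
  rw [div_mul_eq_mul_div, le_div_iff₀ (by positivity), mul_comm (Nat.cast _ : ℝ) (Nat.cast _)]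
  exact_mod_cast this

lemma sum_comp_add {n : ℕ} (Y : Finset (Fin n → ℤ)) (v : Fin n → ℤ) (u : (Fin n → ℤ) → ℝ) :
    ∑ x ∈ Y, u (x + v) = ∑ x ∈ Y.map (addRightEmbedding v), u x := by
  simp

lemma sum_shift_sub_sq_le {n : ℕ} {i : ℕ} {W : Finset (Fin n → ℤ)} (hW : CellClosed i W)
    {h : (Fin n → ℤ) → ℝ} (hh : CellConst i h) (hv : VanishesOff W h) (v : Fin n → ℤ)
    (Y : Finset (Fin n → ℤ)) :
    ∑ x ∈ Y, (h (x + v) - h x) ^ 2 ≤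
      4 * (((∑ a, (v a).natAbs : ℕ) : ℝ) / 2 ^ i) * ∑ x ∈ W, h x ^ 2 := by
  have h1 := sum_shift_ne_le hW hh hv v Y
  have h2 := sum_shift_ne_le hW hh hv (-v) (Y.map (addRightEmbedding v))
  rw [← sum_comp_add] at h2
  simp only [add_neg_cancel_right, Pi.neg_apply, Int.natAbs_neg] at h2
  have key : ∀ x, (h (x + v) - h x) ^ 2 ≤
      2 * (if cellIdx i (x + v) ≠ cellIdx i x then h x ^ 2 else 0) +
      2 * (if cellIdx i x ≠ cellIdx i (x + v) then h (x + v) ^ 2 else 0) := by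
    intro x
    by_cases hx : cellIdx i (x + v) = cellIdx i x
    · simp [hh _ _ hx, hx]
    · rw [if_pos hx, if_pos (Ne.symm hx)]
      nlinarith [sq_nonneg (h (x + v) + h x)]
  refine (Finset.sum_le_sum fun x _ => key x).trans ?_
  rw [Finset.sum_add_distrib, ← Finset.mul_sum, ← Finset.mul_sum]
  linarith

lemma sum_sub_sq_le {n : ℕ} {W : Finset (Fin n → ℤ)}
    {h : (Fin n → ℤ) → ℝ} (hv : VanishesOff W h) (v : Fin n → ℤ) (Y : Finset (Fin n → ℤ)) :
    ∑ x ∈ Y, (h (x + v) - h x) ^ 2 ≤ 4 * ∑ x ∈ W, h x ^ 2 := by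
  have hv2 : VanishesOff W fun x => h x ^ 2 := fun x hx => by simp [hv x hx]
  have h1 := sum_le_of_vanishesOff Y hv2 fun _ => sq_nonneg _
  have h2 := sum_le_of_vanishesOff (Y.map (addRightEmbedding v)) hv2 fun _ => sq_nonneg _
  rw [← sum_comp_add] at h2
  have key : ∀ x, (h (x + v) - h x) ^ 2 ≤ 2 * h x ^ 2 + 2 * h (x + v) ^ 2 := fun x => by
    nlinarith [sq_nonneg (h (x + v) + h x)]
  refine (Finset.sum_le_sum fun x _ => key x).trans ?_
  rw [Finset.sum_add_distrib, ← Finset.mul_sum, ← Finset.mul_sum]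
  linarith

lemma sum_cell_shift_sub_sq_le {n : ℕ} (hn : 0 < n) {j k u : ℕ} {W : Finset (Fin n → ℤ)}
    (hW : CellClosed (j + u) W)
    {h : (Fin n → ℤ) → ℝ} (hh : CellConst (j + u) h) (hv : VanishesOff W h) {m : Fin n → ℤ}
    (hm : ∀ a, |m a| ≤ 2 ^ k) (Y : Finset (Fin n → ℤ)) :
    ∑ x ∈ Y, (h (x + fun a => 2 ^ j * m a) - h x) ^ 2 ≤
      4 * n * ((3 / 4 : ℝ) ^ (u - k)) ^ 2 * ∑ x ∈ W, h x ^ 2 := by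
  have hn1 : (1:ℝ) ≤ n := by exact_mod_cast hn
  have hW0 : 0 ≤ ∑ x ∈ W, h x ^ 2 := Finset.sum_nonneg fun _ _ => sq_nonneg _
  rcases le_total u k with huk | huk
  · refine (sum_sub_sq_le hv _ Y).trans ?_
    rw [Nat.sub_eq_zero_of_le huk]
    refine mul_le_mul_of_nonneg_right ?_ hW0
    simp; linarith
  · obtain ⟨s, rfl⟩ := Nat.exists_eq_add_of_le huk
    refine (sum_shift_sub_sq_le hW hh hv _ Y).trans (mul_le_mul_of_nonneg_right ?_ hW0)
    rw [Nat.add_sub_cancel_left, mul_assoc]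
    refine mul_le_mul_of_nonneg_left ?_ (by norm_num)
    have h1 : ((∑ a, (2 ^ j * m a : ℤ).natAbs : ℕ) : ℝ) ≤ n * 2 ^ (j + k) := by
      push_cast
      calc ∑ a, (((2 ^ j * m a : ℤ).natAbs : ℕ) : ℝ) ≤ ∑ _a : Fin n, (2:ℝ) ^ (j + k) := by
            refine Finset.sum_le_sum fun a _ => ?_
            rw [Nat.cast_natAbs, abs_mul, abs_of_pos (by positivity : (0:ℤ) < 2 ^ j), pow_add]
            have := mul_le_mul_of_nonneg_left (hm a) (by positivity : (0:ℤ) ≤ 2 ^ j)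
            exact_mod_cast this
        _ = _ := by simp
    rw [div_le_iff₀ (by positivity)]
    refine h1.trans ?_
    have h2 : (1:ℝ) ≤ ((3 / 4 : ℝ) ^ s) ^ 2 * 2 ^ s := by
      rw [← pow_mul, mul_comm s 2, pow_mul, ← mul_pow]
      exact one_le_pow₀ (by norm_num)
    rw [← add_assoc, pow_add _ (j + k) s]
    calc (n:ℝ) * 2 ^ (j + k) = n * 2 ^ (j + k) * 1 := by ring
      _ ≤ n * 2 ^ (j + k) * (((3 / 4 : ℝ) ^ s) ^ 2 * 2 ^ s) := by gcongr
      _ = _ := by ring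

lemma sum_three_quarters_le (k M : ℕ) :
    ∑ u ∈ Finset.range M, (3 / 4 : ℝ) ^ (u - k) ≤ k + 4 := by
  calc ∑ u ∈ Finset.range M, (3 / 4 : ℝ) ^ (u - k)
      ≤ ∑ u ∈ Finset.range (k + M), (3 / 4 : ℝ) ^ (u - k) :=
        Finset.sum_le_sum_of_subset_of_nonneg (Finset.range_mono (by omega))
          fun _ _ _ => by positivity
    _ = ∑ u ∈ Finset.range k, (3 / 4 : ℝ) ^ (u - k) + ∑ u ∈ Finset.range M, (3 / 4 : ℝ) ^ u := by
        rw [Finset.sum_range_add]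
        simp
    _ ≤ k + 4 := by
        refine add_le_add ?_ ?_
        · calc _ ≤ ∑ u ∈ Finset.range k, (1:ℝ) :=
                Finset.sum_le_sum fun u _ => pow_le_one₀ (by norm_num) (by norm_num)
            _ = _ := by simp
        · rw [geom_sum_eq (by norm_num)]
          have : (0:ℝ) ≤ (3 / 4) ^ M := by positivity
          rw [div_le_iff_of_neg (by norm_num)]
          linarith

lemma sum_cellAvg_shift_sub_sq_le {n : ℕ} (hn : 0 < n) {j k L : ℕ} (hj : j ≤ L)
    {W : Finset (Fin n → ℤ)} (hW : ∀ i ≤ L, CellClosed i W)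
    {f : (Fin n → ℤ) → ℝ} (hf : VanishesOff W f) {m : Fin n → ℤ}
    (hm : ∀ a, |m a| ≤ 2 ^ k) (Y : Finset (Fin n → ℤ)) :
    ∑ x ∈ Y, (cellAvg j f (x + fun a => 2 ^ j * m a) - cellAvg j f x) ^ 2 ≤
      (k + 4) * (4 * n) * ∑ u ∈ Finset.range (L + 1 - j),
        (3 / 4 : ℝ) ^ (u - k) * ∑ x ∈ W, cellDiff L (j + u) f x ^ 2 := by
  set v : Fin n → ℤ := fun a => 2 ^ j * m a
  have h1 : ∀ x, (cellAvg j f (x + v) - cellAvg j f x) ^ 2 ≤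
      (k + 4) * ∑ u ∈ Finset.range (L + 1 - j),
        ((cellDiff L (j + u) f (x + v) - cellDiff L (j + u) f x) ^ 2 /
          (3 / 4 : ℝ) ^ (u - k)) := by
    intro x
    rw [cellAvg_eq_sum_cellDiff hj, cellAvg_eq_sum_cellDiff hj, ← Finset.sum_sub_distrib]
    refine (Finset.sum_sq_le_sum_mul_sum_of_sq_le_mul _
      (f := fun u => (3 / 4 : ℝ) ^ (u - k)) (g := fun u => (cellDiff L (j + u) f (x + v) -
        cellDiff L (j + u) f x) ^ 2 / (3 / 4 : ℝ) ^ (u - k))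
      (fun _ _ => by positivity) (fun _ _ => by positivity) (fun u _ => le_of_eq (by field_simp))).trans ?_
    refine mul_le_mul_of_nonneg_right (sum_three_quarters_le k _) ?_
    exact Finset.sum_nonneg fun _ _ => by positivity
  refine (Finset.sum_le_sum fun x _ => h1 x).trans ?_
  rw [← Finset.mul_sum, Finset.sum_comm, mul_assoc]
  refine mul_le_mul_of_nonneg_left ?_ (by positivity)
  rw [Finset.mul_sum]
  refine Finset.sum_le_sum fun u hu => ?_
  rw [Finset.mem_range] at hu
  rw [← Finset.sum_div, div_le_iff₀ (by positivity)]
  refine (sum_cell_shift_sub_sq_le hn (hW (j + u) (by omega))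
    (cellDiff_const (by omega) f) (hf.cellDiff hW) hm Y).trans (le_of_eq ?_)
  ring

lemma sum_cells_le_of_forall {n : ℕ} {j : ℕ} (S : Finset (ℕ × (Fin n → ℤ)))
    (hS : ∀ J ∈ S, J.1 = j) {u : (Fin n → ℤ) → ℝ} {B : ℝ}
    (hB : ∀ Y : Finset (Fin n → ℤ), ∑ x ∈ Y, u x ≤ B) :
    ∑ J ∈ S, ∑ x ∈ cell J.1 J.2, u x ≤ B := by
  classical
  rw [← Finset.sum_biUnion]
  · exact hB _
  · intro J hJ J' hJ' hne
    rw [Function.onFun, Finset.disjoint_left]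
    intro y hy hy'
    rw [mem_cell] at hy hy'
    rw [hS J hJ] at hy
    rw [hS J' hJ'] at hy'
    exact hne (Prod.ext ((hS J hJ).trans (hS J' hJ').symm) (hy.symm.trans hy'))

lemma haarCoef_false {n : ℕ} {j : ℕ} (q r : Fin n → ℤ) (f : (Fin n → ℤ) → ℝ)
    {x : Fin n → ℤ} (hx : x ∈ cell j q) :
    cellAvg j f (x + fun a => 2 ^ j * r a) =
      (((2:ℝ) ^ j) ^ n)⁻¹ * haarCoef j (q + r) (fun _ => false) f := by
  rw [mem_cell] at hx
  have : cellIdx j (x + fun a => 2 ^ j * r a) = q + r := by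
    funext a
    have := congrFun hx a
    simp only [cellIdx, Pi.add_apply] at this ⊢
    rw [Int.add_mul_ediv_left _ _ (by positivity), this]
  rw [cellAvg, this]
  simp [haarCoef, haarSigns]

lemma sum_haarCoef_shift_sub_sq_le {n : ℕ} (hn : 0 < n) {k : ℕ} (S : Finset (ℕ × (Fin n → ℤ)))
    {f : (Fin n → ℤ) → ℝ} {Z : Finset (Fin n → ℤ)} (hf : VanishesOff Z f) {m : Fin n → ℤ}
    (hm : ∀ a, |m a| ≤ 2 ^ k) :
    ∑ J ∈ S, (((2:ℝ) ^ J.1) ^ n)⁻¹ * (haarCoef J.1 (J.2 + m) (fun _ => false) f -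
      haarCoef J.1 (J.2 + 0) (fun _ => false) f) ^ 2 ≤
      ((k:ℝ) + 4) ^ 2 * (4 * n) * ∑ x ∈ Z, f x ^ 2 := by
  classical
  set L := S.sup Prod.fst with hL
  have hLS : ∀ J ∈ S, J.1 ≤ L := fun J hJ => Finset.le_sup (f := Prod.fst) hJ
  obtain ⟨W, hZW, hW⟩ := exists_cellClosed L Z
  have hfW : VanishesOff W f := fun x hx => hf x fun h => hx (hZW h)
  have hZ : ∑ x ∈ Z, f x ^ 2 = ∑ x ∈ W, f x ^ 2 :=
    Finset.sum_subset hZW fun x _ hx => by rw [hf x hx]; simp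
  rw [hZ, ← sum_cellDiff_sq hW f]
  have h1 : ∀ J : ℕ × (Fin n → ℤ), (((2:ℝ) ^ J.1) ^ n)⁻¹ *
      (haarCoef J.1 (J.2 + m) (fun _ => false) f -
        haarCoef J.1 (J.2 + 0) (fun _ => false) f) ^ 2 =
      ∑ x ∈ cell J.1 J.2, (cellAvg J.1 f (x + fun a => 2 ^ J.1 * m a) - cellAvg J.1 f x) ^ 2 := by
    intro J
    have : ∀ x ∈ cell J.1 J.2,
        (cellAvg J.1 f (x + fun a => 2 ^ J.1 * m a) - cellAvg J.1 f x) ^ 2 =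
        ((((2:ℝ) ^ J.1) ^ n)⁻¹) ^ 2 * (haarCoef J.1 (J.2 + m) (fun _ => false) f -
        haarCoef J.1 (J.2 + 0) (fun _ => false) f) ^ 2 := by
      intro x hx
      have e := haarCoef_false J.2 0 f hx
      have e0 : (x + fun a => 2 ^ J.1 * (0 : Fin n → ℤ) a) = x := by funext a; simp
      rw [e0] at e
      rw [haarCoef_false J.2 m f hx, e]
      ring
    rw [Finset.sum_congr rfl this, Finset.sum_const, card_cell, nsmul_eq_mul]
    push_cast
    field_simp
  simp only [h1]
  rw [← Finset.sum_fiberwise_of_maps_to (g := Prod.fst) (t := Finset.range (L + 1))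
    (fun J hJ => Finset.mem_range.mpr (by have := hLS J hJ; omega))]
  set D : ℕ → ℝ := fun i => ∑ x ∈ W, cellDiff L i f x ^ 2
  have h2 : ∀ j ∈ Finset.range (L + 1), ∑ J ∈ S with J.1 = j, ∑ x ∈ cell J.1 J.2,
      (cellAvg J.1 f (x + fun a => 2 ^ J.1 * m a) - cellAvg J.1 f x) ^ 2 ≤
      (k + 4) * (4 * n) * ∑ u ∈ Finset.range (L + 1 - j), (3 / 4 : ℝ) ^ (u - k) * D (j + u) := by
    intro j hj
    rw [Finset.mem_range] at hj
    refine le_trans (le_of_eq ?_) (sum_cells_le_of_forall (j := j) (S.filter fun J => J.1 = j)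
      (fun J hJ => (Finset.mem_filter.mp hJ).2)
      (fun Y => sum_cellAvg_shift_sub_sq_le hn (by omega) hW hfW hm Y))
    exact Finset.sum_congr rfl fun J hJ => by rw [(Finset.mem_filter.mp hJ).2]
  refine (Finset.sum_le_sum h2).trans ?_
  rw [← Finset.mul_sum, ← Finset.sum_range_diag_flip]
  calc (k + 4) * (4 * n) * ∑ i ∈ Finset.range (L + 1), ∑ j ∈ Finset.range (i + 1),
        (3 / 4 : ℝ) ^ (i - j - k) * D (j + (i - j))
      ≤ (k + 4) * (4 * n) * ∑ i ∈ Finset.range (L + 1), (k + 4) * D i := by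
        gcongr with i hi
        have : ∀ j ∈ Finset.range (i + 1), (3 / 4 : ℝ) ^ (i - j - k) * D (j + (i - j)) =
            (3 / 4 : ℝ) ^ (i - j - k) * D i := by
          intro j hj
          rw [Finset.mem_range] at hj
          rw [Nat.add_sub_cancel' (by omega)]
        rw [Finset.sum_congr rfl this, ← Finset.sum_mul,
          Finset.sum_flip (fun j => (3 / 4 : ℝ) ^ (j - k))]
        exact mul_le_mul_of_nonneg_right (sum_three_quarters_le k _)
          (Finset.sum_nonneg fun _ _ => sq_nonneg _)
    _ = _ := by
        rw [← Finset.mul_sum]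
        ring

lemma abs_shiftForm_sub_le {n : ℕ} (hn : 0 < n) {k : ℕ} (S : Finset (ℕ × (Fin n → ℤ)))
    (hS : ∀ J ∈ S, 0 < J.1) (β : ℕ × (Fin n → ℤ) → ℝ) (hβ : ∀ J, |β J| ≤ 1)
    {m : Fin n → ℤ} (hm : ∀ a, |m a| ≤ 2 ^ k) {η : Fin n → Bool} (hη : η ≠ fun _ => false)
    {f g : (Fin n → ℤ) → ℝ} {Z Y : Finset (Fin n → ℤ)} (hf : VanishesOff Z f)
    (hg : VanishesOff Y g) :
    |shiftForm S β m 0 (fun _ => false) η f g - shiftForm S β 0 0 (fun _ => false) η f g| ≤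
      8 * n * ((k:ℝ) + 1) * √(∑ x ∈ Z, f x ^ 2) * √(∑ x ∈ Y, g x ^ 2) := by
  set u : ℕ × (Fin n → ℤ) → ℝ := fun J => haarCoef J.1 (J.2 + m) (fun _ => false) f -
    haarCoef J.1 (J.2 + 0) (fun _ => false) f with hu
  have e : shiftForm S β m 0 (fun _ => false) η f g - shiftForm S β 0 0 (fun _ => false) η f g =
      ∑ J ∈ S, β J / ((2:ℝ) ^ J.1) ^ n * u J * haarCoef J.1 (J.2 + 0) η g := by
    rw [shiftForm, shiftForm, ← Finset.sum_sub_distrib]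
    exact Finset.sum_congr rfl fun J _ => by simp only [hu]; ring
  have key : ∀ J ∈ S, |β J / ((2:ℝ) ^ J.1) ^ n * u J *
      haarCoef J.1 (J.2 + 0) η g| ≤ √((((2:ℝ) ^ J.1) ^ n)⁻¹ * u J ^ 2) *
      √((((2:ℝ) ^ J.1) ^ n)⁻¹ * haarCoef J.1 (J.2 + 0) η g ^ 2) := by
    intro J _
    have hV : 0 < ((2:ℝ) ^ J.1) ^ n := by positivity
    rw [Real.sqrt_mul (by positivity), Real.sqrt_mul (by positivity), Real.sqrt_sq_eq_abs,
      Real.sqrt_sq_eq_abs, abs_mul, abs_mul, abs_div, abs_of_pos hV]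
    have e := Real.mul_self_sqrt (inv_nonneg.mpr hV.le)
    calc _ = |β J| * ((((2:ℝ) ^ J.1) ^ n)⁻¹ * (|u J| * |haarCoef J.1 (J.2 + 0) η g|)) := by ring
      _ ≤ 1 * ((((2:ℝ) ^ J.1) ^ n)⁻¹ * (|u J| * |haarCoef J.1 (J.2 + 0) η g|)) := by
          gcongr
          exact hβ J
      _ = (√(((2:ℝ) ^ J.1) ^ n)⁻¹ * √(((2:ℝ) ^ J.1) ^ n)⁻¹) *
          (|u J| * |haarCoef J.1 (J.2 + 0) η g|) := by rw [e, one_mul]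
      _ = _ := by ring
  rw [e]
  refine (Finset.abs_sum_le_sum_abs _ _).trans ((Finset.sum_le_sum key).trans ?_)
  refine (Real.sum_sqrt_mul_sqrt_le _ (fun _ => by positivity) (fun _ => by positivity)).trans ?_
  have hn1 : (1:ℝ) ≤ n := by exact_mod_cast hn
  have hk : (0:ℝ) ≤ k := Nat.cast_nonneg k
  gcongr ?_ * √?_
  · refine (Real.sqrt_le_sqrt (sum_haarCoef_shift_sub_sq_le hn S hf hm)).trans ?_
    rw [Real.sqrt_le_left (by positivity), mul_pow, Real.sq_sqrt (by positivity)]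
    refine mul_le_mul_of_nonneg_right ?_ (by positivity)
    have h1 : ((k:ℝ) + 4) ^ 2 ≤ (4 * (k + 1)) ^ 2 := by gcongr; linarith
    calc ((k:ℝ) + 4) ^ 2 * (4 * n) ≤ (4 * (k + 1)) ^ 2 * (4 * (n * n)) := by
          gcongr
          nlinarith
      _ = _ := by ring
  · exact sum_haarCoef_sq_le S hS 0 hη hg

lemma exists_abs_shiftForm_le {n : ℕ} (hn : 0 < n) {p q : ℝ} (hpq : p.HolderConjugate q) :
    ∃ C : ℝ, 0 < C ∧ ∀ (k : ℕ) (S : Finset (ℕ × (Fin n → ℤ))), (∀ J ∈ S, 0 < J.1) →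
      ∀ β : ℕ × (Fin n → ℤ) → ℝ, (∀ J, |β J| ≤ 1) →
      ∀ m : Fin n → ℤ, (∀ a, |m a| ≤ 2 ^ k) →
      ∀ ζ θ : Fin n → Bool, (ζ ≠ fun _ => false) → (θ ≠ fun _ => false) →
      ∀ f g Z, VanishesOff Z f → VanishesOff Z g →
        |shiftForm S β 0 m ζ θ f g| ≤ C * (k + 1) * lpNormOn Z p f * lpNormOn Z q g := by
  obtain ⟨C, hC, h⟩ := exists_abs_form_le hn hpq
  refine ⟨C, hC, fun k S hS β hβ m hm ζ θ hζ hθ f g Z hf hg => ?_⟩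
  have hk : (1:ℝ) ≤ (k:ℝ) + 1 := by linarith [(Nat.cast_nonneg k : (0:ℝ) ≤ k)]
  refine h (k + 1) (by linarith) (shiftOp S β 0 m ζ θ) (shiftOp S β m 0 θ ζ) _
    (fun f g Z hg => shiftForm_eq_sum_shiftOp S β 0 m ζ θ f g Z hg)
    (fun f g Z hf => by
      rw [shiftForm_swap]; exact shiftForm_eq_sum_shiftOp S β m 0 θ ζ g f Z hf)
    (fun f g Z Y hf hg => (abs_shiftForm_le S hS β hβ 0 m hζ hθ hf hg).trans ?_)
    (cellBound_shiftOp S β hβ 0 m ζ θ (by simpa using hm))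
    (cellBound_shiftOp S β hβ m 0 θ ζ (by simpa using hm)) f g Z hf hg
  rw [mul_assoc]
  exact le_mul_of_one_le_left (by positivity) hk

lemma exists_abs_shiftForm_sub_le {n : ℕ} (hn : 0 < n) {p q : ℝ} (hpq : p.HolderConjugate q) :
    ∃ C : ℝ, 0 < C ∧ ∀ (k : ℕ) (S : Finset (ℕ × (Fin n → ℤ))), (∀ J ∈ S, 0 < J.1) →
      ∀ β : ℕ × (Fin n → ℤ) → ℝ, (∀ J, |β J| ≤ 1) →
      ∀ m : Fin n → ℤ, (∀ a, |m a| ≤ 2 ^ k) →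
      ∀ η : Fin n → Bool, (η ≠ fun _ => false) →
      ∀ f g Z, VanishesOff Z f → VanishesOff Z g →
        |shiftForm S β m 0 (fun _ => false) η f g - shiftForm S β 0 0 (fun _ => false) η f g| ≤
          C * (k + 1) * lpNormOn Z p f * lpNormOn Z q g := by
  obtain ⟨C, hC, h⟩ := exists_abs_form_le hn hpq
  have hn1 : (1:ℝ) ≤ n := by exact_mod_cast hn
  refine ⟨C * (8 * n), by positivity, fun k S hS β hβ m hm η hη f g Z hf hg => ?_⟩
  have hk : (1:ℝ) ≤ (k:ℝ) + 1 := by linarith [(Nat.cast_nonneg k : (0:ℝ) ≤ k)]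
  have hN : ((k:ℝ) + 1) + (k + 1) ≤ 8 * n * (k + 1) := by nlinarith
  have h0 : ∀ a, |(0 : Fin n → ℤ) a - (0 : Fin n → ℤ) a| ≤ 2 ^ k := fun a => by simp
  refine (h (8 * n * (k + 1)) (by positivity)
    (shiftOp S β m 0 (fun _ => false) η - shiftOp S β 0 0 (fun _ => false) η)
    (shiftOp S β 0 m η (fun _ => false) - shiftOp S β 0 0 η (fun _ => false))
    (fun f g => shiftForm S β m 0 (fun _ => false) η f g -
      shiftForm S β 0 0 (fun _ => false) η f g)
    (fun f g Z hg => ?_) (fun f g Z hf => ?_)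
    (fun f g Z Y hf hg => abs_shiftForm_sub_le hn S hS β hβ hm hη hf hg)
    (((cellBound_shiftOp S β hβ m 0 _ η (by simpa using hm)).sub
      (cellBound_shiftOp S β hβ 0 0 _ η h0)).mono hN)
    (((cellBound_shiftOp S β hβ 0 m η _ (by simpa using hm)).sub
      (cellBound_shiftOp S β hβ 0 0 η _ h0)).mono hN) f g Z hf hg).trans (le_of_eq (by ring))
  · simp only [LinearMap.sub_apply, Pi.sub_apply, mul_sub, Finset.sum_sub_distrib,
      shiftForm_eq_sum_shiftOp _ _ _ _ _ _ f g Z hg]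
  · simp only [LinearMap.sub_apply, Pi.sub_apply, mul_sub, Finset.sum_sub_distrib,
      shiftForm_swap S β _ _ (fun _ => false) η f g,
      shiftForm_eq_sum_shiftOp _ _ _ _ _ _ g f Z hf]

lemma abs_apply_le_inorm {n : ℕ} (m : Fin n → ℤ) (a : Fin n) : |(m a : ℝ)| ≤ inorm m := by
  have := norm_le_pi_norm (fun i => (m i : ℝ) : Fin n → ℝ) a
  rwa [Real.norm_eq_abs] at this

lemma inorm_nonneg {n : ℕ} (m : Fin n → ℤ) : 0 ≤ inorm m := norm_nonneg _

lemma inorm_neg {n : ℕ} (m : Fin n → ℤ) : inorm (-m) = inorm m := by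
  unfold inorm
  rw [← norm_neg]
  congr 1
  funext i
  simp

lemma exists_le_two_pow {n : ℕ} (m : Fin n → ℤ) :
    ∃ k : ℕ, (∀ a, |m a| ≤ 2 ^ k) ∧ (k:ℝ) + 1 ≤ 5 * Real.log (2 + inorm m) := by
  have h0 := inorm_nonneg m
  set M := ⌊inorm m⌋₊ with hM
  refine ⟨Nat.log 2 M + 1, fun a => ?_, ?_⟩
  · have h1 : (m a).natAbs ≤ M := by
      rw [hM, Nat.le_floor_iff h0, Nat.cast_natAbs]
      push_cast
      exact abs_apply_le_inorm m a
    have h2 : (m a).natAbs < 2 ^ (Nat.log 2 M + 1) :=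
      h1.trans_lt (Nat.lt_pow_succ_log_self (by norm_num) M)
    rw [Int.abs_eq_natAbs]
    exact_mod_cast h2.le
  · have hl : 0 < Real.log 2 := Real.log_pos (by norm_num)
    have hl2 := Real.log_two_gt_d9
    have h2 : Real.log 2 ≤ Real.log (2 + inorm m) := Real.log_le_log (by norm_num) (by linarith)
    have h1 : (Nat.log 2 M : ℝ) * Real.log 2 ≤ Real.log (2 + inorm m) := by
      rw [← Real.log_pow]
      refine Real.log_le_log (by positivity) ?_
      rcases Nat.eq_zero_or_pos M with h | h
      · rw [h]; simp; linarith
      · have h3 : 2 ^ Nat.log 2 M ≤ M := Nat.pow_log_le_self 2 h.ne'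
        have h4 : (M:ℝ) ≤ inorm m := Nat.floor_le h0
        have h5 : ((2:ℝ) ^ Nat.log 2 M) ≤ M := by exact_mod_cast h3
        linarith
    push_cast
    have h6 : (Nat.log 2 M : ℝ) + 1 + 1 ≤ 3 * Real.log (2 + inorm m) / Real.log 2 := by
      rw [le_div_iff₀ hl]
      linarith
    refine h6.trans ?_
    rw [div_le_iff₀ hl]
    nlinarith

/-- The discrete Haar function with a given level, position and type. -/
def haarAt {n : ℕ} (r : ℕ × (Fin n → ℤ) × (Fin n → Bool)) (z : Fin n → ℤ) : ℝ :=
  if cellIdx r.1 z = r.2.1 then haarSigns r.1 r.2.2 z else 0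

lemma haarSigns_mul {n : ℕ} (j : ℕ) (η θ : Fin n → Bool) (z : Fin n → ℤ) :
    haarSigns j η z * haarSigns j θ z = haarSigns j (fun i => xor (η i) (θ i)) z := by
  unfold haarSigns
  rw [← Finset.prod_mul_distrib]
  refine Finset.prod_congr rfl fun i _ => ?_
  have h : haarSign j (z i) * haarSign j (z i) = 1 := by
    rw [← sq, ← sq_abs, abs_haarSign, one_pow]
  by_cases h1 : η i = true <;> by_cases h2 : θ i = true <;> simp [h1, h2, h]

lemma haarAt_vanishesOff {n : ℕ} (r : ℕ × (Fin n → ℤ) × (Fin n → Bool)) :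
    VanishesOff (cell r.1 r.2.1) (haarAt r) := by
  intro z hz
  rw [mem_cell] at hz
  exact if_neg hz

lemma sum_haarAt {n : ℕ} {r : ℕ × (Fin n → ℤ) × (Fin n → Bool)} (hr : 0 < r.1)
    (hη : r.2.2 ≠ fun _ => false) : ∑ z ∈ cell r.1 r.2.1, haarAt r z = 0 := by
  rw [← sum_haarSigns hr r.2.1 hη]
  exact Finset.sum_congr rfl fun z hz => if_pos (mem_cell.mp hz)

lemma haarAt_const {n : ℕ} {j : ℕ} {r : ℕ × (Fin n → ℤ) × (Fin n → Bool)} (hj : j < r.1) :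
    CellConst j (haarAt r) := by
  intro x y hxy
  simp only [haarAt, cellIdx_eq_of_le hj.le hxy, haarSigns_eq_of_cellIdx_eq hj _ hxy]

lemma haarCoef_haarAt {n : ℕ} {q r : ℕ × (Fin n → ℤ) × (Fin n → Bool)} (hq : 0 < q.1)
    (hr : 0 < r.1) (hqη : q.2.2 ≠ fun _ => false) (hrη : r.2.2 ≠ fun _ => false) :
    haarCoef q.1 q.2.1 q.2.2 (haarAt r) = if q = r then ((2:ℝ) ^ q.1) ^ n else 0 := by
  obtain ⟨j, I, η⟩ := q
  obtain ⟨j', I', η'⟩ := r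
  rcases lt_trichotomy j j' with h | h | h
  · rw [if_neg (fun e => h.ne (congrArg Prod.fst e))]
    exact haarCoef_eq_zero_of_cellConst hq I hqη (haarAt_const h)
  · subst h
    by_cases hI : I = I'
    · subst hI
      have e : haarCoef j I η (haarAt (j, I, η')) =
          ∑ x ∈ cell j I, haarSigns j (fun i => xor (η' i) (η i)) x := by
        refine Finset.sum_congr rfl fun x hx => ?_
        rw [haarAt, if_pos (mem_cell.mp hx), haarSigns_mul]
      dsimp only
      rw [e]
      by_cases hη : η = η'
      · subst hη
        simp [haarSigns, card_cell]
      · rw [if_neg (by simpa using hη)]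
        refine sum_haarSigns hq I fun h => hη ?_
        funext i
        have := congrFun h i
        revert this
        cases η i <;> cases η' i <;> simp
    · rw [if_neg (by simp [hI])]
      refine Finset.sum_eq_zero fun x hx => ?_
      rw [haarAt, if_neg (by rw [mem_cell.mp hx]; exact hI), zero_mul]
  · rw [if_neg (fun e => h.ne' (congrArg Prod.fst e))]
    exact haarCoef_eq_zero_of_cell h I I' η (haarAt_vanishesOff (j', I', η'))
      (sum_haarAt (r := (j', I', η')) hr hrη)

lemma cellAvg_of_const {n : ℕ} {j : ℕ} {f : (Fin n → ℤ) → ℝ} (hf : CellConst j f) :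
    cellAvg j f = f := by
  funext x
  rw [cellAvg, Finset.sum_congr rfl fun y hy => hf y x (mem_cell.mp hy), Finset.sum_const,
    card_cell, nsmul_eq_mul]
  push_cast
  field_simp

lemma cellAvg_haarAt_of_le {n : ℕ} {j : ℕ} {r : ℕ × (Fin n → ℤ) × (Fin n → Bool)} (hr : 0 < r.1)
    (hη : r.2.2 ≠ fun _ => false) (hj : r.1 ≤ j) : cellAvg j (haarAt r) = 0 := by
  have h : cellAvg r.1 (haarAt r) = 0 := by
    funext x
    by_cases hx : cellIdx r.1 x = r.2.1
    · rw [cellAvg, hx, sum_haarAt hr hη, mul_zero]; rfl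
    · rw [cellAvg, Finset.sum_eq_zero, mul_zero]
      · rfl
      · intro y hy
        exact if_neg fun h => hx ((mem_cell.mp hy).symm.trans h)
  rw [← cellAvg_cellAvg hj, h]
  funext x
  simp [cellAvg]

lemma cellAvg_sum {n : ℕ} {ι : Type*} (j : ℕ) (F : Finset ι) (c : ι → ℝ)
    (h : ι → (Fin n → ℤ) → ℝ) (z : Fin n → ℤ) :
    cellAvg j (fun z => ∑ r ∈ F, c r * h r z) z = ∑ r ∈ F, c r * cellAvg j (h r) z := by
  simp only [cellAvg]
  rw [Finset.sum_comm, Finset.mul_sum]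
  refine Finset.sum_congr rfl fun r _ => ?_
  rw [← Finset.mul_sum]
  ring

lemma cellAvg_haarSum {n : ℕ} (j : ℕ) {F : Finset (ℕ × (Fin n → ℤ) × (Fin n → Bool))}
    (hF : ∀ r ∈ F, 0 < r.1 ∧ r.2.2 ≠ fun _ => false)
    (c : ℕ × (Fin n → ℤ) × (Fin n → Bool) → ℝ) (z : Fin n → ℤ) :
    cellAvg j (fun z => ∑ r ∈ F, c r * haarAt r z) z = ∑ r ∈ F with j < r.1, c r * haarAt r z := by
  rw [cellAvg_sum, Finset.sum_filter]
  refine Finset.sum_congr rfl fun r hr => ?_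
  split_ifs with h
  · rw [cellAvg_of_const (haarAt_const h)]
  · rw [cellAvg_haarAt_of_le (hF r hr).1 (hF r hr).2 (not_lt.mp h), Pi.zero_apply, mul_zero]

lemma haarCoef_haarSum {n : ℕ} {F : Finset (ℕ × (Fin n → ℤ) × (Fin n → Bool))}
    (hF : ∀ r ∈ F, 0 < r.1 ∧ r.2.2 ≠ fun _ => false)
    (c : ℕ × (Fin n → ℤ) × (Fin n → Bool) → ℝ) {q : ℕ × (Fin n → ℤ) × (Fin n → Bool)}
    (hq : q ∈ F) :
    haarCoef q.1 q.2.1 q.2.2 (fun z => ∑ r ∈ F, c r * haarAt r z) = ((2:ℝ) ^ q.1) ^ n * c q := by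
  have h : haarCoef q.1 q.2.1 q.2.2 (fun z => ∑ r ∈ F, c r * haarAt r z) =
      ∑ r ∈ F, c r * haarCoef q.1 q.2.1 q.2.2 (haarAt r) := by
    simp only [haarCoef, Finset.sum_mul, Finset.mul_sum]
    rw [Finset.sum_comm]
    exact Finset.sum_congr rfl fun r _ => Finset.sum_congr rfl fun z _ => by ring
  rw [h, Finset.sum_congr rfl fun r hr => by
    rw [haarCoef_haarAt (hF q hq).1 (hF r hr).1 (hF q hq).2 (hF r hr).2]]
  simp only [mul_ite, mul_zero]
  rw [Finset.sum_ite_eq, if_pos hq, mul_comm]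

/-- The average of a function as a combination of indicators of cells. -/
lemma cellAvg_eq_sum_haarAt {n : ℕ} (j : ℕ) {f : (Fin n → ℤ) → ℝ} {Z : Finset (Fin n → ℤ)}
    (hf : VanishesOff Z f) (z : Fin n → ℤ) :
    cellAvg j f z = ∑ I ∈ Z.image (cellIdx j),
      (((2:ℝ) ^ j) ^ n)⁻¹ * haarCoef j I (fun _ => false) f * haarAt (j, I, fun _ => false) z := by
  simp only [haarAt, haarSigns, haarCoef]
  simp only [Bool.false_eq_true, if_false, Finset.prod_const_one, mul_one, mul_ite, mul_zero]
  rw [Finset.sum_ite_eq]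
  split_ifs with h
  · rfl
  · rw [cellAvg, Finset.sum_eq_zero, mul_zero]
    intro y hy
    refine hf y fun hyZ => h ?_
    rw [← mem_cell.mp hy]
    exact Finset.mem_image_of_mem _ hyZ

lemma haarCoef_false_eq_zero {n : ℕ} (j : ℕ) {f : (Fin n → ℤ) → ℝ} {Z : Finset (Fin n → ℤ)}
    (hf : VanishesOff Z f) {I : Fin n → ℤ} (hI : I ∉ Z.image (cellIdx j)) :
    haarCoef j I (fun _ => false) f = 0 := by
  refine Finset.sum_eq_zero fun y hy => ?_
  rw [hf y fun hyZ => hI ?_, zero_mul]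
  rw [← mem_cell.mp hy]
  exact Finset.mem_image_of_mem _ hyZ

lemma sum_eq_tsum_sub {α : Type*} [AddCommGroup α] {Y : Finset α} {a s : α → ℝ}
    (ha : VanishesOff Y a) (J : α) (hs : Summable fun m => s (J + m))
    (hs0 : ∑' m, s (J + m) = 0) :
    ∑ I ∈ Y, a I * s I = ∑' m, (a (J + m) - a J) * s (J + m) := by
  have h1 : ∑' I, a I * s I = ∑ I ∈ Y, a I * s I :=
    tsum_eq_sum fun I hI => by rw [ha I hI, zero_mul]
  have hsum : Summable fun I => a I * s I :=
    summable_of_ne_finset_zero (s := Y) fun I hI => by rw [ha I hI, zero_mul]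
  have h2 : ∑' m, a (J + m) * s (J + m) = ∑' I, a I * s I :=
    (Equiv.addLeft J).tsum_eq fun I => a I * s I
  have hsum2 : Summable fun m => a (J + m) * s (J + m) :=
    (Equiv.addLeft J).summable_iff.mpr hsum
  simp only [sub_mul]
  rw [hsum2.tsum_sub (hs.mul_left (a J)), tsum_mul_left, hs0, mul_zero, sub_zero, h2, h1]

lemma sum_abs_cell_le {n : ℕ} (j : ℕ) (I : Fin n → ℤ) {f : (Fin n → ℤ) → ℝ}
    {Z : Finset (Fin n → ℤ)} (hf : VanishesOff Z f) (η : Fin n → Bool) :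
    |haarCoef j I η f| ≤ ∑ x ∈ Z, |f x| :=
  (abs_haarCoef_le j I η f).trans
    (sum_le_of_vanishesOff _ (fun x hx => by simp [hf x hx]) fun _ => abs_nonneg _)

lemma abs_tsum_le_of_log_bound {n : ℕ} {X B : (Fin n → ℤ) → ℝ} {A R : ℝ} (hR : 0 ≤ R)
    (hX : ∀ m, |X m| ≤ B m * Real.log (2 + inorm m) * R)
    (hB : Summable fun m => B m * Real.log (2 + inorm m))
    (hA : ∑' m, B m * Real.log (2 + inorm m) ≤ A) : |∑' m, X m| ≤ A * R := by
  have := tsum_of_norm_bounded (f := X) (hB.hasSum.mul_right R) hX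
  rw [Real.norm_eq_abs] at this
  exact this.trans (mul_le_mul_of_nonneg_right hA hR)

lemma mul_abs_le_log {n : ℕ} {C N b R x : ℝ} (hC : 0 ≤ C) (hR : 0 ≤ R) (hb : 0 ≤ b)
    (m : Fin n → ℤ) (hN : N ≤ 5 * Real.log (2 + inorm m)) (hx : |x| ≤ C * N * R) :
    |b * x| ≤ b * Real.log (2 + inorm m) * (5 * C * R) := by
  rw [abs_mul, abs_of_nonneg hb, mul_assoc b]
  refine mul_le_mul_of_nonneg_left (hx.trans ?_) hb
  have : C * R * N ≤ C * R * (5 * Real.log (2 + inorm m)) := by gcongr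
  linarith

lemma abs_div_le_one_of_le {x b : ℝ} (h : |x| ≤ b) : |x / b| ≤ 1 := by
  have hb : 0 ≤ b := (abs_nonneg x).trans h
  rw [abs_div, abs_of_nonneg hb]
  exact div_le_one_of_le₀ h hb

lemma mul_div_self_of_abs_le {x b : ℝ} (h : |x| ≤ b) : b * (x / b) = x := by
  rcases eq_or_ne b 0 with hb | hb
  · subst hb
    rw [abs_nonpos_iff.mp h]; simp
  · field_simp

lemma exists_abs_paraproduct_le {n : ℕ} (hn : 0 < n) {p q : ℝ} (hpq : p.HolderConjugate q) :
    ∃ C : ℝ, 0 < C ∧ ∀ (G : Finset (ℕ × (Fin n → ℤ) × (Fin n → Bool))),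
      (∀ r ∈ G, 0 < r.1 ∧ r.2.2 ≠ fun _ => false) →
      ∀ (τ : ℕ × (Fin n → ℤ) × (Fin n → Bool) → (Fin n → ℤ) → ℝ) (A : ℝ), 0 ≤ A →
      (∀ r ∈ G, Summable (τ r)) →
      (∀ η : Fin n → Bool, (η ≠ fun _ => false) → ∃ B : (Fin n → ℤ) → ℝ,
        (∀ m j I, |τ (j, I, η) m| ≤ B m) ∧
        (Summable fun m => B m * Real.log (2 + inorm m)) ∧
        ∑' m, B m * Real.log (2 + inorm m) ≤ A) →
      ∀ f g Z, VanishesOff Z f → VanishesOff Z g →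
        |∑ r ∈ G, ((((2:ℝ) ^ r.1) ^ n)⁻¹ * haarCoef r.1 r.2.1 r.2.2 g) *
          ∑' m, (haarCoef r.1 (r.2.1 + m) (fun _ => false) f -
            haarCoef r.1 r.2.1 (fun _ => false) f) * τ r m| ≤
          C * A * (lpNormOn Z p f * lpNormOn Z q g) := by
  classical
  obtain ⟨C, hC, h⟩ := exists_abs_shiftForm_sub_le hn hpq
  refine ⟨2 ^ n * (5 * C), by positivity, fun G hG τ A hA hsum hB f g Z hf hg => ?_⟩
  set R := lpNormOn Z p f * lpNormOn Z q g with hR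
  have hR0 : 0 ≤ R := mul_nonneg (lpNormOn_nonneg _ _ _) (lpNormOn_nonneg _ _ _)
  set u : ℕ × (Fin n → ℤ) × (Fin n → Bool) → ℝ := fun r =>
    (((2:ℝ) ^ r.1) ^ n)⁻¹ * haarCoef r.1 r.2.1 r.2.2 g
  set D : ℕ × (Fin n → ℤ) × (Fin n → Bool) → (Fin n → ℤ) → ℝ := fun r m =>
    haarCoef r.1 (r.2.1 + m) (fun _ => false) f - haarCoef r.1 r.2.1 (fun _ => false) f
  have hDs : ∀ r ∈ G, Summable fun m => D r m * τ r m := by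
    intro r hr
    refine Summable.of_norm_bounded ((hsum r hr).abs.mul_left (2 * ∑ x ∈ Z, |f x|)) fun m => ?_
    rw [Real.norm_eq_abs, abs_mul]
    refine mul_le_mul_of_nonneg_right ?_ (abs_nonneg _)
    have h1 := sum_abs_cell_le r.1 (r.2.1 + m) hf (fun _ => false)
    have h2 := sum_abs_cell_le r.1 r.2.1 hf (fun _ => false)
    exact (abs_sub _ _).trans (by linarith)
  have key : ∀ η : Fin n → Bool, |∑ r ∈ G with r.2.2 = η, u r * ∑' m, D r m * τ r m| ≤
      A * (5 * C * R) := by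
    intro η
    by_cases hη : η = fun _ => false
    · rw [Finset.sum_eq_zero]
      · rw [abs_zero]; positivity
      · intro r hr
        obtain ⟨hr, hr'⟩ := Finset.mem_filter.mp hr
        exact absurd (hr'.trans hη) (hG r hr).2
    · obtain ⟨B, hB1, hB2, hB3⟩ := hB η hη
      simp only [← tsum_mul_left]
      rw [← Summable.tsum_finsetSum fun r hr =>
        (hDs r (Finset.mem_filter.mp hr).1).mul_left (u r)]
      refine abs_tsum_le_of_log_bound (by positivity) (fun m => ?_) hB2 hB3
      obtain ⟨k, hk1, hk2⟩ := exists_le_two_pow m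
      set S := (G.filter fun r => r.2.2 = η).image fun r => (r.1, r.2.1) with hS
      have hinj : Set.InjOn (fun r : ℕ × (Fin n → ℤ) × (Fin n → Bool) => (r.1, r.2.1))
          ((G.filter fun r => r.2.2 = η) : Finset _) := by
        intro r hr r' hr' e
        have e1 := (Finset.mem_filter.mp (Finset.mem_coe.mp hr)).2
        have e2 := (Finset.mem_filter.mp (Finset.mem_coe.mp hr')).2
        rw [Prod.mk.injEq] at e
        exact Prod.ext e.1 (Prod.ext e.2 (e1.trans e2.symm))
      have hS0 : ∀ J ∈ S, 0 < J.1 := by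
        intro J hJ
        obtain ⟨r, hr, rfl⟩ := Finset.mem_image.mp hJ
        exact (hG r (Finset.mem_filter.mp hr).1).1
      have hb0 : 0 ≤ B m := (abs_nonneg _).trans (hB1 m 0 0)
      set β : ℕ × (Fin n → ℤ) → ℝ := fun J => τ (J.1, J.2, η) m / B m with hβ
      have e : ∑ r ∈ G with r.2.2 = η, u r * (D r m * τ r m) =
          B m * (shiftForm S β m 0 (fun _ => false) η f g -
            shiftForm S β 0 0 (fun _ => false) η f g) := by
        rw [shiftForm, shiftForm, ← Finset.sum_sub_distrib, hS, Finset.sum_image hinj,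
          Finset.mul_sum]
        refine Finset.sum_congr rfl fun r hr => ?_
        obtain ⟨j, I, η'⟩ := r
        have e1 : η' = η := (Finset.mem_filter.mp hr).2
        subst e1
        simp only [u, D, β, add_zero]
        have := mul_div_self_of_abs_le (hB1 m j I)
        calc _ = (((2:ℝ) ^ j) ^ n)⁻¹ * haarCoef j I η' g * ((haarCoef j (I + m) (fun _ => false) f -
            haarCoef j I (fun _ => false) f) * (B m * (τ (j, I, η') m / B m))) := by rw [this]
          _ = _ := by ring
      rw [e]
      refine mul_abs_le_log hC.le hR0 hb0 m hk2 ?_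
      rw [hR, ← mul_assoc]
      exact h k S hS0 β (fun J => abs_div_le_one_of_le (hB1 m J.1 J.2)) m hk1 η hη f g Z hf hg
  rw [← Finset.sum_fiberwise_of_maps_to (g := fun r => r.2.2) (t := Finset.univ)
    (fun _ _ => Finset.mem_univ _)]
  refine (Finset.abs_sum_le_sum_abs _ _).trans ((Finset.sum_le_sum fun η _ => key η).trans ?_)
  rw [Finset.sum_const, Finset.card_univ, nsmul_eq_mul]
  simp
  linarith

lemma exists_abs_diagonal_le {n : ℕ} (hn : 0 < n) {p q : ℝ} (hpq : p.HolderConjugate q) :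
    ∃ C : ℝ, 0 < C ∧ ∀ (F G : Finset (ℕ × (Fin n → ℤ) × (Fin n → Bool))),
      (∀ r ∈ F, 0 < r.1 ∧ r.2.2 ≠ fun _ => false) →
      (∀ r ∈ G, 0 < r.1 ∧ r.2.2 ≠ fun _ => false) →
      ∀ (s : ℕ × (Fin n → ℤ) × (Fin n → Bool) → ℕ × (Fin n → ℤ) × (Fin n → Bool) → ℝ)
        (A : ℝ), 0 ≤ A →
      (∀ θ ζ : Fin n → Bool, (θ ≠ fun _ => false) → (ζ ≠ fun _ => false) →
        ∃ B : (Fin n → ℤ) → ℝ,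
        (∀ m j I, |s (j, I + m, θ) (j, I, ζ)| ≤ B m * ((2:ℝ) ^ j) ^ n) ∧
        (Summable fun m => B m * Real.log (2 + inorm m)) ∧
        ∑' m, B m * Real.log (2 + inorm m) ≤ A) →
      ∀ f g Z, VanishesOff Z f → VanishesOff Z g →
        |∑ x ∈ G ×ˢ F with x.1.1 = x.2.1,
          ((((2:ℝ) ^ x.1.1) ^ n)⁻¹ * haarCoef x.1.1 x.1.2.1 x.1.2.2 g) *
          ((((2:ℝ) ^ x.2.1) ^ n)⁻¹ * haarCoef x.2.1 x.2.2.1 x.2.2.2 f) * s x.1 x.2| ≤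
          C * A * (lpNormOn Z p f * lpNormOn Z q g) := by
  classical
  obtain ⟨C, hC, h⟩ := exists_abs_shiftForm_le hn hpq
  refine ⟨2 ^ n * 2 ^ n * (5 * C), by positivity, fun F G hF hG s A hA hB f g Z hf hg => ?_⟩
  set R := lpNormOn Z p f * lpNormOn Z q g with hR
  have hR0 : 0 ≤ R := mul_nonneg (lpNormOn_nonneg _ _ _) (lpNormOn_nonneg _ _ _)
  set P := (G ×ˢ F).filter fun x => x.1.1 = x.2.1 with hP
  set X : (ℕ × (Fin n → ℤ) × (Fin n → Bool)) × (ℕ × (Fin n → ℤ) × (Fin n → Bool)) → ℝ :=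
    fun x => ((((2:ℝ) ^ x.1.1) ^ n)⁻¹ * haarCoef x.1.1 x.1.2.1 x.1.2.2 g) *
          ((((2:ℝ) ^ x.2.1) ^ n)⁻¹ * haarCoef x.2.1 x.2.2.1 x.2.2.2 f) * s x.1 x.2 with hX
  have hPm : ∀ x ∈ P, x.1 ∈ G ∧ x.2 ∈ F ∧ x.1.1 = x.2.1 := by
    intro x hx
    obtain ⟨h1, h2⟩ := Finset.mem_filter.mp hx
    obtain ⟨h3, h4⟩ := Finset.mem_product.mp h1
    exact ⟨h3, h4, h2⟩
  have key : ∀ θ ζ : Fin n → Bool,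
      |∑ x ∈ P with (x.1.2.2, x.2.2.2) = (θ, ζ), X x| ≤ A * (5 * C * R) := by
    intro θ ζ
    set Q := P.filter fun x => (x.1.2.2, x.2.2.2) = (θ, ζ) with hQ
    have hQm : ∀ x ∈ Q, x.1 ∈ G ∧ x.2 ∈ F ∧ x.1.1 = x.2.1 ∧ x.1.2.2 = θ ∧ x.2.2.2 = ζ := by
      intro x hx
      obtain ⟨h1, h2⟩ := Finset.mem_filter.mp hx
      obtain ⟨h3, h4, h5⟩ := hPm x h1
      rw [Prod.mk.injEq] at h2
      exact ⟨h3, h4, h5, h2⟩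
    rcases Q.eq_empty_or_nonempty with hQ0 | ⟨x₀, hx₀⟩
    · rw [hQ0, Finset.sum_empty, abs_zero]; positivity
    have hθ : θ ≠ fun _ => false := by
      obtain ⟨h1, h2, h3, h4, h5⟩ := hQm x₀ hx₀
      rw [← h4]; exact (hG _ h1).2
    have hζ : ζ ≠ fun _ => false := by
      obtain ⟨h1, h2, h3, h4, h5⟩ := hQm x₀ hx₀
      rw [← h5]; exact (hF _ h2).2
    obtain ⟨B, hB1, hB2, hB3⟩ := hB θ ζ hθ hζ
    have hB1' : ∀ m j I, |s (j, I + m, θ) (j, I, ζ) / ((2:ℝ) ^ j) ^ n| ≤ B m := by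
      intro m j I
      rw [abs_div, abs_of_pos (by positivity : (0:ℝ) < (2 ^ j) ^ n), div_le_iff₀ (by positivity)]
      exact hB1 m j I
    have hb0 : ∀ m, 0 ≤ B m := fun m => (abs_nonneg _).trans (hB1' m 0 0)
    have hfib : ∀ m, |∑ x ∈ Q with x.1.2.1 - x.2.2.1 = m, X x| ≤
        B m * Real.log (2 + inorm m) * (5 * C * R) := by
      intro m
      obtain ⟨k, hk1, hk2⟩ := exists_le_two_pow m
      set Qm := Q.filter fun x => x.1.2.1 - x.2.2.1 = m with hQm'
      have hQmm : ∀ x ∈ Qm, x.1 = (x.2.1, x.2.2.1 + m, θ) ∧ x.2.2.2 = ζ ∧ x.2 ∈ F := by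
        intro x hx
        obtain ⟨h1, h2⟩ := Finset.mem_filter.mp hx
        obtain ⟨h3, h4, h5, h6, h7⟩ := hQm x h1
        refine ⟨Prod.ext h5 (Prod.ext ?_ h6), h7, h4⟩
        rw [← h2]; simp
      set S := Qm.image fun x => (x.2.1, x.2.2.1) with hS
      have hinj : Set.InjOn (fun x : (ℕ × (Fin n → ℤ) × (Fin n → Bool)) ×
          (ℕ × (Fin n → ℤ) × (Fin n → Bool)) => (x.2.1, x.2.2.1)) (Qm : Finset _) := by
        intro x hx x' hx' e
        obtain ⟨a1, a2, _⟩ := hQmm x hx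
        obtain ⟨b1, b2, _⟩ := hQmm x' hx'
        rw [Prod.mk.injEq] at e
        refine Prod.ext ?_ (Prod.ext e.1 (Prod.ext e.2 (a2.trans b2.symm)))
        rw [a1, b1, e.1, e.2]
      have hS0 : ∀ J ∈ S, 0 < J.1 := by
        intro J hJ
        obtain ⟨x, hx, rfl⟩ := Finset.mem_image.mp hJ
        exact (hF x.2 (hQmm x hx).2.2).1
      set β : ℕ × (Fin n → ℤ) → ℝ := fun J =>
        s (J.1, J.2 + m, θ) (J.1, J.2, ζ) / ((2:ℝ) ^ J.1) ^ n / B m with hβ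
      have e : ∑ x ∈ Qm, X x = B m * shiftForm S β 0 m ζ θ f g := by
        rw [shiftForm, hS, Finset.sum_image hinj, Finset.mul_sum]
        refine Finset.sum_congr rfl fun x hx => ?_
        obtain ⟨a1, a2, _⟩ := hQmm x hx
        obtain ⟨x1, j, I, ζ'⟩ := x
        dsimp only at a1 a2
        subst a1 a2
        simp only [X, β, add_zero]
        have := mul_div_self_of_abs_le (hB1' m j I)
        calc _ = (((2:ℝ) ^ j) ^ n)⁻¹ * haarCoef j (I + m) θ g * haarCoef j I ζ' f *
              (s (j, I + m, θ) (j, I, ζ') / ((2:ℝ) ^ j) ^ n) := by ring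
          _ = (((2:ℝ) ^ j) ^ n)⁻¹ * haarCoef j (I + m) θ g * haarCoef j I ζ' f *
              (B m * (s (j, I + m, θ) (j, I, ζ') / ((2:ℝ) ^ j) ^ n / B m)) := by rw [this]
          _ = _ := by ring
      rw [e]
      refine mul_abs_le_log hC.le hR0 (hb0 m) m hk2 ?_
      rw [hR, ← mul_assoc]
      exact h k S hS0 β (fun J => abs_div_le_one_of_le (hB1' m J.1 J.2)) m hk1 ζ θ hζ hθ f g Z hf hg
    rw [← Finset.sum_fiberwise_of_maps_to (g := fun x => x.1.2.1 - x.2.2.1)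
      (t := Q.image fun x => x.1.2.1 - x.2.2.1) (fun x hx => Finset.mem_image_of_mem _ hx)]
    refine (Finset.abs_sum_le_sum_abs _ _).trans ((Finset.sum_le_sum fun m _ => hfib m).trans ?_)
    rw [← Finset.sum_mul]
    refine mul_le_mul_of_nonneg_right (le_trans ?_ hB3) (by positivity)
    refine hB2.sum_le_tsum _ fun m _ => mul_nonneg (hb0 m) (Real.log_nonneg ?_)
    linarith [inorm_nonneg m]
  rw [← Finset.sum_fiberwise_of_maps_to (g := fun x => (x.1.2.2, x.2.2.2)) (t := Finset.univ)
    (fun _ _ => Finset.mem_univ _)]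
  refine (Finset.abs_sum_le_sum_abs _ _).trans
    ((Finset.sum_le_sum fun η _ => key η.1 η.2).trans ?_)
  rw [Finset.sum_const, Finset.card_univ, nsmul_eq_mul]
  simp
  linarith

/-- Linear relations between the functions `haarAt` are respected by `s`. -/
def RespectsHaarRelations {n : ℕ} {α : Type*}
    (s : α → ℕ × (Fin n → ℤ) × (Fin n → Bool) → ℝ) : Prop :=
  ∀ (F G : Finset (ℕ × (Fin n → ℤ) × (Fin n → Bool)))
    (a b : ℕ × (Fin n → ℤ) × (Fin n → Bool) → ℝ), (∀ r ∈ F, 0 < r.1) → (∀ r ∈ G, 0 < r.1) →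
    (∀ z, ∑ r ∈ F, a r * haarAt r z = ∑ r ∈ G, b r * haarAt r z) →
    ∀ q, ∑ r ∈ F, a r * s q r = ∑ r ∈ G, b r * s q r

lemma sum_finer_eq_tsum {n : ℕ} {F : Finset (ℕ × (Fin n → ℤ) × (Fin n → Bool))}
    (hF : ∀ r ∈ F, 0 < r.1 ∧ r.2.2 ≠ fun _ => false)
    {s : ℕ × (Fin n → ℤ) × (Fin n → Bool) → ℕ × (Fin n → ℤ) × (Fin n → Bool) → ℝ}
    (hlin : RespectsHaarRelations s)
    (γ : ℕ × (Fin n → ℤ) × (Fin n → Bool) → ℝ) {Z : Finset (Fin n → ℤ)}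
    (hU : VanishesOff Z fun z => ∑ r ∈ F, γ r * haarAt r z)
    {q : ℕ × (Fin n → ℤ) × (Fin n → Bool)} (hq : 0 < q.1)
    (hs : Summable fun m => s q (q.1, q.2.1 + m, fun _ => false))
    (hs0 : ∑' m, s q (q.1, q.2.1 + m, fun _ => false) = 0) :
    ∑ r ∈ F with q.1 < r.1, γ r * s q r =
      ∑' m, (haarCoef q.1 (q.2.1 + m) (fun _ => false) (fun z => ∑ r ∈ F, γ r * haarAt r z) -
        haarCoef q.1 q.2.1 (fun _ => false) (fun z => ∑ r ∈ F, γ r * haarAt r z)) *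
        (s q (q.1, q.2.1 + m, fun _ => false) / ((2:ℝ) ^ q.1) ^ n) := by
  classical
  set U : (Fin n → ℤ) → ℝ := fun z => ∑ r ∈ F, γ r * haarAt r z with hUdef
  have hinj : Set.InjOn (fun I : Fin n → ℤ => (q.1, I, fun _ : Fin n => false))
      (Z.image (cellIdx q.1) : Finset _) := by
    intro I _ I' _ h
    simpa using h
  have h1 := hlin (F.filter fun r => q.1 < r.1)
    ((Z.image (cellIdx q.1)).image fun I => (q.1, I, fun _ => false)) γ
    (fun r => (((2:ℝ) ^ q.1) ^ n)⁻¹ * haarCoef q.1 r.2.1 (fun _ => false) U)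
    (fun r hr => (hF r (Finset.mem_filter.mp hr).1).1)
    (fun r hr => by
      obtain ⟨I, _, rfl⟩ := Finset.mem_image.mp hr
      exact hq)
    (fun z => by
      rw [← cellAvg_haarSum q.1 hF γ z, cellAvg_eq_sum_haarAt q.1 hU z,
        Finset.sum_image hinj]) q
  rw [h1, Finset.sum_image hinj]
  have h2 := sum_eq_tsum_sub (Y := Z.image (cellIdx q.1))
    (a := fun I => haarCoef q.1 I (fun _ => false) U)
    (s := fun I => s q (q.1, I, fun _ => false) / ((2:ℝ) ^ q.1) ^ n)
    (fun I hI => haarCoef_false_eq_zero q.1 hU hI) q.2.1 (hs.div_const _)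
    (by rw [tsum_div_const, hs0, zero_div])
  rw [← h2]
  refine Finset.sum_congr rfl fun I _ => ?_
  field_simp

lemma exists_abs_sum_finer_le {n : ℕ} (hn : 0 < n) {p q : ℝ} (hpq : p.HolderConjugate q) :
    ∃ C : ℝ, 0 < C ∧ ∀ (F G : Finset (ℕ × (Fin n → ℤ) × (Fin n → Bool))),
      (∀ r ∈ F, 0 < r.1 ∧ r.2.2 ≠ fun _ => false) →
      (∀ r ∈ G, 0 < r.1 ∧ r.2.2 ≠ fun _ => false) →
      ∀ (s : ℕ × (Fin n → ℤ) × (Fin n → Bool) → ℕ × (Fin n → ℤ) × (Fin n → Bool) → ℝ)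
        (A : ℝ), 0 ≤ A → RespectsHaarRelations s →
      (∀ η : Fin n → Bool, (η ≠ fun _ => false) → ∀ j, 0 < j → ∀ I,
        (Summable fun m => s (j, I, η) (j, I + m, fun _ => false)) ∧
        ∑' m, s (j, I, η) (j, I + m, fun _ => false) = 0) →
      (∀ η : Fin n → Bool, (η ≠ fun _ => false) → ∃ B : (Fin n → ℤ) → ℝ,
        (∀ m j I, |s (j, I, η) (j, I + m, fun _ => false)| ≤ B m * ((2:ℝ) ^ j) ^ n) ∧
        (Summable fun m => B m * Real.log (2 + inorm m)) ∧
        ∑' m, B m * Real.log (2 + inorm m) ≤ A) →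
      ∀ (γ δ : ℕ × (Fin n → ℤ) × (Fin n → Bool) → ℝ) (Z : Finset (Fin n → ℤ)),
        (VanishesOff Z fun z => ∑ r ∈ F, γ r * haarAt r z) →
        (VanishesOff Z fun z => ∑ r ∈ G, δ r * haarAt r z) →
        |∑ q ∈ G, ∑ r ∈ F with q.1 < r.1, δ q * γ r * s q r| ≤
          C * A * (lpNormOn Z p (fun z => ∑ r ∈ F, γ r * haarAt r z) *
            lpNormOn Z q fun z => ∑ r ∈ G, δ r * haarAt r z) := by
  classical
  obtain ⟨C, hC, h⟩ := exists_abs_paraproduct_le hn hpq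
  refine ⟨C, hC, fun F G hF hG s A hA hlin hsum hB γ δ Z hU hW => ?_⟩
  have hsq : ∀ r ∈ G, (Summable fun m => s r (r.1, r.2.1 + m, fun _ => false)) ∧
      ∑' m, s r (r.1, r.2.1 + m, fun _ => false) = 0 := fun r hr =>
    hsum r.2.2 (hG r hr).2 r.1 (hG r hr).1 r.2.1
  have key := h G hG (fun r m => s r (r.1, r.2.1 + m, fun _ => false) / ((2:ℝ) ^ r.1) ^ n) A hA
    (fun r hr => (hsq r hr).1.div_const _)
    (fun η hη => by
      obtain ⟨B, hB1, hB2, hB3⟩ := hB η hη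
      refine ⟨B, fun m j I => ?_, hB2, hB3⟩
      have hV : 0 < ((2:ℝ) ^ j) ^ n := by positivity
      rw [abs_div, abs_of_pos hV, div_le_iff₀ hV]
      exact hB1 m j I) _ _ Z hU hW
  convert key using 2
  refine Finset.sum_congr rfl fun r hr => ?_
  rw [haarCoef_haarSum hG δ hr, inv_mul_cancel_left₀ (by positivity),
    ← sum_finer_eq_tsum hF hlin γ hU (hG r hr).1 (hsq r hr).1 (hsq r hr).2, Finset.mul_sum]
  exact Finset.sum_congr rfl fun _ _ => by ring

lemma exists_abs_haarForm_le {n : ℕ} (hn : 0 < n) {p q : ℝ} (hpq : p.HolderConjugate q) :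
    ∃ C : ℝ, 0 < C ∧ ∀ (F G : Finset (ℕ × (Fin n → ℤ) × (Fin n → Bool))),
      (∀ r ∈ F, 0 < r.1 ∧ r.2.2 ≠ fun _ => false) →
      (∀ r ∈ G, 0 < r.1 ∧ r.2.2 ≠ fun _ => false) →
      ∀ (s : ℕ × (Fin n → ℤ) × (Fin n → Bool) → ℕ × (Fin n → ℤ) × (Fin n → Bool) → ℝ)
        (A : ℝ), 0 ≤ A → RespectsHaarRelations s → RespectsHaarRelations (fun q r => s r q) →
      (∀ η : Fin n → Bool, (η ≠ fun _ => false) → ∀ j, 0 < j → ∀ I,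
        (Summable fun m => s (j, I, η) (j, I + m, fun _ => false)) ∧
        ∑' m, s (j, I, η) (j, I + m, fun _ => false) = 0) →
      (∀ η : Fin n → Bool, (η ≠ fun _ => false) → ∀ j, 0 < j → ∀ I,
        (Summable fun m => s (j, I + m, fun _ => false) (j, I, η)) ∧
        ∑' m, s (j, I + m, fun _ => false) (j, I, η) = 0) →
      (∀ θ ζ : Fin n → Bool, ¬ (θ = (fun _ => false) ∧ ζ = fun _ => false) →
        ∃ B : (Fin n → ℤ) → ℝ,
        (∀ m j I, |s (j, I + m, θ) (j, I, ζ)| ≤ B m * ((2:ℝ) ^ j) ^ n) ∧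
        (Summable fun m => B m * Real.log (2 + inorm m)) ∧
        ∑' m, B m * Real.log (2 + inorm m) ≤ A) →
      ∀ (γ δ : ℕ × (Fin n → ℤ) × (Fin n → Bool) → ℝ) (Z : Finset (Fin n → ℤ)),
        (VanishesOff Z fun z => ∑ r ∈ F, γ r * haarAt r z) →
        (VanishesOff Z fun z => ∑ r ∈ G, δ r * haarAt r z) →
        |∑ q ∈ G, ∑ r ∈ F, δ q * γ r * s q r| ≤
          C * A * (lpNormOn Z p (fun z => ∑ r ∈ F, γ r * haarAt r z) *
            lpNormOn Z q fun z => ∑ r ∈ G, δ r * haarAt r z) := by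
  classical
  obtain ⟨C₁, hC₁, h₁⟩ := exists_abs_sum_finer_le hn hpq
  obtain ⟨C₂, hC₂, h₂⟩ := exists_abs_sum_finer_le hn hpq.symm
  obtain ⟨C₃, hC₃, h₃⟩ := exists_abs_diagonal_le hn hpq
  refine ⟨C₁ + C₂ + C₃, by positivity,
    fun F G hF hG s A hA hlin hlin' hsum hsum' hB γ δ Z hU hW => ?_⟩
  have k₁ := h₁ F G hF hG s A hA hlin hsum (fun η hη => by
    obtain ⟨B, hB1, hB2, hB3⟩ := hB η (fun _ => false) (fun e => hη e.1)
    refine ⟨fun m => B (-m), fun m j I => ?_, ?_, ?_⟩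
    · simpa using hB1 (-m) j (I + m)
    · simpa [Function.comp_def, inorm_neg] using (Equiv.neg (Fin n → ℤ)).summable_iff.mpr hB2
    · refine le_trans (le_of_eq ?_) hB3
      rw [← (Equiv.neg (Fin n → ℤ)).tsum_eq]
      simp [inorm_neg]) γ δ Z hU hW
  have k₂ := h₂ G F hG hF (fun q r => s r q) A hA hlin' hsum'
    (fun η hη => hB (fun _ => false) η (fun e => hη e.2)) δ γ Z hW hU
  have k₃ := h₃ F G hF hG s A hA (fun θ ζ hθ _ => hB θ ζ (fun e => hθ e.1)) _ _ Z hU hW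
  have e₃ : ∑ x ∈ G ×ˢ F with x.1.1 = x.2.1,
          ((((2:ℝ) ^ x.1.1) ^ n)⁻¹ * haarCoef x.1.1 x.1.2.1 x.1.2.2
            (fun z => ∑ r ∈ G, δ r * haarAt r z)) *
          ((((2:ℝ) ^ x.2.1) ^ n)⁻¹ * haarCoef x.2.1 x.2.2.1 x.2.2.2
            (fun z => ∑ r ∈ F, γ r * haarAt r z)) * s x.1 x.2 =
      ∑ q ∈ G, ∑ r ∈ F with q.1 = r.1, δ q * γ r * s q r := by
    rw [Finset.sum_filter, Finset.sum_product]
    refine Finset.sum_congr rfl fun q hq => ?_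
    rw [Finset.sum_filter]
    refine Finset.sum_congr rfl fun r hr => ?_
    dsimp only
    rw [haarCoef_haarSum hG δ hq, haarCoef_haarSum hF γ hr,
      inv_mul_cancel_left₀ (by positivity), inv_mul_cancel_left₀ (by positivity)]
  have e₂ : ∑ q ∈ F, ∑ r ∈ G with q.1 < r.1, γ q * δ r * s r q =
      ∑ q ∈ G, ∑ r ∈ F with r.1 < q.1, δ q * γ r * s q r := by
    simp only [Finset.sum_filter]
    rw [Finset.sum_comm]
    simp only [mul_comm (γ _)]
  have e : ∑ q ∈ G, ∑ r ∈ F, δ q * γ r * s q r =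
      (∑ q ∈ G, ∑ r ∈ F with q.1 < r.1, δ q * γ r * s q r) +
      (∑ q ∈ G, ∑ r ∈ F with r.1 < q.1, δ q * γ r * s q r) +
      ∑ q ∈ G, ∑ r ∈ F with q.1 = r.1, δ q * γ r * s q r := by
    simp only [Finset.sum_filter, ← Finset.sum_add_distrib]
    refine Finset.sum_congr rfl fun q _ => Finset.sum_congr rfl fun r _ => ?_
    rcases lt_trichotomy q.1 r.1 with h | h | h
    · simp [h, h.not_gt, h.ne]
    · simp [h]
    · simp [h, h.not_gt, h.ne']
  rw [e₃] at k₃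
  rw [e₂, mul_comm (lpNormOn Z q _)] at k₂
  rw [e]
  refine (abs_add_three _ _ _).trans ((add_le_add_three k₁ k₂ k₃).trans (le_of_eq ?_))
  ring

/-- Real points are mapped to the indices of the cubes of generation `K` containing them. -/
def floorMap {n : ℕ} (K : ℤ) (x : Fin n → ℝ) : Fin n → ℤ := fun i => ⌊(2:ℝ) ^ K * x i⌋

/-- The normalising constant of the Haar functions of generation `k`. -/
def haarHeight (n : ℕ) (k : ℤ) : ℝ := (Real.sqrt ((2:ℝ) ^ (-k)))⁻¹ ^ n

lemma haarHeight_pos (n : ℕ) (k : ℤ) : 0 < haarHeight n k := by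
  unfold haarHeight
  positivity

lemma haarHeight_sq (n : ℕ) (k : ℤ) : haarHeight n k * haarHeight n k = ((2:ℝ) ^ k) ^ n := by
  unfold haarHeight
  rw [← mul_pow, ← mul_inv, Real.mul_self_sqrt (by positivity), zpow_neg, inv_inv]

lemma floor_zpow_sub_mul (K : ℤ) (j : ℕ) (t : ℝ) :
    ⌊(2:ℝ) ^ (K - j) * t⌋ = ⌊(2:ℝ) ^ K * t⌋ / 2 ^ j := by
  have h : (2:ℝ) ^ (K - j) * t = (2:ℝ) ^ K * t / ((2 ^ j : ℕ) : ℝ) := by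
    rw [zpow_sub₀ two_ne_zero, zpow_natCast]
    push_cast
    ring
  rw [h, Int.floor_div_natCast]
  push_cast
  rfl

lemma mem_Ico_zpow_iff (k : ℤ) (a b t : ℝ) :
    t ∈ Set.Ico ((2:ℝ) ^ (-k) * a) ((2:ℝ) ^ (-k) * b) ↔
      a ≤ (2:ℝ) ^ k * t ∧ (2:ℝ) ^ k * t < b := by
  have h : (0:ℝ) < 2 ^ k := by positivity
  rw [zpow_neg, Set.mem_Ico, inv_mul_le_iff₀ h, ← div_eq_inv_mul, lt_div_iff₀ h, mul_comm t]

lemma haar1D_eq (K : ℤ) {j : ℕ} (hj : 0 < j) (m : ℤ) (η : Bool) (t : ℝ) :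
    haar1D (K - j) m η t = (Real.sqrt ((2:ℝ) ^ (-(K - (j:ℤ)))))⁻¹ *
      (if ⌊(2:ℝ) ^ K * t⌋ / 2 ^ j = m then
        (if η then haarSign j ⌊(2:ℝ) ^ K * t⌋ else 1) else 0) := by
  classical
  unfold haar1D
  congr 1
  obtain ⟨i, rfl⟩ : ∃ i, j = i + 1 := ⟨j - 1, by omega⟩
  set k : ℤ := K - ((i + 1 : ℕ) : ℤ) with hk
  have hki : K - (i:ℤ) = k + 1 := by rw [hk]; push_cast; ring
  set z := ⌊(2:ℝ) ^ K * t⌋ with hz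
  set y := z / 2 ^ i with hy
  have hy' : ⌊(2:ℝ) ^ (k + 1) * t⌋ = y := by rw [← hki, floor_zpow_sub_mul]
  have hyb := Int.floor_eq_iff.mp hy'
  rw [zpow_add_one₀ two_ne_zero] at hyb
  have h1 : z / 2 ^ (i + 1) = y / 2 := by
    rw [hy, pow_succ, Int.ediv_ediv_of_nonneg (by positivity)]
  have h2 : 2 * z / 2 ^ (i + 1) = y := by
    rw [pow_succ, mul_comm (2 ^ i : ℤ), Int.mul_ediv_mul_of_pos _ _ two_pos]
  rw [haarSign, h1, h2]
  have c0 : (t ∈ Set.Ico ((2:ℝ) ^ (-k) * m) ((2:ℝ) ^ (-k) * (m + 1))) ↔ y / 2 = m := by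
    rw [mem_Ico_zpow_iff, ← h1, ← floor_zpow_sub_mul, Int.floor_eq_iff]
  have c1 : (t ∈ Set.Ico ((2:ℝ) ^ (-k) * m) ((2:ℝ) ^ (-k) * (m + 1/2))) ↔ y = 2 * m := by
    rw [mem_Ico_zpow_iff, ← hy', Int.floor_eq_iff, zpow_add_one₀ two_ne_zero]
    push_cast
    constructor <;> rintro ⟨a, b⟩ <;> constructor <;> linarith
  have c2 : (t ∈ Set.Ico ((2:ℝ) ^ (-k) * (m + 1/2)) ((2:ℝ) ^ (-k) * (m + 1))) ↔
      y = 2 * m + 1 := by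
    rw [mem_Ico_zpow_iff, ← hy', Int.floor_eq_iff, zpow_add_one₀ two_ne_zero]
    push_cast
    constructor <;> rintro ⟨a, b⟩ <;> constructor <;> linarith
  simp only [Set.indicator_apply, c0, c1, c2, Pi.one_apply]
  by_cases hη : η = true
  · simp only [hη, if_true]
    split_ifs <;> first | omega | norm_num
  · simp [hη]

lemma haarFn_eq {n : ℕ} (K : ℤ) {j : ℕ} (hj : 0 < j) (I : Fin n → ℤ) (η : Fin n → Bool)
    (x : Fin n → ℝ) :
    haarFn n (K - j) I η x = haarHeight n (K - j) * haarAt (j, I, η) (floorMap K x) := by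
  classical
  unfold haarFn haarHeight haarAt haarSigns
  simp only [haar1D_eq K hj]
  rw [Finset.prod_mul_distrib, Finset.prod_const, Finset.card_univ, Fintype.card_fin]
  congr 1
  rw [Finset.prod_ite_zero]
  simp only [Finset.mem_univ, true_imp_iff, cellIdx, floorMap, funext_iff]

lemma measurableSet_floorMap_preimage {n : ℕ} (K : ℤ) (z : Fin n → ℤ) :
    MeasurableSet (floorMap K ⁻¹' {z}) := by
  have h : Measurable (floorMap K : (Fin n → ℝ) → _) :=
    measurable_pi_lambda _ fun i => Int.measurable_floor.comp
      ((measurable_pi_apply i).const_mul _)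
  exact h (measurableSet_singleton z)

lemma volume_floorMap_preimage {n : ℕ} (K : ℤ) (z : Fin n → ℤ) :
    volume (floorMap K ⁻¹' {z}) = ENNReal.ofReal (((2:ℝ) ^ (-K)) ^ n) := by
  have h : floorMap K ⁻¹' {z} = Set.pi Set.univ fun i =>
      Set.Ico ((2:ℝ) ^ (-K) * z i) ((2:ℝ) ^ (-K) * (z i + 1)) := by
    ext x
    simp only [Set.mem_preimage, Set.mem_singleton_iff, Set.mem_pi, Set.mem_univ, true_imp_iff,
      mem_Ico_zpow_iff, funext_iff, floorMap, Int.floor_eq_iff]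
  rw [h, Real.volume_pi_Ico]
  simp only [← mul_sub, add_sub_cancel_left, mul_one, Finset.prod_const, Finset.card_univ,
    Fintype.card_fin]
  rw [ENNReal.ofReal_pow (by positivity)]

lemma eLpNorm_comp_floorMap {n : ℕ} (K : ℤ) {p : ℝ} (hp : 0 < p) {u : (Fin n → ℤ) → ℝ}
    {Z : Finset (Fin n → ℤ)} (hu : VanishesOff Z u) :
    eLpNorm (fun x => u (floorMap K x)) (ENNReal.ofReal p) volume =
      ENNReal.ofReal ((((2:ℝ) ^ (-K)) ^ n) ^ (1 / p) * lpNormOn Z p u) := by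
  classical
  have h1 : ∀ x, ‖u (floorMap K x)‖ₑ ^ p =
      ∑ z ∈ Z, (floorMap K ⁻¹' {z}).indicator (fun _ => ENNReal.ofReal (|u z| ^ p)) x := by
    intro x
    simp only [Set.indicator_apply, Set.mem_preimage, Set.mem_singleton_iff]
    rw [Finset.sum_ite_eq, Real.enorm_eq_ofReal_abs, ENNReal.ofReal_rpow_of_nonneg
      (abs_nonneg _) hp.le]
    split_ifs with h
    · rfl
    · rw [hu _ h, abs_zero, Real.zero_rpow hp.ne', ENNReal.ofReal_zero]
  have h2 : ∀ z ∈ Z, 0 ≤ |u z| ^ p := fun z _ => by positivity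
  rw [eLpNorm_eq_lintegral_rpow_enorm_toReal (by simpa using hp) ENNReal.ofReal_ne_top,
    ENNReal.toReal_ofReal hp.le]
  simp only [h1]
  rw [lintegral_finsetSum _ fun z _ =>
    measurable_const.indicator (measurableSet_floorMap_preimage K z)]
  simp only [lintegral_indicator_const (measurableSet_floorMap_preimage K _),
    volume_floorMap_preimage]
  rw [← Finset.sum_mul, ← ENNReal.ofReal_sum_of_nonneg h2,
    ← ENNReal.ofReal_mul (Finset.sum_nonneg h2),
    ENNReal.ofReal_rpow_of_nonneg (mul_nonneg (Finset.sum_nonneg h2) (by positivity))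
      (by positivity), Real.mul_rpow (Finset.sum_nonneg h2) (by positivity), mul_comm, lpNormOn]

/-- The pairings of a family with the images of its members under `T` respect linear relations
in the second slot, provided `T` is linear on finite combinations. -/
lemma sum_pairing_eq_right {n : ℕ} {α : Type*} {H : α → (Fin n → ℝ) → ℝ}
    {T : ((Fin n → ℝ) → ℝ) → (Fin n → ℝ) → ℝ}
    (hT : ∀ (F : Finset α) (c : α → ℝ),
      T (fun x => ∑ q ∈ F, c q * H q x) =ᵐ[volume] fun x => ∑ q ∈ F, c q * T (H q) x)
    (hpairInt : ∀ q r, Integrable (fun x => H q x * T (H r) x) volume) (F : Finset α) (c : α → ℝ)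
    (q : α) :
    pairing (H q) (T fun x => ∑ r ∈ F, c r * H r x) = ∑ r ∈ F, c r * pairing (H q) (T (H r)) := by
  have h : pairing (H q) (T fun x => ∑ r ∈ F, c r * H r x) =
      ∫ x, ∑ r ∈ F, c r * (H q x * T (H r) x) := by
    refine integral_congr_ae ?_
    filter_upwards [hT F c] with x hx
    rw [hx, Finset.mul_sum]
    exact Finset.sum_congr rfl fun _ _ => by ring
  rw [h, integral_finsetSum _ fun r _ => (hpairInt q r).const_mul _]
  exact Finset.sum_congr rfl fun r _ => integral_const_mul _ _

lemma pairing_sum_left {n : ℕ} {α : Type*} {H : α → (Fin n → ℝ) → ℝ} {u : (Fin n → ℝ) → ℝ}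
    (hpairInt : ∀ q, Integrable (fun x => H q x * u x) volume) (G : Finset α) (d : α → ℝ) :
    pairing (fun x => ∑ q ∈ G, d q * H q x) u = ∑ q ∈ G, d q * pairing (H q) u := by
  have h : pairing (fun x => ∑ q ∈ G, d q * H q x) u = ∫ x, ∑ q ∈ G, d q * (H q x * u x) := by
    refine integral_congr_ae (Filter.Eventually.of_forall fun x => ?_)
    simp only [Finset.sum_mul, mul_assoc]
  rw [h, integral_finsetSum _ fun r _ => (hpairInt r).const_mul _]
  exact Finset.sum_congr rfl fun r _ => integral_const_mul _ _

/-- Linearity on finite combinations of a family passes to injectively reindexed families. -/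
lemma linear_comp_of_injective {n : ℕ} {α β : Type*} {H : α → (Fin n → ℝ) → ℝ}
    {T : ((Fin n → ℝ) → ℝ) → (Fin n → ℝ) → ℝ}
    (hT : ∀ (F : Finset α) (c : α → ℝ),
      T (fun x => ∑ q ∈ F, c q * H q x) =ᵐ[volume] fun x => ∑ q ∈ F, c q * T (H q) x)
    {e : β → α} (he : Function.Injective e) (F : Finset β) (c : β → ℝ) :
    T (fun x => ∑ q ∈ F, c q * H (e q) x) =ᵐ[volume]
      fun x => ∑ q ∈ F, c q * T (H (e q)) x := by
  have h := hT (F.map ⟨e, he⟩) (Function.extend e c 0)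
  simpa [Finset.sum_map, he.extend_apply] using h

/-- The Haar index of generation `K - j` corresponding to the discrete index at level `j`. -/
def haarIdx {n : ℕ} (K : ℤ) (r : ℕ × (Fin n → ℤ) × (Fin n → Bool)) :
    ℤ × (Fin n → ℤ) × (Fin n → Bool) := (K - r.1, r.2)

lemma haarIdx_injective {n : ℕ} (K : ℤ) : Function.Injective (haarIdx (n := n) K) := by
  intro q r h
  rw [haarIdx, haarIdx, Prod.mk.injEq] at h
  exact Prod.ext (by omega) h.2

lemma exists_map_haarIdx {n : ℕ} (K : ℤ) (F : Finset (ℤ × (Fin n → ℤ) × (Fin n → Bool)))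
    (hK : ∀ q ∈ F, q.1 < K) :
    ∃ F' : Finset (ℕ × (Fin n → ℤ) × (Fin n → Bool)),
      F = F'.map ⟨haarIdx K, haarIdx_injective K⟩ ∧ ∀ r ∈ F', 0 < r.1 ∧ haarIdx K r ∈ F := by
  classical
  have hcancel : ∀ q ∈ F, haarIdx K ((K - q.1).toNat, q.2) = q := by
    intro q hq
    have := hK q hq
    refine Prod.ext ?_ rfl
    simp only [haarIdx]
    omega
  refine ⟨F.image fun q => ((K - q.1).toNat, q.2), ?_, fun r hr => ?_⟩
  · ext q
    simp only [Finset.mem_map, Finset.mem_image, Function.Embedding.coeFn_mk]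
    constructor
    · exact fun hq => ⟨_, ⟨q, hq, rfl⟩, hcancel q hq⟩
    · rintro ⟨_, ⟨q', hq', rfl⟩, rfl⟩
      rwa [hcancel q' hq']
  · obtain ⟨q, hq, rfl⟩ := Finset.mem_image.mp hr
    have := hK q hq
    rw [hcancel q hq]
    exact ⟨by simp only; omega, hq⟩

lemma exists_generation_bound {n : ℕ} (F : Finset (ℤ × (Fin n → ℤ) × (Fin n → Bool))) :
    ∃ K : ℤ, ∀ q ∈ F, q.1 < K := by
  classical
  obtain ⟨M, hM⟩ := (F.image Prod.fst).bddAbove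
  refine ⟨M + 1, fun q hq => ?_⟩
  have : q.1 ≤ M := hM (by exact_mod_cast Finset.mem_image_of_mem Prod.fst hq)
  omega

lemma haarSum_vanishesOff {n : ℕ} {F : Finset (ℕ × (Fin n → ℤ) × (Fin n → Bool))}
    {Z : Finset (Fin n → ℤ)} (h : ∀ r ∈ F, cell r.1 r.2.1 ⊆ Z)
    (c : ℕ × (Fin n → ℤ) × (Fin n → Bool) → ℝ) :
    VanishesOff Z fun z => ∑ r ∈ F, c r * haarAt r z := fun z hz =>
  Finset.sum_eq_zero fun r hr => by
    rw [haarAt_vanishesOff r z fun hz' => hz (h r hr hz'), mul_zero]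

/-- The Haar function of generation `K - j` corresponding to the discrete index at level `j`. -/
def haarFnAt {n : ℕ} (K : ℤ) (r : ℕ × (Fin n → ℤ) × (Fin n → Bool)) : (Fin n → ℝ) → ℝ :=
  haarFn n (K - r.1) r.2.1 r.2.2

/-- The pairings of Haar functions with their images, renormalised for the functions `haarAt`. -/
def haarMatrix {n : ℕ} (K : ℤ) (T : ((Fin n → ℝ) → ℝ) → (Fin n → ℝ) → ℝ)
    (q r : ℕ × (Fin n → ℤ) × (Fin n → Bool)) : ℝ :=
  ((2:ℝ) ^ K) ^ n / (haarHeight n (K - q.1) * haarHeight n (K - r.1)) *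
    pairing (haarFnAt K q) (T (haarFnAt K r))

lemma haarMatrix_same_level {n : ℕ} (K : ℤ) (T : ((Fin n → ℝ) → ℝ) → (Fin n → ℝ) → ℝ)
    (j : ℕ) (I J : Fin n → ℤ) (θ ζ : Fin n → Bool) :
    haarMatrix K T (j, I, θ) (j, J, ζ) = ((2:ℝ) ^ j) ^ n *
      pairing (haarFn n (K - j) I θ) (T (haarFn n (K - j) J ζ)) := by
  have e : ((2:ℝ) ^ K) ^ n / (haarHeight n (K - j) * haarHeight n (K - j)) =
      ((2:ℝ) ^ j) ^ n := by
    rw [haarHeight_sq, ← div_pow, ← zpow_sub₀ two_ne_zero, sub_sub_cancel, zpow_natCast]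
  rw [haarMatrix, e, haarFnAt, haarFnAt]

lemma sum_mul_haarFnAt_eq {n : ℕ} (K : ℤ) {F : Finset (ℕ × (Fin n → ℤ) × (Fin n → Bool))}
    (hF : ∀ r ∈ F, 0 < r.1) (c : ℕ × (Fin n → ℤ) × (Fin n → Bool) → ℝ) (x : Fin n → ℝ) :
    ∑ r ∈ F, c r * haarFnAt K r x =
      ∑ r ∈ F, c r * haarHeight n (K - r.1) * haarAt r (floorMap K x) :=
  Finset.sum_congr rfl fun r hr => by rw [haarFnAt, haarFn_eq K (hF r hr), mul_assoc]

lemma sum_div_mul_haarFnAt_eq {n : ℕ} (K : ℤ)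
    {F : Finset (ℕ × (Fin n → ℤ) × (Fin n → Bool))}
    (hF : ∀ r ∈ F, 0 < r.1) (c : ℕ × (Fin n → ℤ) × (Fin n → Bool) → ℝ) (x : Fin n → ℝ) :
    ∑ r ∈ F, c r / haarHeight n (K - r.1) * haarFnAt K r x =
      ∑ r ∈ F, c r * haarAt r (floorMap K x) := by
  rw [sum_mul_haarFnAt_eq K hF]
  exact Finset.sum_congr rfl fun r _ => by rw [div_mul_cancel₀ _ (haarHeight_pos _ _).ne']

lemma haarMatrix_respectsHaarRelations {n : ℕ} {T : ((Fin n → ℝ) → ℝ) → (Fin n → ℝ) → ℝ} (K : ℤ)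
    (hT : ∀ (F : Finset (ℕ × (Fin n → ℤ) × (Fin n → Bool)))
      (c : ℕ × (Fin n → ℤ) × (Fin n → Bool) → ℝ),
      T (fun x => ∑ q ∈ F, c q * haarFnAt K q x) =ᵐ[volume]
        fun x => ∑ q ∈ F, c q * T (haarFnAt K q) x)
    (hpairInt : ∀ q r : ℕ × (Fin n → ℤ) × (Fin n → Bool),
      Integrable (fun x => haarFnAt K q x * T (haarFnAt K r) x) volume) :
    RespectsHaarRelations (haarMatrix K T) := by
  intro F G a b hF hG h q
  have key : ∀ (F : Finset (ℕ × (Fin n → ℤ) × (Fin n → Bool)))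
      (a : ℕ × (Fin n → ℤ) × (Fin n → Bool) → ℝ), (∀ r ∈ F, 0 < r.1) →
      ∑ r ∈ F, a r * haarMatrix K T q r = ((2:ℝ) ^ K) ^ n / haarHeight n (K - q.1) *
        pairing (haarFnAt K q) (T fun x => ∑ r ∈ F, a r * haarAt r (floorMap K x)) := by
    intro F a hF
    simp only [← sum_div_mul_haarFnAt_eq K hF]
    rw [sum_pairing_eq_right hT hpairInt F (fun r => a r / haarHeight n (K - r.1)) q, Finset.mul_sum]
    refine Finset.sum_congr rfl fun r _ => ?_
    rw [haarMatrix]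
    have := haarHeight_pos n (K - r.1)
    have := haarHeight_pos n (K - q.1)
    field_simp
  rw [key F a hF, key G b hG]
  simp only [h]

lemma haarMatrix_respectsHaarRelations_left {n : ℕ} {T : ((Fin n → ℝ) → ℝ) → (Fin n → ℝ) → ℝ}
    (K : ℤ)
    (hpairInt : ∀ q r : ℕ × (Fin n → ℤ) × (Fin n → Bool),
      Integrable (fun x => haarFnAt K q x * T (haarFnAt K r) x) volume) :
    RespectsHaarRelations fun q r => haarMatrix K T r q := by
  intro F G a b hF hG h q
  have key : ∀ (F : Finset (ℕ × (Fin n → ℤ) × (Fin n → Bool)))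
      (a : ℕ × (Fin n → ℤ) × (Fin n → Bool) → ℝ), (∀ r ∈ F, 0 < r.1) →
      ∑ r ∈ F, a r * haarMatrix K T r q = ((2:ℝ) ^ K) ^ n / haarHeight n (K - q.1) *
        pairing (fun x => ∑ r ∈ F, a r * haarAt r (floorMap K x)) (T (haarFnAt K q)) := by
    intro F a hF
    simp only [← sum_div_mul_haarFnAt_eq K hF]
    rw [pairing_sum_left (fun r => hpairInt r q) F (fun r => a r / haarHeight n (K - r.1)),
      Finset.mul_sum]
    refine Finset.sum_congr rfl fun r _ => ?_
    rw [haarMatrix]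
    have := haarHeight_pos n (K - r.1)
    have := haarHeight_pos n (K - q.1)
    field_simp
  dsimp only
  rw [key F a hF, key G b hG]
  simp only [h]

/-- Figiel's T(1) theorem (Lemma 5.2): an operator on the span of the Haar system with
`T1 = T*1 = 0` and summable Haar-coefficient bounds is bounded on `L^p`. -/
theorem statement12 (n : ℕ) (hn : 0 < n) (p : ℝ) (hp : 1 < p) :
    ∃ C : ℝ, 0 < C ∧
      ∀ A : ℝ, 0 ≤ A →
      ∀ T : ((Fin n → ℝ) → ℝ) → ((Fin n → ℝ) → ℝ),
        -- T takes values in L¹_loc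
        (∀ (k : ℤ) (mI : Fin n → ℤ) (η : Fin n → Bool),
          LocallyIntegrable (T (haarFn n k mI η)) volume) →
        -- T is linear on the span of the Haar functions
        (∀ (F : Finset (ℤ × (Fin n → ℤ) × (Fin n → Bool)))
            (c : ℤ × (Fin n → ℤ) × (Fin n → Bool) → ℝ),
          T (fun x => ∑ q ∈ F, c q * haarFn n q.1 q.2.1 q.2.2 x) =ᵐ[volume]
            fun x => ∑ q ∈ F, c q * T (haarFn n q.1 q.2.1 q.2.2) x) →
        -- all the pairings ⟨h^θ_J, T h^ζ_I⟩ are defined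
        (∀ (kJ : ℤ) (mJ : Fin n → ℤ) (θ : Fin n → Bool) (k : ℤ) (mI : Fin n → ℤ)
            (ζ : Fin n → Bool),
          Integrable (fun x => haarFn n kJ mJ θ x * T (haarFn n k mI ζ) x) volume) →
        -- (i): T*1 = 0
        (∀ (k : ℤ) (mI : Fin n → ℤ) (η : Fin n → Bool), η ≠ (fun _ => false) →
          Summable (fun m : Fin n → ℤ =>
            |pairing (haarZero n k (mI + m)) (T (haarFn n k mI η))|) ∧
          (∑' m : Fin n → ℤ, pairing (haarZero n k (mI + m)) (T (haarFn n k mI η))) = 0) →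
        -- (i): T1 = 0
        (∀ (k : ℤ) (mI : Fin n → ℤ) (η : Fin n → Bool), η ≠ (fun _ => false) →
          Summable (fun m : Fin n → ℤ =>
            |pairing (haarFn n k mI η) (T (haarZero n k (mI + m)))|) ∧
          (∑' m : Fin n → ℤ, pairing (haarFn n k mI η) (T (haarZero n k (mI + m)))) = 0) →
        -- (ii): the weighted series of suprema of Haar coefficients is at most A
        (∀ θ ζ : Fin n → Bool, ¬(θ = (fun _ => false) ∧ ζ = (fun _ => false)) →
          ∃ B : (Fin n → ℤ) → ℝ,
            (∀ (m : Fin n → ℤ) (k : ℤ) (mI : Fin n → ℤ),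
              |pairing (haarFn n k (mI + m) θ) (T (haarFn n k mI ζ))| ≤ B m) ∧
            Summable (fun m : Fin n → ℤ => B m * Real.log (2 + inorm m)) ∧
            (∑' m : Fin n → ℤ, B m * Real.log (2 + inorm m)) ≤ A) →
      ∀ (F : Finset (ℤ × (Fin n → ℤ) × (Fin n → Bool)))
          (c : ℤ × (Fin n → ℤ) × (Fin n → Bool) → ℝ),
        (∀ q ∈ F, q.2.2 ≠ (fun _ => false)) →
      ∀ (G : Finset (ℤ × (Fin n → ℤ) × (Fin n → Bool)))
          (d : ℤ × (Fin n → ℤ) × (Fin n → Bool) → ℝ),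
        (∀ q ∈ G, q.2.2 ≠ (fun _ => false)) →
      ∀ f g : (Fin n → ℝ) → ℝ,
        (f = fun x => ∑ q ∈ F, c q * haarFn n q.1 q.2.1 q.2.2 x) →
        (g = fun x => ∑ q ∈ G, d q * haarFn n q.1 q.2.1 q.2.2 x) →
        ENNReal.ofReal |pairing g (T f)| ≤
          ENNReal.ofReal (C * A) * eLpNorm f (ENNReal.ofReal p) volume *
            eLpNorm g (ENNReal.ofReal (p / (p - 1))) volume := by
  classical
  have hpq : p.HolderConjugate (p / (p - 1)) := Real.HolderConjugate.conjExponent hp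
  obtain ⟨C, hC, key⟩ := exists_abs_haarForm_le hn hpq
  refine ⟨C, hC, fun A hA T _ hlin hpairInt hTs hT1 hB F c hF G d hG f g hf hg => ?_⟩
  obtain ⟨K, hK⟩ := exists_generation_bound (F ∪ G)
  obtain ⟨F', rfl, hF'⟩ :=
    exists_map_haarIdx K F fun q hq => hK q (Finset.mem_union_left _ hq)
  obtain ⟨G', rfl, hG'⟩ :=
    exists_map_haarIdx K G fun q hq => hK q (Finset.mem_union_right _ hq)
  have hF0 : ∀ r ∈ F', 0 < r.1 ∧ r.2.2 ≠ fun _ => false := fun r hr =>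
    ⟨(hF' r hr).1, hF _ (hF' r hr).2⟩
  have hG0 : ∀ r ∈ G', 0 < r.1 ∧ r.2.2 ≠ fun _ => false := fun r hr =>
    ⟨(hG' r hr).1, hG _ (hG' r hr).2⟩
  have hTlin := linear_comp_of_injective
    (H := fun q : ℤ × (Fin n → ℤ) × (Fin n → Bool) => haarFn n q.1 q.2.1 q.2.2) hlin
    (haarIdx_injective K)
  have hpairInt' : ∀ q r : ℕ × (Fin n → ℤ) × (Fin n → Bool),
      Integrable (fun x => haarFnAt K q x * T (haarFnAt K r) x) volume := fun q r =>
    hpairInt _ _ _ _ _ _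
  set γ : ℕ × (Fin n → ℤ) × (Fin n → Bool) → ℝ := fun r =>
    c (haarIdx K r) * haarHeight n (K - r.1) with hγ
  set δ : ℕ × (Fin n → ℤ) × (Fin n → Bool) → ℝ := fun r =>
    d (haarIdx K r) * haarHeight n (K - r.1) with hδ
  set Z : Finset (Fin n → ℤ) := (F' ∪ G').biUnion fun r => cell r.1 r.2.1 with hZ
  have hU : VanishesOff Z fun z => ∑ r ∈ F', γ r * haarAt r z :=
    haarSum_vanishesOff (fun r hr => Finset.subset_biUnion_of_mem
      (fun r : ℕ × (Fin n → ℤ) × (Fin n → Bool) => cell r.1 r.2.1)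
      (Finset.mem_union_left _ hr)) γ
  have hW : VanishesOff Z fun z => ∑ r ∈ G', δ r * haarAt r z :=
    haarSum_vanishesOff (fun r hr => Finset.subset_biUnion_of_mem
      (fun r : ℕ × (Fin n → ℤ) × (Fin n → Bool) => cell r.1 r.2.1)
      (Finset.mem_union_right _ hr)) δ
  have hf' : f = fun x => ∑ r ∈ F', c (haarIdx K r) * haarFnAt K r x := by
    rw [hf]; funext x; rw [Finset.sum_map]; rfl
  have hg' : g = fun x => ∑ r ∈ G', d (haarIdx K r) * haarFnAt K r x := by
    rw [hg]; funext x; rw [Finset.sum_map]; rfl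
  have hfU : f = fun x => (fun z => ∑ r ∈ F', γ r * haarAt r z) (floorMap K x) := by
    rw [hf']; funext x; exact sum_mul_haarFnAt_eq K (fun r hr => (hF0 r hr).1) _ x
  have hgW : g = fun x => (fun z => ∑ r ∈ G', δ r * haarAt r z) (floorMap K x) := by
    rw [hg']; funext x; exact sum_mul_haarFnAt_eq K (fun r hr => (hG0 r hr).1) _ x
  have hsum : ∀ η : Fin n → Bool, (η ≠ fun _ => false) → ∀ j : ℕ, 0 < j → ∀ I,
      (Summable fun m => haarMatrix K T (j, I, η) (j, I + m, fun _ => false)) ∧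
      ∑' m, haarMatrix K T (j, I, η) (j, I + m, fun _ => false) = 0 := by
    intro η hη j _ I
    obtain ⟨h1, h2⟩ := hT1 (K - j) I η hη
    simp only [haarMatrix_same_level]
    refine ⟨h1.of_abs.mul_left _, ?_⟩
    rw [tsum_mul_left]
    exact mul_eq_zero_of_right _ h2
  have hsum' : ∀ η : Fin n → Bool, (η ≠ fun _ => false) → ∀ j : ℕ, 0 < j → ∀ I,
      (Summable fun m => haarMatrix K T (j, I + m, fun _ => false) (j, I, η)) ∧
      ∑' m, haarMatrix K T (j, I + m, fun _ => false) (j, I, η) = 0 := by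
    intro η hη j _ I
    obtain ⟨h1, h2⟩ := hTs (K - j) I η hη
    simp only [haarMatrix_same_level]
    refine ⟨h1.of_abs.mul_left _, ?_⟩
    rw [tsum_mul_left]
    exact mul_eq_zero_of_right _ h2
  have hbd : ∀ θ ζ : Fin n → Bool, ¬ (θ = (fun _ => false) ∧ ζ = fun _ => false) →
      ∃ B : (Fin n → ℤ) → ℝ,
      (∀ m j I, |haarMatrix K T (j, I + m, θ) (j, I, ζ)| ≤ B m * ((2:ℝ) ^ j) ^ n) ∧
      (Summable fun m => B m * Real.log (2 + inorm m)) ∧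
      ∑' m, B m * Real.log (2 + inorm m) ≤ A := by
    intro θ ζ h
    obtain ⟨B, hB1, hB2, hB3⟩ := hB θ ζ h
    refine ⟨B, fun m j I => ?_, hB2, hB3⟩
    rw [haarMatrix_same_level, abs_mul, abs_of_pos (by positivity), mul_comm]
    exact mul_le_mul_of_nonneg_right (hB1 m (K - j) I) (by positivity)
  have hmain := key F' G' hF0 hG0 (haarMatrix K T) A hA
    (haarMatrix_respectsHaarRelations K hTlin hpairInt')
    (haarMatrix_respectsHaarRelations_left K hpairInt')
    hsum hsum' hbd γ δ Z hU hW
  set U : (Fin n → ℤ) → ℝ := fun z => ∑ r ∈ F', γ r * haarAt r z with hUdef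
  set W : (Fin n → ℤ) → ℝ := fun z => ∑ r ∈ G', δ r * haarAt r z with hWdef
  have hpair : pairing g (T f) =
      ((2:ℝ) ^ (-K)) ^ n * ∑ q ∈ G', ∑ r ∈ F', δ q * γ r * haarMatrix K T q r := by
    have hq : ∀ q, pairing (haarFnAt K q) (T f) =
        ∑ r ∈ F', c (haarIdx K r) * pairing (haarFnAt K q) (T (haarFnAt K r)) := fun q => by
      rw [hf']
      exact sum_pairing_eq_right hTlin hpairInt' F' (fun r => c (haarIdx K r)) q
    have hintf : ∀ q, Integrable (fun x => haarFnAt K q x * T f x) volume := fun q => by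
      have h : Integrable (fun x => ∑ r ∈ F', c (haarIdx K r) *
          (haarFnAt K q x * T (haarFnAt K r) x)) volume :=
        integrable_finsetSum _ fun r _ => (hpairInt' q r).const_mul _
      refine h.congr ?_
      filter_upwards [hTlin F' fun r => c (haarIdx K r)] with x hx
      rw [hf']
      refine Eq.trans ?_ (congrArg (haarFnAt K q x * ·) hx.symm)
      rw [Finset.mul_sum]
      exact Finset.sum_congr rfl fun _ _ => mul_left_comm _ _ _
    rw [hg', pairing_sum_left hintf, Finset.mul_sum]
    refine Finset.sum_congr rfl fun q _ => ?_
    rw [hq, Finset.mul_sum, Finset.mul_sum]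
    refine Finset.sum_congr rfl fun r _ => ?_
    have h1 := haarHeight_pos n (K - q.1)
    have h2 := haarHeight_pos n (K - r.1)
    simp only [hγ, hδ, haarMatrix]
    rw [zpow_neg, inv_pow]
    field_simp
  have hq0 : 0 < p / (p - 1) := hpq.symm.pos
  have hv : (0:ℝ) < ((2:ℝ) ^ (-K)) ^ n := by positivity
  have hfn := eLpNorm_comp_floorMap K hpq.pos hU
  have hgn := eLpNorm_comp_floorMap K hq0 hW
  rw [← hfU] at hfn
  rw [← hgW] at hgn
  have hLU := lpNormOn_nonneg Z p U
  have hLW := lpNormOn_nonneg Z (p / (p - 1)) W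
  have hvv : (((2:ℝ) ^ (-K)) ^ n) ^ (1 / p) * (((2:ℝ) ^ (-K)) ^ n) ^ (1 / (p / (p - 1))) =
      ((2:ℝ) ^ (-K)) ^ n := by
    rw [← Real.rpow_add hv, one_div, one_div, hpq.inv_add_inv_eq_one, Real.rpow_one]
  rw [hfn, hgn, ← ENNReal.ofReal_mul (by positivity), ← ENNReal.ofReal_mul (by positivity)]
  refine ENNReal.ofReal_le_ofReal ?_
  rw [hpair, abs_mul, abs_of_pos hv]
  refine (mul_le_mul_of_nonneg_left hmain hv.le).trans (le_of_eq ?_)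
  calc _ = (((2:ℝ) ^ (-K)) ^ n) * (C * A * (lpNormOn Z p U * lpNormOn Z (p / (p - 1)) W)) := rfl
    _ = ((((2:ℝ) ^ (-K)) ^ n) ^ (1 / p) * (((2:ℝ) ^ (-K)) ^ n) ^ (1 / (p / (p - 1)))) *
        (C * A * (lpNormOn Z p U * lpNormOn Z (p / (p - 1)) W)) := by rw [hvv]
    _ = _ := by ring

end
end

section
/- Let T be a Calderón–Zygmund operator with normalised standard kernel of Hölder exponent γ, and let s ∈ ℕ. Then for every L ∈ 𝒟 and ζ ∈ {0,1}ⁿ∖{0}, with y_L the centre of L and C depending only on n, γ: |T_{4·2^s ℓ(L)} h^ζ_L(x)| ≤ C [ ℓ(L)^{γ+n/2} |x−y_L|^{−n−γ} · 1{|x−y_L| > 3·2^s ℓ(L)} + ℓ(L)^{n/2} |x−y_L|^{−n} · 1{ | |x−y_L| − 4·2^s ℓ(L) | < ℓ(L) } ] for a.e. x ∈ ℝⁿ. -/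
open MeasureTheory

noncomputable section

lemma sideLen_pos (k : ℤ) : 0 < sideLen k := by
  unfold sideLen; positivity

lemma indR_of {P : Prop} (h : P) : indR P = 1 := if_pos h

lemma indR_nonneg (P : Prop) : 0 ≤ indR P := by
  unfold indR; split_ifs <;> norm_num

lemma measurable_haar1D (k m : ℤ) (η : Bool) : Measurable (haar1D k m η) := by
  unfold haar1D
  cases η
  · simpa using (measurable_one.indicator measurableSet_Ico).const_mul _
  · simpa using ((measurable_one.indicator measurableSet_Ico).sub
      (measurable_one.indicator measurableSet_Ico)).const_mul _

lemma abs_haar1D_le (k m : ℤ) (η : Bool) (t : ℝ) :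
    |haar1D k m η t| ≤ (Real.sqrt (sideLen k))⁻¹ := by
  have hl : 0 < (2:ℝ) ^ (-k) := by positivity
  have h0 : 0 ≤ (Real.sqrt ((2:ℝ) ^ (-k)))⁻¹ := by positivity
  unfold haar1D sideLen
  rw [abs_mul, abs_of_nonneg h0]
  refine mul_le_of_le_one_right h0 ?_
  cases η
  · simp only [Set.indicator, Bool.false_eq_true, if_false]
    split_ifs <;> simp
  · simp only [Set.indicator, if_true, Set.mem_Ico]
    split_ifs with h1 h2
    · linarith [h1.2, h2.1]
    all_goals simp

lemma haar1D_eq_zero {k m : ℤ} {η : Bool} {t : ℝ}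
    (ht : sideLen k / 2 < |t - sideLen k * (m + 1 / 2)|) : haar1D k m η t = 0 := by
  have hl := sideLen_pos k
  unfold haar1D
  change (Real.sqrt (sideLen k))⁻¹ * (if η = true then
    (Set.Ico (sideLen k * m) (sideLen k * (m + 1/2))).indicator 1 t
      - (Set.Ico (sideLen k * (m + 1/2)) (sideLen k * (m + 1))).indicator 1 t
    else (Set.Ico (sideLen k * m) (sideLen k * (m + 1))).indicator 1 t) = 0
  rw [lt_abs] at ht
  have h1 : t ∉ Set.Ico (sideLen k * m) (sideLen k * (m + 1 / 2)) := by
    rintro ⟨h1, h2⟩; rcases ht with h | h <;> nlinarith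
  have h2 : t ∉ Set.Ico (sideLen k * (m + 1 / 2)) (sideLen k * (m + 1)) := by
    rintro ⟨h1, h2⟩; rcases ht with h | h <;> nlinarith
  have h3 : t ∉ Set.Ico (sideLen k * m) (sideLen k * (m + 1)) := by
    rintro ⟨h1, h2⟩; rcases ht with h | h <;> nlinarith
  rw [Set.indicator_of_notMem h1, Set.indicator_of_notMem h2, Set.indicator_of_notMem h3]
  simp

lemma integral_haar1D_true (k m : ℤ) : ∫ t, haar1D k m true t = 0 := by
  have hl : 0 < (2:ℝ) ^ (-k) := by positivity
  have hi : ∀ a b : ℝ, Integrable ((Set.Ico a b).indicator (1 : ℝ → ℝ)) := fun a b =>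
    (integrable_indicator_iff measurableSet_Ico).2
      (integrableOn_const (by simp) (by simp))
  simp only [haar1D, if_true]
  rw [integral_const_mul, integral_sub (hi _ _) (hi _ _),
    integral_indicator_one measurableSet_Ico, integral_indicator_one measurableSet_Ico]
  simp only [measureReal_def, Real.volume_Ico]
  ring_nf

lemma measurable_haarFn (n : ℕ) (k : ℤ) (m : Fin n → ℤ) (ζ : Fin n → Bool) :
    Measurable (haarFn n k m ζ) := by
  unfold haarFn
  exact Finset.measurable_prod _ fun i _ =>
    (measurable_haar1D k (m i) (ζ i)).comp (measurable_pi_apply i)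

lemma abs_haarFn_le (n : ℕ) (k : ℤ) (m : Fin n → ℤ) (ζ : Fin n → Bool) (y : Fin n → ℝ) :
    |haarFn n k m ζ y| ≤ (Real.sqrt (sideLen k))⁻¹ ^ n := by
  unfold haarFn
  rw [Finset.abs_prod]
  calc ∏ i, |haar1D k (m i) (ζ i) (y i)|
      ≤ ∏ _i : Fin n, (Real.sqrt (sideLen k))⁻¹ :=
        Finset.prod_le_prod (fun _ _ => abs_nonneg _) fun _ _ => abs_haar1D_le _ _ _ _
    _ = _ := by simp

lemma haarFn_eq_zero {n : ℕ} {k : ℤ} {m : Fin n → ℤ} {ζ : Fin n → Bool} {y : Fin n → ℝ}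
    (hy : sideLen k / 2 < dist y (cubeCenter n k m)) : haarFn n k m ζ y = 0 := by
  by_contra hne
  refine absurd hy (not_lt.2 ?_)
  refine (dist_pi_le_iff (by linarith [sideLen_pos k])).2 fun i => ?_
  by_contra! h
  exact hne (Finset.prod_eq_zero (Finset.mem_univ i) (haar1D_eq_zero h))

lemma integral_haarFn_eq_zero {n : ℕ} (k : ℤ) (m : Fin n → ℤ) {ζ : Fin n → Bool}
    (hζ : ζ ≠ fun _ => false) : ∫ y, haarFn n k m ζ y = 0 := by
  obtain ⟨i, hi⟩ := Function.ne_iff.1 hζ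
  unfold haarFn
  rw [integral_fintype_prod_volume_eq_prod (fun i => haar1D k (m i) (ζ i))]
  refine Finset.prod_eq_zero (Finset.mem_univ i) ?_
  rw [Bool.eq_true_of_not_eq_false hi]
  exact integral_haar1D_true _ _

/-- A product with a Haar function, whose other factor is bounded by `a` on the cube, has set
integrals at most `a` times the `L¹` norm of the Haar function. -/
lemma abs_setIntegral_mul_haarFn_le {n : ℕ} (k : ℤ) (m : Fin n → ℤ) (ζ : Fin n → Bool)
    {A : Set (Fin n → ℝ)} (hA : MeasurableSet A) {g : (Fin n → ℝ) → ℝ} {a : ℝ} (ha : 0 ≤ a)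
    (hg : ∀ y ∈ A, dist y (cubeCenter n k m) ≤ sideLen k / 2 → |g y| ≤ a) :
    |∫ y in A, g y * haarFn n k m ζ y| ≤ a * sideLen k ^ ((n:ℝ) / 2) := by
  have hl := sideLen_pos k
  set c := cubeCenter n k m
  set M := a * (Real.sqrt (sideLen k))⁻¹ ^ n
  have hM : 0 ≤ M := by positivity
  have hint : Integrable ((Metric.closedBall c (sideLen k / 2)).indicator fun _ => M) :=
    (integrable_indicator_iff measurableSet_closedBall).2
      (integrableOn_const measure_closedBall_lt_top.ne (by simp))
  have hbound : ∀ y ∈ A, ‖g y * haarFn n k m ζ y‖ ≤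
      (Metric.closedBall c (sideLen k / 2)).indicator (fun _ => M) y := by
    intro y hyA
    by_cases hy : dist y c ≤ sideLen k / 2
    · rw [Set.indicator_of_mem (Metric.mem_closedBall.2 hy), Real.norm_eq_abs, abs_mul]
      exact mul_le_mul (hg y hyA hy) (abs_haarFn_le _ _ _ _ _) (abs_nonneg _) ha
    · rw [haarFn_eq_zero (not_le.1 hy), mul_zero, norm_zero]
      exact Set.indicator_nonneg (fun _ _ => hM) _
  have hs : 0 < Real.sqrt (sideLen k) := Real.sqrt_pos.2 hl
  have hpow : (Real.sqrt (sideLen k))⁻¹ ^ n * sideLen k ^ n = sideLen k ^ ((n:ℝ) / 2) := by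
    rw [← mul_pow]
    nth_rewrite 2 [← Real.mul_self_sqrt hl.le]
    rw [inv_mul_cancel_left₀ hs.ne', Real.sqrt_eq_rpow, ← Real.rpow_mul_natCast hl.le]
    congr 1
    ring
  calc |∫ y in A, g y * haarFn n k m ζ y|
      ≤ ∫ y in A, (Metric.closedBall c (sideLen k / 2)).indicator (fun _ => M) y :=
        norm_integral_le_of_norm_le hint.integrableOn
          ((ae_restrict_iff' hA).2 (Filter.Eventually.of_forall hbound))
    _ ≤ ∫ y, (Metric.closedBall c (sideLen k / 2)).indicator (fun _ => M) y :=
        setIntegral_le_integral hint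
          (Filter.Eventually.of_forall fun _ => Set.indicator_nonneg (fun _ _ => hM) _)
    _ = a * sideLen k ^ ((n:ℝ) / 2) := by
        rw [integral_indicator_const _ measurableSet_closedBall, measureReal_def,
          Real.volume_pi_closedBall _ (by positivity), ENNReal.toReal_ofReal (by positivity),
          mul_div_cancel₀ _ two_ne_zero, Fintype.card_fin, smul_eq_mul, ← hpow]
        simp only [M]
        ring

lemma integrable_haarFn (n : ℕ) (k : ℤ) (m : Fin n → ℤ) (ζ : Fin n → Bool) :
    Integrable (haarFn n k m ζ) := by
  refine (integrableOn_iff_integrable_of_support_subset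
    (s := Metric.closedBall (cubeCenter n k m) (sideLen k / 2)) ?_).1 ?_
  · intro y hy
    by_contra h
    exact hy (haarFn_eq_zero (not_le.1 h))
  · exact IntegrableOn.of_bound measure_closedBall_lt_top
      (measurable_haarFn n k m ζ).aestronglyMeasurable _
      (Filter.Eventually.of_forall fun y => abs_haarFn_le n k m ζ y)

/-- Far from the cube, the cancellation of the Haar function gains a factor from the Hölder
regularity of the kernel. -/
lemma abs_integral_kernel_mul_haarFn_le {n : ℕ} {γ : ℝ} (hγ : 0 < γ)
    {K : (Fin n → ℝ) → (Fin n → ℝ) → ℝ} (hK : IsNormalisedKernel n γ K)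
    (k : ℤ) (m : Fin n → ℤ) {ζ : Fin n → Bool} (hζ : ζ ≠ fun _ => false) {x : Fin n → ℝ}
    (hx : sideLen k < dist x (cubeCenter n k m)) :
    |∫ y, K x y * haarFn n k m ζ y| ≤
      sideLen k ^ (γ + (n:ℝ) / 2) * dist x (cubeCenter n k m) ^ (-(n:ℝ) - γ) := by
  have hl := sideLen_pos k
  set c := cubeCenter n k m
  by_cases hint : Integrable fun y => K x y * haarFn n k m ζ y
  swap
  · rw [integral_undef hint, abs_zero]
    positivity
  have heq : ∫ y, K x y * haarFn n k m ζ y = ∫ y, (K x y - K x c) * haarFn n k m ζ y := by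
    simp_rw [sub_mul]
    rw [integral_sub hint ((integrable_haarFn n k m ζ).const_mul _), integral_const_mul,
      integral_haarFn_eq_zero k m hζ, mul_zero, sub_zero]
  have hg : ∀ y ∈ Set.univ, dist y c ≤ sideLen k / 2 →
      |K x y - K x c| ≤ sideLen k ^ γ * dist x c ^ (-(n:ℝ) - γ) := by
    intro y _ hy
    rw [dist_eq_norm] at hy
    have := hK.smooth x c (y - c) (by linarith)
    rw [add_sub_cancel] at this
    refine (le_add_of_nonneg_left (abs_nonneg _)).trans (this.trans ?_)
    gcongr
    linarith
  rw [heq, ← setIntegral_univ, Real.rpow_add hl]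
  refine (abs_setIntegral_mul_haarFn_le k m ζ MeasurableSet.univ (by positivity) hg).trans_eq ?_
  ring

/-- Lemma 5.3: pointwise bound for the truncated singular integral of a Haar function. -/
theorem statement13 (n : ℕ) (hn : 0 < n) (γ : ℝ) (hγ0 : 0 < γ) (hγ1 : γ ≤ 1) :
    ∃ C : ℝ, 0 < C ∧
      ∀ K : (Fin n → ℝ) → (Fin n → ℝ) → ℝ, IsNormalisedKernel n γ K →
      ∀ (s : ℕ) (k : ℤ) (mL : Fin n → ℤ) (ζ : Fin n → Bool), ζ ≠ (fun _ => false) →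
        ∀ᵐ x ∂(volume : Measure (Fin n → ℝ)),
          |czTrunc K (4 * 2^s * sideLen k) (haarFn n k mL ζ) x| ≤
            C * (indR (3 * 2^s * sideLen k < dist x (cubeCenter n k mL)) *
                  (sideLen k ^ (γ + (n:ℝ)/2) * dist x (cubeCenter n k mL) ^ (-(n:ℝ) - γ)) +
                indR (|dist x (cubeCenter n k mL) - 4 * 2^s * sideLen k| < sideLen k) *
                  (sideLen k ^ ((n:ℝ)/2) * dist x (cubeCenter n k mL) ^ (-(n:ℝ)))) := by
  refine ⟨2 ^ n, by positivity, fun K hK s k mL ζ hζ => Filter.Eventually.of_forall fun x => ?_⟩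
  have hl := sideLen_pos k
  have hs : sideLen k ≤ 2 ^ s * sideLen k := le_mul_of_one_le_left hl.le (one_le_pow₀ one_le_two)
  set ℓ := sideLen k
  set c := cubeCenter n k mL
  have hA : MeasurableSet {y | 4 * 2 ^ s * ℓ < dist x y} :=
    measurableSet_lt measurable_const (measurable_const.dist measurable_id)
  have hfar : 0 ≤ indR (3 * 2 ^ s * ℓ < dist x c) *
      (ℓ ^ (γ + (n:ℝ) / 2) * dist x c ^ (-(n:ℝ) - γ)) :=
    mul_nonneg (indR_nonneg _) (by positivity)
  have hnear : 0 ≤ indR (|dist x c - 4 * 2 ^ s * ℓ| < ℓ) *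
      (ℓ ^ ((n:ℝ) / 2) * dist x c ^ (-(n:ℝ))) :=
    mul_nonneg (indR_nonneg _) (by positivity)
  have hC : (1:ℝ) ≤ 2 ^ n := one_le_pow₀ one_le_two
  unfold czTrunc
  rcases lt_or_ge (4 * 2 ^ s * ℓ + ℓ / 2) (dist x c) with hd | hd
  · rw [setIntegral_eq_integral_of_forall_compl_eq_zero]
    · refine (abs_integral_kernel_mul_haarFn_le hγ0 hK k mL hζ (by linarith)).trans ?_
      rw [indR_of (show 3 * 2 ^ s * ℓ < dist x c by linarith), one_mul] at hfar ⊢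
      exact (le_add_of_nonneg_right hnear).trans
        (le_mul_of_one_le_left (add_nonneg hfar hnear) hC)
    · intro y hy
      have hy : dist x y ≤ 4 * 2 ^ s * ℓ := not_lt.1 hy
      rw [haarFn_eq_zero, mul_zero]
      linarith [dist_triangle x y c]
  rcases lt_or_ge (dist x c) (4 * 2 ^ s * ℓ - ℓ / 2) with hd' | hd'
  · rw [setIntegral_eq_zero_of_forall_eq_zero, abs_zero]
    · exact mul_nonneg (by positivity) (add_nonneg hfar hnear)
    · intro y (hy : 4 * 2 ^ s * ℓ < dist x y)
      rw [haarFn_eq_zero, mul_zero]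
      linarith [dist_triangle_right x y c]
  · have hdpos : 0 < dist x c := by linarith
    have hg : ∀ y ∈ {y | 4 * 2 ^ s * ℓ < dist x y}, dist y c ≤ ℓ / 2 →
        |K x y| ≤ 2 ^ n * dist x c ^ (-(n:ℝ)) := by
      intro y _ hy
      have hxy : dist x c / 2 ≤ dist x y := by linarith [dist_triangle x y c]
      have hpos : 0 < dist x y := by linarith
      refine (hK.size x y (dist_pos.1 hpos)).trans ?_
      rw [Real.rpow_neg dist_nonneg, Real.rpow_neg dist_nonneg, Real.rpow_natCast,
        Real.rpow_natCast, ← div_eq_mul_inv, ← inv_div, ← div_pow]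
      gcongr
    refine (abs_setIntegral_mul_haarFn_le k mL ζ hA (by positivity) hg).trans ?_
    rw [indR_of (show |dist x c - 4 * 2 ^ s * ℓ| < ℓ by rw [abs_lt]; constructor <;> linarith),
      one_mul]
    calc 2 ^ n * dist x c ^ (-(n:ℝ)) * ℓ ^ ((n:ℝ) / 2)
        = 2 ^ n * (ℓ ^ ((n:ℝ) / 2) * dist x c ^ (-(n:ℝ))) := by ring
      _ ≤ _ := mul_le_mul_of_nonneg_left (le_add_of_nonneg_left hfar) (by positivity)

end
end
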